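/- Let O be an order in a quartic number field. Then the number of monogenizations of O is at most 2760; that is, the set of equivalence classes of elements α ∈ O with O = ℤ[α] (under the equivalence α ~ ±α + c, c ∈ ℤ) is finite and has cardinality at most 2760. -/

import Mathlib

/-- A monogenizer of an order `O` in a number field `K` (an `ℤ`-subalgebra of `K`
consisting of algebraic integers and spanning `K` over `ℚ`) is an element `α ∈ O`
with `ℤ[α] = O`. -/
def IsMonogenizer {K : Type*} [Field K] (O : Subalgebra ℤ K) (α : K) : Prop :=
  α ∈ O ∧ Algebra.adjoin ℤ ({α} : Set K) = O

/-- Two monogenizers are equivalent if `α' = ±α + c` for some `c ∈ ℤ`. -/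
def MonogenizerRel {K : Type*} [Field K] (O : Subalgebra ℤ K)
    (α β : {x : K // IsMonogenizer O x}) : Prop :=
  ∃ c : ℤ, (β : K) = (α : K) + (c : K) ∨ (β : K) = -(α : K) + (c : K)

/-- The type of monogenizations of `O`: equivalence classes of monogenizers. -/
def Monogenizations {K : Type*} [Field K] (O : Subalgebra ℤ K) : Type _ :=
  Quot (MonogenizerRel O)


section PadeAlgebra

open PowerSeries Finset

variable {k : Type*} [Field k]

/-- The power series of `(δ + X)⁻⁽ʳ⁺¹⁾`. -/
noncomputable def invPow (r : ℕ) (δ : k) : k⟦X⟧ :=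
  PowerSeries.mk fun a => (-1) ^ a * ((r + a).choose r : k) * (δ⁻¹) ^ (r + 1 + a)

theorem invPow_mul (r : ℕ) {δ : k} (hδ : δ ≠ 0) :
    invPow r δ * (C δ + X) ^ (r + 1) = 1 := by
  have h1 : invPow r δ = C (δ⁻¹ ^ (r + 1)) *
      rescale (-δ⁻¹) (PowerSeries.mk fun a => ((r + a).choose r : k)) := by
    ext a
    simp only [invPow, coeff_mk, coeff_C_mul, coeff_rescale]
    rw [neg_pow, pow_add]
    ring
  have h2 : (C δ + X : k⟦X⟧) = C δ * rescale (-δ⁻¹) (1 - X) := by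
    rw [map_sub, map_one, rescale_X, mul_sub, ← mul_assoc, ← map_mul]
    simp [hδ]
  have h3 : (PowerSeries.mk fun a => ((r + a).choose r : k)) * (1 - X) ^ (r + 1) = 1 :=
    mk_add_choose_mul_one_sub_pow_eq_one k r
  have h4 := congrArg (rescale (-δ⁻¹)) h3
  rw [map_mul, map_one, map_pow] at h4
  rw [h1, h2, mul_pow]
  calc _ = C (δ⁻¹ ^ (r + 1)) * C δ ^ (r + 1) * (rescale (-δ⁻¹)
        (PowerSeries.mk fun a => ((r + a).choose r : k)) * rescale (-δ⁻¹) (1 - X) ^ (r + 1)) := by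
          ring
    _ = 1 := by
      rw [h4, mul_one, ← map_pow, ← map_mul, ← mul_pow, inv_mul_cancel₀ hδ, one_pow, map_one]

variable {ι : Type*} [Fintype ι] [DecidableEq ι]

/-- The local expansion at `e i` of the inverse of `∏ l ≠ i, (z - e l) ^ (r + 1)`. -/
noncomputable def locInv (r : ℕ) (e : ι → k) (i : ι) : k⟦X⟧ :=
  ∏ l ∈ univ.erase i, invPow r (e i - e l)

/-- The local expansion at `e i` of `∏ l ≠ i, (z - e l)`. -/
noncomputable def locProd (e : ι → k) (i : ι) : k⟦X⟧ :=
  ∏ l ∈ univ.erase i, (C (e i - e l) + X)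

theorem locInv_mul (r : ℕ) {e : ι → k} (he : Function.Injective e) (i : ι) :
    locInv r e i * locProd e i ^ (r + 1) = 1 := by
  rw [locInv, locProd, ← prod_pow, ← prod_mul_distrib]
  refine prod_eq_one fun l hl => invPow_mul r ?_
  rw [sub_ne_zero]
  exact fun h => (ne_of_mem_erase hl) (he h).symm

/-- The coefficients at `e i` of `p / ∏ l ≠ i, (z - e l) ^ (r + 1)`. -/
noncomputable def locCoeff (r : ℕ) (e : ι → k) (p : Polynomial k) (i : ι) (j : ℕ) : k :=
  coeff j ((Polynomial.taylor (e i) p : k⟦X⟧) * locInv r e i)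

variable [CharZero k]

/-- The residue at `e i` of `(h - g z) ^ (r + ν) p / ∏ (z - e l) ^ (r + 1)`, divided by the
`ν`-th power of `H i = h - g (e i)`. -/
noncomputable def padeRes (ν : ℚ) (r : ℕ) (g : k) (H e : ι → k) (p : Polynomial k) (i : ι) : k :=
  ∑ m ∈ range (r + 1), ((Ring.choose ((r : ℚ) + ν) m : ℚ) : k) * (-g) ^ m * H i ^ (r - m) *
    locCoeff r e p i (r - m)

end PadeAlgebra

section PadeVanishing

open PowerSeries Finset

variable {k : Type*} [Field k] {ι : Type*} [Fintype ι] [DecidableEq ι]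

theorem coe_taylor_prod_erase (e : ι → k) (i : ι) :
    ((Polynomial.taylor (e i) (∏ l ∈ univ.erase i, (Polynomial.X - Polynomial.C (e l))) :
      Polynomial k) : k⟦X⟧) = locProd e i := by
  have h : Polynomial.taylor (e i) (∏ l ∈ univ.erase i, (Polynomial.X - Polynomial.C (e l))) =
      ∏ l ∈ univ.erase i, (Polynomial.C (e i - e l) + Polynomial.X) := by
    change Polynomial.taylorAlgHom (e i) _ = _
    rw [map_prod]
    refine prod_congr rfl fun l _ => ?_
    change Polynomial.taylor (e i) _ = _
    rw [map_sub, Polynomial.taylor_X, Polynomial.taylor_C, map_sub]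
    ring
  rw [h, locProd, ← Polynomial.coeToPowerSeries.ringHom_apply, map_prod]
  simp

/-- `(X - C a) ^ n` divides `p` when the Taylor expansion of `p` at `a` starts in degree `n`. -/
theorem X_sub_C_pow_dvd_of_taylor {p : Polynomial k} {a : k} {n : ℕ}
    (h : (X : k⟦X⟧) ^ n ∣ (Polynomial.taylor a p : Polynomial k)) :
    (Polynomial.X - Polynomial.C a) ^ n ∣ p := by
  have h1 : (Polynomial.X : Polynomial k) ^ n ∣ Polynomial.taylor a p := by
    rw [Polynomial.X_pow_dvd_iff]
    intro d hd
    have := (PowerSeries.X_pow_dvd_iff.1 h) d hd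
    simpa using this
  obtain ⟨q, hq⟩ := h1
  refine ⟨Polynomial.taylor (-a) q, ?_⟩
  have := congrArg (Polynomial.taylor (-a)) hq
  rw [Polynomial.taylor_taylor, neg_add_cancel, Polynomial.taylor_zero, Polynomial.taylor_mul,
    Polynomial.taylor_pow, Polynomial.taylor_X, map_neg, ← sub_eq_add_neg] at this
  exact this

/-- The sum of the residues of `p / ∏ (z - e l) ^ (r + 1)` vanishes when the degree of `p` is at
most the degree of the denominator minus two. -/
theorem sum_locCoeff_eq_zero (r : ℕ) {e : ι → k} (he : Function.Injective e) {p : Polynomial k}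
    (hp : p.natDegree + 2 ≤ Fintype.card ι * (r + 1)) :
    ∑ i, locCoeff r e p i r = 0 := by
  classical
  set N : ι → Polynomial k := fun i => ∑ j ∈ range (r + 1),
    Polynomial.C (locCoeff r e p i j) * (Polynomial.X - Polynomial.C (e i)) ^ j with hN
  set P : ι → Polynomial k := fun i => ∏ l ∈ univ.erase i, (Polynomial.X - Polynomial.C (e l))
    with hP
  have hNdeg : ∀ i, (N i).natDegree ≤ r := fun i => by
    refine Polynomial.natDegree_sum_le_of_forall_le _ _ fun j hj => ?_
    refine (Polynomial.natDegree_C_mul_le _ _).trans ?_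
    rw [Polynomial.natDegree_pow, Polynomial.natDegree_X_sub_C]
    have := mem_range.1 hj
    omega
  have hNcoeff : ∀ i, (N i).coeff r = locCoeff r e p i r := fun i => by
    rw [hN, Polynomial.finsetSum_coeff, sum_range_succ, sum_eq_zero, zero_add,
      Polynomial.coeff_C_mul]
    · have : ((Polynomial.X - Polynomial.C (e i)) ^ r).coeff r = 1 := by
        have h1 : ((Polynomial.X - Polynomial.C (e i)) ^ r).Monic :=
          (Polynomial.monic_X_sub_C _).pow r
        have h2 : ((Polynomial.X - Polynomial.C (e i)) ^ r).natDegree = r := by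
          rw [Polynomial.natDegree_pow, Polynomial.natDegree_X_sub_C, mul_one]
        simpa [Polynomial.Monic, Polynomial.leadingCoeff, h2] using h1
      rw [this, mul_one]
    · intro j hj
      refine Polynomial.coeff_eq_zero_of_natDegree_lt ?_
      refine (Polynomial.natDegree_C_mul_le _ _).trans_lt ?_
      rw [Polynomial.natDegree_pow, Polynomial.natDegree_X_sub_C]
      have := mem_range.1 hj
      omega
  have hPmonic : ∀ i, (P i).Monic := fun i =>
    Polynomial.monic_prod_of_monic _ _ fun l _ => Polynomial.monic_X_sub_C _
  have hPdeg : ∀ i, (P i).natDegree + 1 = Fintype.card ι := fun i => by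
    rw [hP, Polynomial.natDegree_prod_of_monic _ _ fun l _ => Polynomial.monic_X_sub_C _]
    simp only [Polynomial.natDegree_X_sub_C, sum_const, smul_eq_mul, mul_one]
    rw [card_erase_add_one (mem_univ i), card_univ]
  have hPpow : ∀ i, (P i ^ (r + 1)).natDegree + (r + 1) = Fintype.card ι * (r + 1) := fun i => by
    rw [(hPmonic i).natDegree_pow, ← hPdeg i]
    ring
  set F := p - ∑ i, N i * P i ^ (r + 1) with hF
  have hdvd : ∀ i, (Polynomial.X - Polynomial.C (e i)) ^ (r + 1) ∣ F := fun i => by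
    have h1 : (Polynomial.X - Polynomial.C (e i)) ^ (r + 1) ∣
        ∑ l ∈ univ.erase i, N l * P l ^ (r + 1) := by
      refine dvd_sum fun l hl => Dvd.dvd.mul_left (pow_dvd_pow_of_dvd ?_ _) _
      exact dvd_prod_of_mem _ (mem_erase.2 ⟨(ne_of_mem_erase hl).symm, mem_univ _⟩)
    have h2 : (Polynomial.X - Polynomial.C (e i)) ^ (r + 1) ∣ p - N i * P i ^ (r + 1) := by
      refine X_sub_C_pow_dvd_of_taylor ?_
      have h3 : (Polynomial.taylor (e i) (N i)) =
          ∑ j ∈ range (r + 1), Polynomial.C (locCoeff r e p i j) * Polynomial.X ^ j := by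
        rw [hN, map_sum]
        refine sum_congr rfl fun j _ => ?_
        rw [Polynomial.taylor_mul, Polynomial.taylor_C, Polynomial.taylor_pow, map_sub,
          Polynomial.taylor_X, Polynomial.taylor_C, add_sub_cancel_right]
      have h4 : (X : k⟦X⟧) ^ (r + 1) ∣ (Polynomial.taylor (e i) p : Polynomial k) * locInv r e i -
          (Polynomial.taylor (e i) (N i) : Polynomial k) := by
        rw [PowerSeries.X_pow_dvd_iff]
        intro m hm
        rw [map_sub, h3, Polynomial.coeff_coe, Polynomial.finsetSum_coeff]
        simp only [Polynomial.coeff_C_mul, Polynomial.coeff_X_pow, mul_ite, mul_one, mul_zero]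
        rw [sum_ite_eq, if_pos (mem_range.2 hm)]
        exact sub_self _
      have h5 := h4.mul_right (locProd e i ^ (r + 1))
      rw [sub_mul, mul_assoc, locInv_mul r he, mul_one, ← coe_taylor_prod_erase] at h5
      rw [map_sub, Polynomial.taylor_mul, Polynomial.taylor_pow]
      simpa using h5
    rw [hF, ← add_sum_erase univ _ (mem_univ i), ← sub_sub]
    exact h2.sub h1
  have hFdvd : ∏ i, (Polynomial.X - Polynomial.C (e i)) ^ (r + 1) ∣ F := by
    refine Finset.prod_dvd_of_coprime ?_ fun i _ => hdvd i
    intro i _ j _ hij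
    exact (Polynomial.isCoprime_X_sub_C_of_isUnit_sub
      (sub_ne_zero.2 (he.ne hij)).isUnit).pow
  have hterm : ∀ i, (N i * P i ^ (r + 1)).natDegree < Fintype.card ι * (r + 1) := fun i => by
    refine Polynomial.natDegree_mul_le.trans_lt ?_
    have := hPpow i
    have := hNdeg i
    omega
  have hF0 : F = 0 := by
    refine Polynomial.eq_zero_of_dvd_of_natDegree_lt hFdvd ?_
    rw [Polynomial.natDegree_prod_of_monic _ _
      fun i _ => (Polynomial.monic_X_sub_C (e i)).pow (r + 1)]
    simp only [Polynomial.natDegree_pow, Polynomial.natDegree_X_sub_C, mul_one, sum_const,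
      card_univ, smul_eq_mul]
    refine (Polynomial.natDegree_sub_le _ _).trans_lt (max_lt (by omega) ?_)
    by_cases hne : (univ : Finset ι).Nonempty
    · refine (Polynomial.natDegree_sum_le _ _).trans_lt ?_
      rw [Finset.fold_max_lt]
      exact ⟨by omega, fun i _ => hterm i⟩
    · rw [not_nonempty_iff_eq_empty.1 hne]
      simp only [sum_empty, Polynomial.natDegree_zero]
      omega
  have hc := congrArg (fun q => Polynomial.coeff q (Fintype.card ι * (r + 1) - 1)) hF0
  simp only [hF, Polynomial.coeff_sub, Polynomial.finsetSum_coeff, Polynomial.coeff_zero] at hc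
  rw [Polynomial.coeff_eq_zero_of_natDegree_lt (by omega), zero_sub, neg_eq_zero] at hc
  rw [← hc]
  refine sum_congr rfl fun i _ => ?_
  have h6 := hPpow i
  have h7 : Fintype.card ι * (r + 1) - 1 = r + (P i ^ (r + 1)).natDegree := by omega
  rw [h7, Polynomial.coeff_mul_add_eq_of_natDegree_le (hNdeg i) le_rfl, hNcoeff]
  have := (hPmonic i).pow (r + 1)
  rw [Polynomial.Monic, Polynomial.leadingCoeff] at this
  rw [this, mul_one]

end PadeVanishing

section PadeNonvanishing

open PowerSeries Finset

variable {k : Type*} [Field k] [CharZero k]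

/-- The local expansion of `(h - g z) ^ (r + ν)` at a point where `h - g z` takes the value `H`,
divided by the `ν`-th power of `H`. -/
noncomputable def locPow (ν : ℚ) (r : ℕ) (g H : k) : k⟦X⟧ :=
  PowerSeries.mk fun m => ((Ring.choose ((r : ℚ) + ν) m : ℚ) : k) * (-g) ^ m * H ^ ((r : ℤ) - m)

theorem succ_mul_choose_succ (x : ℚ) (m : ℕ) :
    ((m : ℚ) + 1) * Ring.choose x (m + 1) = Ring.choose x m * (x - m) := by
  have := Ring.choose_smul_choose x (Nat.le_succ m)
  simpa [Nat.choose_succ_self_right] using this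

theorem locPow_ode (ν : ℚ) (r : ℕ) (g : k) {H : k} (hH : H ≠ 0) :
    (C H - C g * X) * d⁄dX k (locPow ν r g H) = -(C (((r : k) + (ν : k)) * g)) * locPow ν r g H := by
  ext n
  have h1 : coeff n (X * d⁄dX k (locPow ν r g H)) = n * coeff n (locPow ν r g H) := by
    cases n with
    | zero => simp
    | succ n => rw [coeff_succ_X_mul, coeff_derivative]; push_cast; ring
  rw [sub_mul, mul_assoc, map_sub, coeff_C_mul, coeff_C_mul, h1, neg_mul, map_neg, coeff_C_mul,
    coeff_derivative]
  simp only [locPow, coeff_mk]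
  have h2 := congrArg (fun q : ℚ => (q : k)) (succ_mul_choose_succ ((r : ℚ) + ν) n)
  push_cast at h2
  have h3 : H ^ ((r : ℤ) - n) = H * H ^ ((r : ℤ) - (n + 1 : ℕ)) := by
    rw [← zpow_one_add₀ hH]
    congr 1
    push_cast
    ring
  rw [h3, pow_succ]
  linear_combination (-g) ^ n * (-g) * H * H ^ ((r : ℤ) - (n + 1 : ℕ)) * h2

theorem coeff_X_mul_derivative_sub (r : ℕ) (Y : k⟦X⟧) :
    coeff r (X * d⁄dX k Y - C (r : k) * Y) = 0 := by
  rw [map_sub, coeff_C_mul, sub_eq_zero]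
  cases r with
  | zero => simp
  | succ r => rw [coeff_succ_X_mul, coeff_derivative]; push_cast; ring

variable {ι : Type*} [Fintype ι] [DecidableEq ι]

theorem padeRes_eq_coeff (ν : ℚ) (r : ℕ) (g : k) (H e : ι → k) (p : Polynomial k) (i : ι) :
    padeRes ν r g H e p i =
      coeff r (locPow ν r g (H i) *
        (((Polynomial.taylor (e i) p : Polynomial k) : k⟦X⟧) * locInv r e i)) := by
  rw [padeRes, coeff_mul, Nat.sum_antidiagonal_eq_sum_range_succ_mk]
  refine sum_congr rfl fun m hm => ?_
  rw [locPow, coeff_mk, locCoeff]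
  congr 2
  have : m ≤ r := Nat.lt_succ_iff.1 (mem_range.1 hm)
  rw [← Nat.cast_sub this, zpow_natCast]

/-- The numerator, up to the factor `(h - g z) ^ (r + ν) / ∏ (z - e l) ^ (r + 1)`, of the derivative
of `(h - g z) ^ (r + ν + 1) R / ∏ (z - e l) ^ r`. -/
noncomputable def padeDer (ν : ℚ) (r : ℕ) (h g : k) (P R : Polynomial k) : Polynomial k :=
  (Polynomial.C h - Polynomial.C g * Polynomial.X) *
      (Polynomial.derivative R * P - Polynomial.C (r : k) * R * Polynomial.derivative P) -
    Polynomial.C (((r : k) + ν + 1) * g) * R * P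

theorem derivative_taylor' (a : k) (p : Polynomial k) :
    Polynomial.taylor a (Polynomial.derivative p) =
      Polynomial.derivative (Polynomial.taylor a p) := by
  rw [Polynomial.taylor_apply, Polynomial.taylor_apply, Polynomial.derivative_comp]
  simp

theorem padeRes_padeDer (ν : ℚ) (r : ℕ) (h g : k) {H e : ι → k} (he : Function.Injective e)
    (hH : ∀ i, H i = h - g * e i) (hH0 : ∀ i, H i ≠ 0) (R : Polynomial k) (i : ι) :
    padeRes ν r g H e (padeDer ν r h g (∏ l, (Polynomial.X - Polynomial.C (e l))) R) i = 0 := by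
  rw [padeRes_eq_coeff]
  have hP : ((Polynomial.taylor (e i) (∏ l, (Polynomial.X - Polynomial.C (e l))) :
      Polynomial k) : k⟦X⟧) = X * locProd e i := by
    rw [← mul_prod_erase univ _ (mem_univ i), Polynomial.taylor_mul, Polynomial.coe_mul,
      coe_taylor_prod_erase, map_sub, Polynomial.taylor_X, Polynomial.taylor_C,
      add_sub_cancel_right, Polynomial.coe_X]
  set B := locPow ν r g (H i) with hB
  set U := locInv r e i with hU
  set W := locProd e i with hW
  set T : k⟦X⟧ := ((Polynomial.taylor (e i) R : Polynomial k) : k⟦X⟧) with hT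
  have hode := locPow_ode ν r g (hH0 i)
  rw [← hB] at hode
  have hUW : U * W ^ (r + 1) = 1 := locInv_mul r he i
  have hW0 : W ^ (r + 1) ≠ 0 := right_ne_zero_of_mul_eq_one hUW
  have hder : W * d⁄dX k U = -(C ((r : k) + 1)) * d⁄dX k W * U := by
    have h1 := congrArg (d⁄dX k) hUW
    rw [Derivation.leibniz, PowerSeries.derivative_pow, PowerSeries.derivative_one] at h1
    simp only [smul_eq_mul, add_tsub_cancel_right] at h1
    refine mul_left_cancel₀ hW0 ?_
    have h2 : (C ((r : k) + 1)) = ((r + 1 : ℕ) : k⟦X⟧) := by simp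
    rw [h2]
    linear_combination W * h1
  have hDT : ((Polynomial.taylor (e i) (Polynomial.derivative R) : Polynomial k) : k⟦X⟧) =
      d⁄dX k T := by
    rw [derivative_taylor', ← PowerSeries.derivative_coe]
  have hDP : ((Polynomial.taylor (e i) (Polynomial.derivative
      (∏ l, (Polynomial.X - Polynomial.C (e l)))) : Polynomial k) : k⟦X⟧) =
      W + X * d⁄dX k W := by
    rw [derivative_taylor', ← PowerSeries.derivative_coe, hP, Derivation.leibniz]
    simp only [smul_eq_mul, PowerSeries.derivative_X]
    ring
  have hlin : ((Polynomial.taylor (e i) (Polynomial.C h - Polynomial.C g * Polynomial.X) :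
      Polynomial k) : k⟦X⟧) = C (H i) - C g * X := by
    rw [map_sub, Polynomial.taylor_mul, Polynomial.taylor_C, Polynomial.taylor_C,
      Polynomial.taylor_X, hH]
    simp only [Polynomial.coe_sub, Polynomial.coe_mul, Polynomial.coe_C, Polynomial.coe_add,
      Polynomial.coe_X, map_sub, map_mul]
    ring
  have hkey : B * (((Polynomial.taylor (e i) (padeDer ν r h g
      (∏ l, (Polynomial.X - Polynomial.C (e l))) R) : Polynomial k) : k⟦X⟧) * U) =
      X * d⁄dX k (W * U * (C (H i) - C g * X) * B * T) -
        C (r : k) * (W * U * (C (H i) - C g * X) * B * T) := by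
    have hd : ∀ P : Polynomial k, Polynomial.taylor (e i) (padeDer ν r h g P R) =
        Polynomial.taylor (e i) (Polynomial.C h - Polynomial.C g * Polynomial.X) *
          (Polynomial.taylor (e i) (Polynomial.derivative R) * Polynomial.taylor (e i) P -
            Polynomial.C (r : k) * Polynomial.taylor (e i) R *
              Polynomial.taylor (e i) (Polynomial.derivative P)) -
          Polynomial.C (((r : k) + ν + 1) * g) * Polynomial.taylor (e i) R *
            Polynomial.taylor (e i) P := fun P => by
      simp only [padeDer, map_sub, Polynomial.taylor_mul, Polynomial.taylor_C]
    rw [hd]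
    simp only [Polynomial.coe_sub, Polynomial.coe_mul, Polynomial.coe_C] at hlin ⊢
    rw [hlin, hDT, hP, hDP, ← hT]
    simp only [Derivation.leibniz, smul_eq_mul, map_sub, PowerSeries.derivative_C,
      PowerSeries.derivative_X, mul_one, mul_zero, add_zero, zero_sub]
    simp only [map_mul, map_add, map_one] at hode hder ⊢
    linear_combination (-(X * W * U * T)) * hode -
      X * (C (H i) - C g * X) * B * T * hder
  rw [hkey, coeff_X_mul_derivative_sub]

theorem natDegree_prod_X_sub_C' (e : ι → k) :
    (∏ l, (Polynomial.X - Polynomial.C (e l))).natDegree = Fintype.card ι := by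
  rw [Polynomial.natDegree_prod_of_monic _ _ fun l _ => Polynomial.monic_X_sub_C _]
  simp

theorem coeff_padeDer (ν : ℚ) (r : ℕ) (h g : k) (e : ι → k) (j m : ℕ)
    (hm : j + Fintype.card ι ≤ m) :
    (padeDer ν r h g (∏ l, (Polynomial.X - Polynomial.C (e l))) (Polynomial.X ^ j)).coeff m =
      -g * (j - r * (m - j : ℕ) + r + ν + 1) *
        (∏ l, (Polynomial.X - Polynomial.C (e l))).coeff (m - j) := by
  set P := ∏ l, (Polynomial.X - Polynomial.C (e l)) with hP
  have hPm : P.Monic := Polynomial.monic_prod_of_monic _ _ fun l _ => Polynomial.monic_X_sub_C _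
  have hPd : P.natDegree = Fintype.card ι := natDegree_prod_X_sub_C' e
  obtain ⟨t, rfl⟩ : ∃ t, m = t + j := ⟨m - j, by omega⟩
  rw [Nat.add_sub_cancel]
  have ht : P.natDegree ≤ t := by omega
  have hdeg : (Polynomial.X ^ j * P : Polynomial k).degree ≤ (t + j : ℕ) := by
    rw [Polynomial.degree_mul, Polynomial.degree_X_pow, Polynomial.degree_eq_natDegree hPm.ne_zero]
    norm_cast
    omega
  have h1 : (Polynomial.derivative (Polynomial.X ^ j) * P : Polynomial k).coeff (t + j) = 0 := by
    refine Polynomial.coeff_eq_zero_of_degree_lt (lt_of_lt_of_le ?_ hdeg)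
    rw [Polynomial.degree_mul, Polynomial.degree_mul]
    refine WithBot.add_lt_add_right ?_ (Polynomial.degree_derivative_lt (pow_ne_zero _ Polynomial.X_ne_zero))
    exact Polynomial.degree_ne_bot.2 hPm.ne_zero
  have h2 : (Polynomial.X ^ j * Polynomial.derivative P : Polynomial k).coeff (t + j) = 0 := by
    refine Polynomial.coeff_eq_zero_of_degree_lt (lt_of_lt_of_le ?_ hdeg)
    rw [Polynomial.degree_mul, Polynomial.degree_mul]
    refine WithBot.add_lt_add_left ?_ (Polynomial.degree_derivative_lt hPm.ne_zero)
    exact Polynomial.degree_ne_bot.2 (pow_ne_zero _ Polynomial.X_ne_zero)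
  have h3 : Polynomial.X * Polynomial.derivative (Polynomial.X ^ j) =
      Polynomial.C (j : k) * Polynomial.X ^ j := by
    cases j with
    | zero => simp
    | succ j => rw [Polynomial.derivative_X_pow, Nat.add_sub_cancel]; ring
  have h4 : (Polynomial.X * Polynomial.derivative P).coeff t = t * P.coeff t := by
    cases t with
    | zero => simp
    | succ t => rw [Polynomial.coeff_X_mul, Polynomial.coeff_derivative]; push_cast; ring
  have h5 : padeDer ν r h g P (Polynomial.X ^ j) =
      Polynomial.C h * (Polynomial.derivative (Polynomial.X ^ j) * P) -
      Polynomial.C (h * r) * (Polynomial.X ^ j * Polynomial.derivative P) -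
      Polynomial.C (g * (j + r + ν + 1)) * (P * Polynomial.X ^ j) +
      Polynomial.C (g * r) * (Polynomial.X * Polynomial.derivative P * Polynomial.X ^ j) := by
    rw [padeDer]
    simp only [map_mul, map_add, map_one]
    linear_combination (-(Polynomial.C g * P)) * h3
  rw [h5]
  simp only [Polynomial.coeff_add, Polynomial.coeff_sub, Polynomial.coeff_C_mul,
    Polynomial.coeff_mul_X_pow, h1, h2, h4]
  ring

/-- The functional `∑ w i * padeRes i` as a linear map. -/
noncomputable def padeFun (ν : ℚ) (r : ℕ) (g : k) (H e w : ι → k) : Polynomial k →ₗ[k] k where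
  toFun p := ∑ i, w i * padeRes ν r g H e p i
  map_add' p q := by
    simp only [padeRes_eq_coeff, map_add, Polynomial.coe_add, add_mul, mul_add, sum_add_distrib]
  map_smul' c p := by
    simp only [padeRes_eq_coeff, map_smul, Polynomial.coe_smul, smul_mul_assoc, mul_smul_comm,
      smul_eq_mul, RingHom.id_apply, mul_sum]
    exact sum_congr rfl fun i _ => by ring

theorem padeFun_apply (ν : ℚ) (r : ℕ) (g : k) (H e w : ι → k) (p : Polynomial k) :
    padeFun ν r g H e w p = ∑ i, w i * padeRes ν r g H e p i := rfl

theorem exists_padeFun_ne_zero {ν : ℚ} (hν : ∀ m : ℤ, ν ≠ m) (r : ℕ) {h g : k} (hg : g ≠ 0)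
    {H e w : ι → k} (he : Function.Injective e) (hH : ∀ i, H i = h - g * e i)
    (hH0 : ∀ i, H i ≠ 0) {i₀ : ι} (hw : w i₀ ≠ 0) :
    ∃ s < Fintype.card ι, padeFun ν r g H e w (Polynomial.X ^ s) ≠ 0 := by
  by_contra! hcon
  set L := padeFun ν r g H e w with hL
  set P := ∏ l, (Polynomial.X - Polynomial.C (e l)) with hP
  have hPm : P.Monic := Polynomial.monic_prod_of_monic _ _ fun l _ => Polynomial.monic_X_sub_C _
  have hPd : P.natDegree = Fintype.card ι := natDegree_prod_X_sub_C' e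
  have hD : ∀ R, L (padeDer ν r h g P R) = 0 := fun R => by
    rw [hL, padeFun_apply]
    exact sum_eq_zero fun i _ => by rw [padeRes_padeDer ν r h g he hH hH0, mul_zero]
  have hall : ∀ d : ℕ, ∀ p : Polynomial k, p.degree < d → L p = 0 := by
    intro d
    induction d with
    | zero =>
      intro p hp
      have : p = 0 := by
        rw [Polynomial.degree_lt_iff_coeff_zero] at hp
        ext m
        exact hp m (Nat.zero_le m)
      rw [this, map_zero]
    | succ d ih =>
      intro p hp
      rw [Polynomial.degree_lt_iff_coeff_zero] at hp
      rcases lt_or_ge d (Fintype.card ι) with hd | hd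
      · have h1 : L (p - p.coeff d • Polynomial.X ^ d) = 0 := by
          refine ih _ ?_
          rw [Polynomial.degree_lt_iff_coeff_zero]
          intro m hm
          rcases hm.eq_or_lt with rfl | hm
          · simp
          · rw [Polynomial.coeff_sub, hp m hm, Polynomial.coeff_smul, Polynomial.coeff_X_pow,
              if_neg (by omega)]
            simp
        rw [map_sub, map_smul, hcon d hd, smul_zero, sub_zero] at h1
        exact h1
      · obtain ⟨j, rfl⟩ : ∃ j, d = j + Fintype.card ι := ⟨d - Fintype.card ι, by omega⟩
        set c : k := -g * (j - r * Fintype.card ι + r + ν + 1) with hc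
        have hc0 : c ≠ 0 := by
          refine mul_ne_zero (neg_ne_zero.2 hg) fun h0 => ?_
          refine hν (-(j - r * Fintype.card ι + r + 1)) ?_
          have : ((((j : ℚ) - r * Fintype.card ι + r + ν + 1 : ℚ)) : k) = 0 := by
            push_cast
            exact h0
          rw [Rat.cast_eq_zero] at this
          push_cast
          linarith
        have h1 : L (p - (p.coeff (j + Fintype.card ι) / c) •
            padeDer ν r h g P (Polynomial.X ^ j)) = 0 := by
          refine ih _ ?_
          rw [Polynomial.degree_lt_iff_coeff_zero]
          intro m hm
          rw [Polynomial.coeff_sub, Polynomial.coeff_smul, hP, coeff_padeDer ν r h g e j m hm]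
          rcases hm.eq_or_lt with rfl | hm
          · rw [Nat.add_sub_cancel_left, ← hP, ← hPd, hPm.coeff_natDegree, hPd, mul_one, ← hc,
              smul_eq_mul, div_mul_cancel₀ _ hc0, sub_self]
          · have h2 : P.coeff (m - j) = 0 :=
              Polynomial.coeff_eq_zero_of_natDegree_lt (by rw [hPd]; omega)
            rw [hp m hm, ← hP, h2]
            simp
        rw [map_sub, map_smul, hD, smul_zero, sub_zero] at h1
        exact h1
  have hzero : L ((Polynomial.X - Polynomial.C (e i₀)) ^ r *
      (∏ l ∈ univ.erase i₀, (Polynomial.X - Polynomial.C (e l))) ^ (r + 1)) = 0 :=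
    hall _ _ (Polynomial.degree_le_natDegree.trans_lt (Nat.cast_lt.2 (Nat.lt_succ_self _)))
  rw [hL, padeFun_apply, sum_eq_single i₀] at hzero
  · rcases mul_eq_zero.1 hzero with h0 | h0
    · exact hw h0
    · rw [padeRes_eq_coeff, Polynomial.taylor_mul, Polynomial.taylor_pow, Polynomial.taylor_pow,
        map_sub, Polynomial.taylor_X, Polynomial.taylor_C, add_sub_cancel_right,
        Polynomial.coe_mul, Polynomial.coe_pow, Polynomial.coe_pow, Polynomial.coe_X,
        coe_taylor_prod_erase, mul_assoc, mul_comm (locProd e i₀ ^ (r + 1)), locInv_mul r he,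
        mul_one, PowerSeries.coeff_mul_X_pow'] at h0
      simp only [le_refl, if_true, Nat.sub_self, locPow, coeff_mk, pow_zero, mul_one,
        Ring.choose_zero_right, Rat.cast_one, one_mul, Nat.cast_zero, sub_zero, zpow_natCast] at h0
      exact pow_ne_zero _ (hH0 i₀) h0
  · intro i _ hi
    rw [padeRes_eq_coeff]
    have : (X : k⟦X⟧) ^ (r + 1) ∣ locPow ν r g (H i) *
        (((Polynomial.taylor (e i) ((Polynomial.X - Polynomial.C (e i₀)) ^ r *
          (∏ l ∈ univ.erase i₀, (Polynomial.X - Polynomial.C (e l))) ^ (r + 1)) : Polynomial k) :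
            k⟦X⟧) * locInv r e i) := by
      refine Dvd.dvd.mul_left (Dvd.dvd.mul_right ?_ _) _
      rw [← mul_prod_erase _ _ (mem_erase.2 ⟨hi, mem_univ i⟩), mul_pow, mul_left_comm,
        Polynomial.taylor_mul, Polynomial.taylor_pow, map_sub, Polynomial.taylor_X,
        Polynomial.taylor_C, add_sub_cancel_right]
      simp
    rw [(PowerSeries.X_pow_dvd_iff.1 this) r (Nat.lt_succ_self r), mul_zero]
  · exact fun h => absurd (mem_univ _) h

end PadeNonvanishing

section ChooseIntegrality

open PowerSeries Finset

theorem coeff_sq_mem_int {w : ℚ⟦X⟧} (h0 : coeff 0 w = 0) {m : ℕ}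
    (h : ∀ j < m, ∃ z : ℤ, coeff j w = (z : ℚ)) {j : ℕ} (hj : j ≤ m) : ∃ z : ℤ, coeff j (w ^ 2) = (z : ℚ) := by
  have : coeff j (w ^ 2) ∈ (Int.castRingHom ℚ).range := by
    rw [sq, coeff_mul]
    refine sum_mem fun p hp => ?_
    have hp' := mem_antidiagonal.1 hp
    rcases Nat.eq_zero_or_pos p.1 with h1 | h1
    · rw [h1, h0, zero_mul]
      exact zero_mem _
    rcases Nat.eq_zero_or_pos p.2 with h2 | h2
    · rw [h2, h0, mul_zero]
      exact zero_mem _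
    obtain ⟨a, ha⟩ := h p.1 (by omega)
    obtain ⟨b, hb⟩ := h p.2 (by omega)
    exact ⟨a * b, by simp [ha, hb]⟩
  obtain ⟨z, hz⟩ := this
  exact ⟨z, hz.symm⟩

theorem coeff_cube_mem_int {w : ℚ⟦X⟧} (h0 : coeff 0 w = 0) {m : ℕ}
    (h : ∀ j < m, ∃ z : ℤ, coeff j w = (z : ℚ)) : ∃ z : ℤ, coeff m (w ^ 3) = (z : ℚ) := by
  have : coeff m (w ^ 3) ∈ (Int.castRingHom ℚ).range := by
    rw [pow_succ, coeff_mul]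
    refine sum_mem fun p hp => ?_
    have hp' := mem_antidiagonal.1 hp
    rcases Nat.eq_zero_or_pos p.2 with h2 | h2
    · rw [h2, h0, mul_zero]
      exact zero_mem _
    rcases Nat.eq_zero_or_pos p.1 with h1 | h1
    · rw [h1, sq, coeff_mul]
      simp [h0]
    obtain ⟨a, ha⟩ := coeff_sq_mem_int h0 h (show p.1 ≤ m by omega)
    obtain ⟨b, hb⟩ := h p.2 (by omega)
    exact ⟨a * b, by simp [ha, hb]⟩
  obtain ⟨z, hz⟩ := this
  exact ⟨z, hz.symm⟩

theorem coeff_mem_int_of_quadratic {w : ℚ⟦X⟧} (h0 : coeff 0 w = 0) (h : w + w ^ 2 = X) (m : ℕ) :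
    ∃ z : ℤ, coeff m w = (z : ℚ) := by
  induction m using Nat.strong_induction_on with
  | _ m ih =>
    obtain ⟨a, ha⟩ := coeff_sq_mem_int h0 ih le_rfl
    have h1 := congrArg (coeff m) h
    rw [map_add, ha, coeff_X] at h1
    refine ⟨(if m = 1 then 1 else 0) - a, ?_⟩
    push_cast
    linarith

theorem coeff_mem_int_of_cubic {w : ℚ⟦X⟧} (h0 : coeff 0 w = 0)
    (h : w + 3 * w ^ 2 + 3 * w ^ 3 = X) (m : ℕ) : ∃ z : ℤ, coeff m w = (z : ℚ) := by
  induction m using Nat.strong_induction_on with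
  | _ m ih =>
    obtain ⟨a, ha⟩ := coeff_sq_mem_int h0 ih le_rfl
    obtain ⟨b, hb⟩ := coeff_cube_mem_int h0 ih
    have h1 := congrArg (coeff m) h
    have h3 : (3 : ℚ⟦X⟧) = C 3 := (map_ofNat C 3).symm
    rw [map_add, map_add, h3, coeff_C_mul, coeff_C_mul, ha, hb, coeff_X] at h1
    refine ⟨(if m = 1 then 1 else 0) - 3 * a - 3 * b, ?_⟩
    push_cast
    linarith

theorem pow_mul_choose_add_mem_int {c : ℤ} {x : ℚ}
    (h : ∀ m, ∃ z : ℤ, (c : ℚ) ^ m * Ring.choose x m = z) (r m : ℕ) :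
    ∃ z : ℤ, (c : ℚ) ^ m * Ring.choose ((r : ℚ) + x) m = z := by
  induction r generalizing m with
  | zero => simpa using h m
  | succ r ih =>
    cases m with
    | zero => exact ⟨1, by simp⟩
    | succ m =>
      have h1 : ((r + 1 : ℕ) : ℚ) + x = (r + x) + 1 := by push_cast; ring
      rw [h1, Ring.choose_succ_succ]
      obtain ⟨a, ha⟩ := ih m
      obtain ⟨b, hb⟩ := ih (m + 1)
      refine ⟨c * a + b, ?_⟩
      push_cast
      rw [← ha, ← hb]
      ring

theorem four_pow_mul_choose_half (r m : ℕ) :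
    ∃ z : ℤ, (4 : ℚ) ^ m * Ring.choose ((r : ℚ) + 1 / 2) m = z := by
  refine pow_mul_choose_add_mem_int (c := 4) (fun m => ?_) r m
  set y : ℚ⟦X⟧ := rescale 4 (PowerSeries.binomialSeries ℚ (1 / 2 : ℚ)) with hy
  have hcoeff : ∀ m, coeff m y = 4 ^ m * Ring.choose (1 / 2 : ℚ) m := fun m => by
    rw [hy, coeff_rescale, binomialSeries_coeff, smul_eq_mul, mul_one]
  have hy2 : y ^ 2 = 1 + 4 * X := by
    have h1 : PowerSeries.binomialSeries ℚ (1 / 2 : ℚ) ^ 2 = 1 + X := by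
      rw [sq, ← binomialSeries_add]
      have := binomialSeries_nat (A := ℚ) (R := ℚ) 1
      simp only [Nat.cast_one, pow_one] at this
      rw [← this]
      norm_num
    have h2 := congrArg (rescale (4 : ℚ)) h1
    rw [map_pow, map_add, map_one, rescale_X] at h2
    rw [hy, h2, map_ofNat]
  set w : ℚ⟦X⟧ := C (1 / 2) * (y - 1) with hw
  have hyw : y = 1 + 2 * w := by
    have h2 : (2 : ℚ⟦X⟧) * C (1 / 2) = 1 := by
      have : (2 : ℚ⟦X⟧) = C 2 := (map_ofNat C 2).symm
      rw [this, ← map_mul]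
      norm_num
    rw [hw, ← mul_assoc, h2]
    ring
  have h0 : coeff 0 w = 0 := by
    rw [hw, coeff_C_mul, map_sub, hcoeff]
    simp
  have hww : w + w ^ 2 = X := by
    have h4 : (4 : ℚ⟦X⟧) ≠ 0 := by
      rw [← map_ofNat (C (R := ℚ)) 4, Ne, ← map_zero (C (R := ℚ)), C_injective.eq_iff]
      norm_num
    refine mul_left_cancel₀ h4 ?_
    rw [hyw] at hy2
    linear_combination hy2
  obtain ⟨z, hz⟩ := coeff_mem_int_of_quadratic h0 hww m
  have h5 : coeff m y = coeff m (1 : ℚ⟦X⟧) + 2 * coeff m w := by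
    have : (2 : ℚ⟦X⟧) = C 2 := (map_ofNat C 2).symm
    rw [hyw, map_add, this, coeff_C_mul]
  refine ⟨(if m = 0 then 1 else 0) + 2 * z, ?_⟩
  push_cast
  rw [← hcoeff, h5, hz, coeff_one]

theorem nine_pow_mul_choose_third (r m : ℕ) :
    ∃ z : ℤ, (9 : ℚ) ^ m * Ring.choose ((r : ℚ) + 1 / 3) m = z := by
  refine pow_mul_choose_add_mem_int (c := 9) (fun m => ?_) r m
  set y : ℚ⟦X⟧ := rescale 9 (PowerSeries.binomialSeries ℚ (1 / 3 : ℚ)) with hy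
  have hcoeff : ∀ m, coeff m y = 9 ^ m * Ring.choose (1 / 3 : ℚ) m := fun m => by
    rw [hy, coeff_rescale, binomialSeries_coeff, smul_eq_mul, mul_one]
  have hy3 : y ^ 3 = 1 + 9 * X := by
    have h1 : PowerSeries.binomialSeries ℚ (1 / 3 : ℚ) ^ 3 = 1 + X := by
      rw [pow_succ, sq, ← binomialSeries_add, ← binomialSeries_add]
      have := binomialSeries_nat (A := ℚ) (R := ℚ) 1
      simp only [Nat.cast_one, pow_one] at this
      rw [← this]
      norm_num
    have h2 := congrArg (rescale (9 : ℚ)) h1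
    rw [map_pow, map_add, map_one, rescale_X] at h2
    rw [hy, h2, map_ofNat]
  set w : ℚ⟦X⟧ := C (1 / 3) * (y - 1) with hw
  have hyw : y = 1 + 3 * w := by
    have h2 : (3 : ℚ⟦X⟧) * C (1 / 3) = 1 := by
      have : (3 : ℚ⟦X⟧) = C 3 := (map_ofNat C 3).symm
      rw [this, ← map_mul]
      norm_num
    rw [hw, ← mul_assoc, h2]
    ring
  have h0 : coeff 0 w = 0 := by
    rw [hw, coeff_C_mul, map_sub, hcoeff]
    simp
  have hww : w + 3 * w ^ 2 + 3 * w ^ 3 = X := by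
    have h4 : (9 : ℚ⟦X⟧) ≠ 0 := by
      rw [← map_ofNat (C (R := ℚ)) 9, Ne, ← map_zero (C (R := ℚ)), C_injective.eq_iff]
      norm_num
    refine mul_left_cancel₀ h4 ?_
    rw [hyw] at hy3
    linear_combination hy3
  obtain ⟨z, hz⟩ := coeff_mem_int_of_cubic h0 hww m
  have h5 : coeff m y = coeff m (1 : ℚ⟦X⟧) + 3 * coeff m w := by
    have : (3 : ℚ⟦X⟧) = C 3 := (map_ofNat C 3).symm
    rw [hyw, map_add, this, coeff_C_mul]
  refine ⟨(if m = 0 then 1 else 0) + 3 * z, ?_⟩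
  push_cast
  rw [← hcoeff, h5, hz, coeff_one]

end ChooseIntegrality

section PadeArithmetic

open PowerSeries Finset

/-- A nonzero algebraic integer whose square is fixed by the Galois group has absolute value at
least one in every complex embedding. -/
theorem one_le_norm_of_galois {L : Type*} [Field L] [CharZero L] [IsGalois ℚ L] (φ : L →+* ℂ)
    {x : L} (hx : IsIntegral ℤ x) (h0 : x ≠ 0)
    (hσ : ∀ σ : L ≃ₐ[ℚ] L, σ x = x ∨ σ x = -x) : 1 ≤ ‖φ x‖ := by
  have hfix : ∀ σ : L ≃ₐ[ℚ] L, σ (x ^ 2) = x ^ 2 := fun σ => by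
    rcases hσ σ with h | h <;> rw [map_pow, h]
    ring
  obtain ⟨q, hq⟩ := (InfiniteGalois.mem_range_algebraMap_iff_fixed (k := ℚ) (x ^ 2)).2 hfix
  have hqint : IsIntegral ℤ q := by
    rw [← isIntegral_algebraMap_iff (algebraMap ℚ L).injective, hq]
    exact hx.pow 2
  obtain ⟨z, hz⟩ := IsIntegrallyClosed.isIntegral_iff.1 hqint
  have hz0 : z ≠ 0 := by
    rintro rfl
    rw [map_zero] at hz
    rw [← hz, map_zero] at hq
    exact pow_ne_zero 2 h0 hq.symm
  have h1 : φ x ^ 2 = (z : ℂ) := by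
    rw [← map_pow, ← hq, ← hz]
    simp
  have h2 : (1 : ℝ) ≤ ‖φ x‖ ^ 2 := by
    rw [← norm_pow, h1, Complex.norm_intCast]
    exact_mod_cast Int.one_le_abs hz0
  nlinarith [norm_nonneg (φ x)]

variable {k : Type*} [Field k] {ι : Type*} [Fintype ι] [DecidableEq ι]

theorem map_invPow {k' : Type*} [Field k'] (φ : k →+* k') (r : ℕ) (δ : k) :
    PowerSeries.map φ (invPow r δ) = invPow r (φ δ) := by
  ext a
  simp [invPow, coeff_map]

theorem map_locCoeff {k' : Type*} [Field k'] (φ : k →+* k') (r : ℕ) (e : ι → k)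
    (p : Polynomial k) (i : ι) (j : ℕ) :
    φ (locCoeff r e p i j) = locCoeff r (fun l => φ (e l)) (p.map φ) i j := by
  rw [locCoeff, locCoeff, ← coeff_map, map_mul, locInv, locInv, map_prod]
  simp_rw [map_invPow, map_sub]
  rw [← Polynomial.map_taylor, Polynomial.polynomial_map_coe]

theorem map_padeRes [CharZero k] {k' : Type*} [Field k'] [CharZero k'] (φ : k →+* k') (ν : ℚ)
    (r : ℕ) (g : k) (H e : ι → k) (p : Polynomial k) (i : ι) :
    φ (padeRes ν r g H e p i) =
      padeRes ν r (φ g) (fun l => φ (H l)) (fun l => φ (e l)) (p.map φ) i := by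
  simp only [padeRes, map_sum, map_mul, map_pow, map_neg, map_locCoeff, map_ratCast]

theorem map_padeFun [CharZero k] {k' : Type*} [Field k'] [CharZero k'] (φ : k →+* k') (ν : ℚ)
    (r : ℕ) (g c : k) (H e w : ι → k) (s : ℕ) :
    φ (padeFun ν r g H e w ((Polynomial.C c * Polynomial.X) ^ s)) =
      padeFun ν r (φ g) (fun i => φ (H i)) (fun i => φ (e i)) (fun i => φ (w i))
        ((Polynomial.C (φ c) * Polynomial.X) ^ s) := by
  simp only [padeFun_apply, map_sum, map_mul, map_padeRes, Polynomial.map_pow,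
    Polynomial.map_mul, Polynomial.map_C, Polynomial.map_X]

theorem locInv_comp_equiv (r : ℕ) (e : ι → k) (π : ι ≃ ι) (i : ι) :
    locInv r (fun l => e (π l)) i = locInv r e (π i) := by
  rw [locInv, locInv]
  refine prod_bij' (fun l _ => π l) (fun l _ => π.symm l) ?_ ?_ ?_ ?_ ?_ <;> simp
  · intro a ha h
    exact ha (by rw [← h, π.apply_symm_apply])

theorem padeRes_comp_equiv [CharZero k] (ν : ℚ) (r : ℕ) (g : k) (H e : ι → k) (p : Polynomial k)
    (π : ι ≃ ι) (i : ι) :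
    padeRes ν r g (fun l => H (π l)) (fun l => e (π l)) p i = padeRes ν r g H e p (π i) := by
  simp only [padeRes, locCoeff, locInv_comp_equiv]

theorem isIntegral_coeff_mul {r : ℕ} {f f' : k⟦X⟧} {D D' : k}
    (h : ∀ j ≤ r, IsIntegral ℤ (D * coeff j f)) (h' : ∀ j ≤ r, IsIntegral ℤ (D' * coeff j f'))
    {j : ℕ} (hj : j ≤ r) : IsIntegral ℤ (D * D' * coeff j (f * f')) := by
  rw [coeff_mul, mul_sum]
  refine IsIntegral.sum _ fun p hp => ?_
  have := mem_antidiagonal.1 hp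
  have h1 := (h p.1 (by omega)).mul (h' p.2 (by omega))
  convert h1 using 1
  ring

theorem isIntegral_coeff_invPow {r : ℕ} {δ : k} (hδ : IsIntegral ℤ δ) {j : ℕ} (hj : j ≤ r) :
    IsIntegral ℤ (δ ^ (2 * r + 1) * coeff j (invPow r δ)) := by
  rcases eq_or_ne δ 0 with rfl | h0
  · simpa using isIntegral_zero
  rw [invPow, coeff_mk]
  have h1 : δ ^ (2 * r + 1) = δ ^ (r - j) * δ ^ (r + 1 + j) := by
    rw [← pow_add]
    congr 1
    omega
  have h2 : δ ^ (2 * r + 1) * ((-1) ^ j * ((r + j).choose r : k) * δ⁻¹ ^ (r + 1 + j)) =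
      ((-1) ^ j * ((r + j).choose r : k)) * δ ^ (r - j) := by
    rw [h1, inv_pow]
    field_simp
  rw [h2]
  exact (((isIntegral_one.neg).pow _).mul (isIntegral_natCast _)).mul (hδ.pow _)

theorem isIntegral_coeff_locInv {r : ℕ} {e : ι → k}
    (he : ∀ i l, IsIntegral ℤ (e i - e l)) (i : ι) {j : ℕ} (hj : j ≤ r) :
    IsIntegral ℤ ((∏ l ∈ univ.erase i, (e i - e l)) ^ (2 * r + 1) * coeff j (locInv r e i)) := by
  rw [locInv, ← prod_pow]
  generalize univ.erase i = s
  induction s using Finset.induction_on generalizing j with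
  | empty =>
    simp only [prod_empty, coeff_one, one_mul]
    split_ifs
    exacts [isIntegral_one, isIntegral_zero]
  | insert a s ha ih =>
    rw [prod_insert ha, prod_insert ha]
    exact isIntegral_coeff_mul (fun j hj => isIntegral_coeff_invPow (he i a) hj)
      (fun j hj => ih hj) hj

theorem isIntegral_padeFun [CharZero k] {ν : ℚ} {r : ℕ} {g D V c : k} {H e w : ι → k} (s : ℕ)
    (hD : ∀ m ≤ r, IsIntegral ℤ (D * ((Ring.choose ((r : ℚ) + ν) m : ℚ) : k) * g ^ m))
    (he : ∀ i l, IsIntegral ℤ (e i - e l)) (hc : IsIntegral ℤ c)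
    (hce : ∀ i, IsIntegral ℤ (c * e i)) (hH : ∀ i, IsIntegral ℤ (H i))
    (hw : ∀ i, IsIntegral ℤ (w i))
    (hV : ∀ i, ∃ v, IsIntegral ℤ v ∧ V = v * ∏ l ∈ univ.erase i, (e i - e l)) :
    IsIntegral ℤ (D * V ^ (2 * r + 1) *
      padeFun ν r g H e w ((Polynomial.C c * Polynomial.X) ^ s)) := by
  rw [padeFun_apply, mul_sum]
  refine IsIntegral.sum _ fun i _ => ?_
  rw [padeRes, mul_sum, mul_sum]
  refine IsIntegral.sum _ fun m hm => ?_
  have hm' : m ≤ r := Nat.lt_succ_iff.1 (mem_range.1 hm)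
  obtain ⟨v, hv, hVv⟩ := hV i
  have h1 : IsIntegral ℤ (V ^ (2 * r + 1) * locCoeff r e ((Polynomial.C c * Polynomial.X) ^ s) i
      (r - m)) := by
    have h2 : ∀ j ≤ r, IsIntegral ℤ (v ^ (2 * r + 1) * coeff j
        ((Polynomial.taylor (e i) ((Polynomial.C c * Polynomial.X) ^ s) : Polynomial k) :
          k⟦X⟧)) := by
      intro j _
      refine (hv.pow _).mul ?_
      rw [Polynomial.taylor_pow, Polynomial.taylor_mul, Polynomial.taylor_C, Polynomial.taylor_X,
        Polynomial.coeff_coe]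
      have h3 : (Polynomial.C c * (Polynomial.X + Polynomial.C (e i))) ^ s =
          Polynomial.map (algebraMap (integralClosure ℤ k) k)
          ((Polynomial.C ⟨c, hc⟩ * Polynomial.X + Polynomial.C ⟨c * e i, hce i⟩) ^ s) := by
        rw [Polynomial.map_pow, Polynomial.map_add, Polynomial.map_mul, Polynomial.map_C,
          Polynomial.map_C, Polynomial.map_X]
        change _ = (Polynomial.C c * Polynomial.X + Polynomial.C (c * e i)) ^ s
        rw [map_mul]
        ring
      rw [h3, Polynomial.coeff_map]
      exact (Polynomial.coeff ((Polynomial.C (⟨c, hc⟩ : integralClosure ℤ k) * Polynomial.X +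
        Polynomial.C (⟨c * e i, hce i⟩ : integralClosure ℤ k)) ^ s) j).2
    have := isIntegral_coeff_mul h2 (fun j hj => isIntegral_coeff_locInv he i hj)
      (Nat.sub_le r m)
    rw [← mul_pow, ← hVv] at this
    exact this
  have h4 := ((hw i).mul (((hD m hm').mul ((isIntegral_one.neg).pow m)).mul
    ((hH i).pow (r - m)))).mul h1
  convert h4 using 1
  rw [neg_pow g]
  ring

/-- The arithmetic lower bound for the Padé forms. -/
theorem exists_one_le_norm_padeFun {L : Type*} [Field L] [CharZero L] [IsGalois ℚ L] (φ : L →+* ℂ)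
    {ν : ℚ} (hν : ∀ m : ℤ, ν ≠ m) (r : ℕ) {h g D V c : L} {H e w : ι → L}
    (hg : g ≠ 0) (hD0 : D ≠ 0) (hc0 : c ≠ 0) (hV0 : V ≠ 0)
    (hei : Function.Injective e) (hHe : ∀ i, H i = h - g * e i) (hH0 : ∀ i, H i ≠ 0)
    {i₀ : ι} (hw0 : w i₀ ≠ 0)
    (hD : ∀ m ≤ r, IsIntegral ℤ (D * ((Ring.choose ((r : ℚ) + ν) m : ℚ) : L) * g ^ m))
    (he : ∀ i l, IsIntegral ℤ (e i - e l)) (hc : IsIntegral ℤ c)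
    (hce : ∀ i, IsIntegral ℤ (c * e i)) (hH : ∀ i, IsIntegral ℤ (H i))
    (hw : ∀ i, IsIntegral ℤ (w i))
    (hV : ∀ i, ∃ v, IsIntegral ℤ v ∧ V = v * ∏ l ∈ univ.erase i, (e i - e l))
    (hσ : ∀ σ : L ≃ₐ[ℚ] L, σ g = g ∧ σ D = D ∧ σ c = c ∧ (σ V = V ∨ σ V = -V) ∧
      ∃ π : ι ≃ ι, ∀ i, σ (H i) = H (π i) ∧ σ (e i) = e (π i) ∧ σ (w i) = w (π i)) :
    ∃ s < Fintype.card ι, 1 ≤ ‖φ D * φ V ^ (2 * r + 1) *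
      padeFun ν r (φ g) (fun i => φ (H i)) (fun i => φ (e i)) (fun i => φ (w i))
        ((Polynomial.C (φ c) * Polynomial.X) ^ s)‖ := by
  obtain ⟨s, hs, hne⟩ := exists_padeFun_ne_zero hν r hg hei hHe hH0 hw0
  refine ⟨s, hs, ?_⟩
  rw [← map_padeFun φ, ← map_pow, ← map_mul, ← map_mul]
  refine one_le_norm_of_galois φ (isIntegral_padeFun s hD he hc hce hH hw hV) ?_ fun σ => ?_
  · refine mul_ne_zero (mul_ne_zero hD0 (pow_ne_zero _ hV0)) ?_
    rw [mul_pow, ← Polynomial.C_pow, ← Polynomial.smul_eq_C_mul, map_smul]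
    exact smul_ne_zero (pow_ne_zero _ hc0) hne
  · obtain ⟨hg', hD', hc', hV', π, hπ⟩ := hσ σ
    have h1 : σ (padeFun ν r g H e w ((Polynomial.C c * Polynomial.X) ^ s)) =
        padeFun ν r g H e w ((Polynomial.C c * Polynomial.X) ^ s) := by
      have h2 := map_padeFun (σ : L →+* L) ν r g c H e w s
      simp only [RingHom.coe_coe, hg', hc', (hπ _).1, (hπ _).2.1, (hπ _).2.2] at h2
      rw [h2, padeFun_apply, padeFun_apply]
      simp only [padeRes_comp_equiv]
      exact Equiv.sum_comp π fun i => w i * padeRes ν r g H e _ i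
    rw [map_mul, map_mul, map_pow, h1, hD']
    rcases hV' with h | h <;> rw [h]
    · exact Or.inl rfl
    · right
      rw [Odd.neg_pow ⟨r, rfl⟩]
      ring

end PadeArithmetic

section BinomialTail

open Finset

theorem abs_choose_le_one {ν : ℚ} (h0 : 0 ≤ ν) (h1 : ν ≤ 1) (n : ℕ) : |Ring.choose ν n| ≤ 1 := by
  induction n with
  | zero => simp
  | succ n ih =>
    have h := succ_mul_choose_succ ν n
    have h2 : |((n : ℚ) + 1) * Ring.choose ν (n + 1)| ≤ 1 * (n + 1) := by
      rw [h, abs_mul]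
      refine mul_le_mul ih ?_ (abs_nonneg _) zero_le_one
      rw [abs_le]
      constructor <;> linarith [n.cast_nonneg (α := ℚ)]
    rw [abs_mul, abs_of_nonneg (by positivity)] at h2
    have : (0 : ℚ) < n + 1 := by positivity
    nlinarith

theorem abs_choose_add_le {ν : ℚ} (h0 : 0 ≤ ν) (h1 : ν ≤ 1) (j n : ℕ) :
    |Ring.choose ((j : ℚ) + ν) n| ≤ 2 ^ j := by
  induction j generalizing n with
  | zero => simpa using abs_choose_le_one h0 h1 n
  | succ j ih =>
    cases n with
    | zero =>
      rw [Ring.choose_zero_right, abs_one]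
      exact one_le_pow₀ (by norm_num)
    | succ n =>
      have h : ((j + 1 : ℕ) : ℚ) + ν = (j : ℚ) + ν + 1 := by push_cast; ring
      rw [h, Ring.choose_succ_succ, pow_succ, mul_two]
      exact (abs_add_le _ _).trans (add_le_add (ih _) (ih _))

theorem hasSum_one_add_cpow (ν : ℚ) (j : ℕ) {x : ℂ} (hx : ‖x‖ < 1) :
    HasSum (fun n => ((Ring.choose ((j : ℚ) + ν) n : ℚ) : ℂ) * x ^ n)
      ((1 + x) ^ (ν : ℂ) * (1 + x) ^ j) := by
  have h0 : 1 + x ≠ 0 := fun h0 => by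
    have : x = -1 := by linear_combination h0
    rw [this] at hx
    simp at hx
  have hmem : x ∈ Metric.eball (0 : ℂ) 1 := by
    rw [Metric.mem_eball, edist_zero_right, ← ofReal_norm, ENNReal.ofReal_lt_one]
    exact hx
  have h := (Complex.one_add_cpow_hasFPowerSeriesOnBall_zero (a := ((j : ℚ) + ν : ℚ))).hasSum hmem
  have h2 : (1 + (0 + x)) ^ (((j : ℚ) + ν : ℚ) : ℂ) = (1 + x) ^ (ν : ℂ) * (1 + x) ^ j := by
    push_cast
    rw [zero_add, Complex.cpow_add _ _ h0, Complex.cpow_natCast, mul_comm]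
  have h3 : (fun n => binomialSeries ℂ ((((j : ℚ) + ν : ℚ) : ℂ)) n fun _ => x) =
      fun n => ((Ring.choose ((j : ℚ) + ν) n : ℚ) : ℂ) * x ^ n := by
    ext n
    rw [binomialSeries_apply, List.ofFn_const, List.prod_replicate, smul_eq_mul]
    congr 1
    exact (Ring.map_choose (algebraMap ℚ ℂ) ((j : ℚ) + ν) n).symm
  rw [h2, h3] at h
  exact h

theorem norm_one_add_cpow_sub_le {ν : ℚ} (h0 : 0 ≤ ν) (h1 : ν ≤ 1) (j N : ℕ) {x : ℂ} {τ : ℝ}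
    (hx : ‖x‖ ≤ τ) (hτ : τ < 1) :
    ‖(1 + x) ^ (ν : ℂ) * (1 + x) ^ j -
      ∑ n ∈ range N, ((Ring.choose ((j : ℚ) + ν) n : ℚ) : ℂ) * x ^ n‖ ≤
      2 ^ j * τ ^ N / (1 - τ) := by
  have h := (hasSum_nat_add_iff' N).2 (hasSum_one_add_cpow ν j (hx.trans_lt hτ))
  have hτ0 : 0 ≤ τ := (norm_nonneg x).trans hx
  have hg : HasSum (fun n => 2 ^ j * τ ^ N * τ ^ n) (2 ^ j * τ ^ N * (1 - τ)⁻¹) :=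
    (hasSum_geometric_of_lt_one hτ0 hτ).mul_left _
  rw [div_eq_mul_inv]
  refine h.norm_le_of_bounded hg fun n => ?_
  rw [norm_mul, norm_pow, mul_assoc, ← pow_add, add_comm N]
  have h2 : ‖((Ring.choose ((j : ℚ) + ν) (n + N) : ℚ) : ℂ)‖ ≤ 2 ^ j := by
    rw [Complex.norm_ratCast]
    exact_mod_cast abs_choose_add_le h0 h1 j (n + N)
  gcongr

theorem norm_one_add_cpow_le {ν : ℚ} (h0 : 0 ≤ ν) (h1 : ν ≤ 1) {x : ℂ} (hx : ‖x‖ ≤ 1 / 4) :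
    ‖(1 + x) ^ (ν : ℂ)‖ ≤ 2 := by
  have h := norm_one_add_cpow_sub_le h0 h1 0 0 hx (by norm_num)
  simp only [pow_zero, range_zero, sum_empty, sub_zero, mul_one] at h
  exact h.trans (by norm_num)

end BinomialTail

section PadeTruncation

open PowerSeries Finset

theorem sum_range_eq_sum_range_sub {M : Type*} [AddCommMonoid M] (f : ℕ → M) {m : ℕ} (n : ℕ)
    (hf : ∀ j < m, f j = 0) : ∑ j ∈ range n, f j = ∑ j ∈ range (n - m), f (m + j) := by
  rcases le_total n m with h | h
  · rw [Nat.sub_eq_zero_of_le h, range_zero, sum_empty]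
    exact sum_eq_zero fun j hj => hf j ((mem_range.1 hj).trans_le h)
  · obtain ⟨d, rfl⟩ := Nat.exists_eq_add_of_le h
    rw [sum_range_add, sum_eq_zero fun j hj => hf j (mem_range.1 hj), zero_add,
      Nat.add_sub_cancel_left]

variable {k : Type*} [Field k] {ι : Type*} [Fintype ι] [DecidableEq ι]

theorem locCoeff_X_pow_mul (r : ℕ) (e : ι → k) (p : Polynomial k) (i : ι) (n : ℕ) :
    locCoeff r e (Polynomial.X ^ n * p) i r =
      ∑ m ∈ range (r + 1), (n.choose m : k) * e i ^ (n - m) * locCoeff r e p i (r - m) := by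
  rw [locCoeff, Polynomial.taylor_mul, Polynomial.coe_mul, mul_assoc, coeff_mul,
    Finset.Nat.sum_antidiagonal_eq_sum_range_succ_mk]
  refine sum_congr rfl fun m _ => ?_
  rw [Polynomial.coeff_coe, Polynomial.taylor_pow, Polynomial.taylor_X,
    Polynomial.coeff_X_add_C_pow, locCoeff]
  ring

theorem sum_truncated_eq_zero [CharZero k] (ν : ℚ) (r : ℕ) {e : ι → k}
    (he : Function.Injective e) {p : Polynomial k} (hp : p.natDegree < Fintype.card ι) (t : k) :
    ∑ i, ∑ m ∈ range (r + 1), ((Ring.choose ((r : ℚ) + ν) m : ℚ) : k) * (-t) ^ m *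
      (∑ n ∈ range (Fintype.card ι * r - m),
        ((Ring.choose (((r - m : ℕ) : ℚ) + ν) n : ℚ) : k) * (-t * e i) ^ n) *
      locCoeff r e p i (r - m) = 0 := by
  have key : ∀ i, (∑ m ∈ range (r + 1), ((Ring.choose ((r : ℚ) + ν) m : ℚ) : k) * (-t) ^ m *
      (∑ n ∈ range (Fintype.card ι * r - m),
        ((Ring.choose (((r - m : ℕ) : ℚ) + ν) n : ℚ) : k) * (-t * e i) ^ n) *
      locCoeff r e p i (r - m)) =
      ∑ n ∈ range (Fintype.card ι * r), ((Ring.choose ((r : ℚ) + ν) n : ℚ) : k) * (-t) ^ n *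
        locCoeff r e (Polynomial.X ^ n * p) i r := by
    intro i
    simp_rw [locCoeff_X_pow_mul, mul_sum]
    rw [sum_comm]
    refine sum_congr rfl fun m hm => ?_
    have hm' : m ≤ r := Nat.lt_succ_iff.1 (mem_range.1 hm)
    rw [sum_mul]
    symm
    rw [sum_range_eq_sum_range_sub (m := m) _ _ fun j hj => by
      rw [Nat.choose_eq_zero_of_lt hj]; simp]
    refine sum_congr rfl fun n _ => ?_
    have h := Ring.choose_smul_choose ((r : ℚ) + ν) (Nat.le_add_right m n)
    rw [Nat.add_sub_cancel_left, nsmul_eq_mul] at h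
    have h2 : (((r - m : ℕ) : ℚ) + ν) = (r : ℚ) + ν - m := by
      rw [Nat.cast_sub hm']
      ring
    have h3 := congrArg (fun q : ℚ => (q : k)) h
    simp only [Rat.cast_mul, Rat.cast_natCast] at h3
    rw [h2, Nat.add_sub_cancel_left, mul_pow, pow_add]
    linear_combination ((-t) ^ m * (-t) ^ n * e i ^ n * locCoeff r e p i (r - m)) * h3
  rw [sum_congr rfl fun i _ => key i, sum_comm]
  refine sum_eq_zero fun n hn => ?_
  rw [← mul_sum, sum_locCoeff_eq_zero r he, mul_zero]
  have h1 : (Polynomial.X ^ n * p).natDegree ≤ n + p.natDegree :=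
    Polynomial.natDegree_mul_le.trans (by rw [Polynomial.natDegree_X_pow])
  have := mem_range.1 hn
  rw [mul_add, mul_one]
  omega

theorem sum_le_of_norm_locCoeff_le {r : ℕ} {e : ι → ℂ} {p : Polynomial ℂ} {i : ι} {E B A : ℝ}
    (hA : 0 ≤ A) {F : ℕ → ℂ}
    (hB : ∑ a ∈ range (r + 1), ‖locCoeff r e p i a‖ * (E / 2) ^ a ≤ B)
    (hF : ∀ m ≤ r, ‖F m‖ ≤ A * (‖locCoeff r e p i (r - m)‖ * (E / 2) ^ (r - m))) :
    ‖∑ m ∈ range (r + 1), F m‖ ≤ A * B := by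
  calc ‖∑ m ∈ range (r + 1), F m‖
      ≤ ∑ m ∈ range (r + 1), A * (‖locCoeff r e p i (r - m)‖ * (E / 2) ^ (r - m)) :=
        norm_sum_le_of_le _ fun m hm => hF m (Nat.lt_succ_iff.1 (mem_range.1 hm))
    _ = A * ∑ a ∈ range (r + 1), ‖locCoeff r e p i a‖ * (E / 2) ^ a := by
        rw [← mul_sum, ← sum_range_reflect (fun a => ‖locCoeff r e p i a‖ * (E / 2) ^ a) (r + 1)]
        simp only [Nat.add_sub_cancel]
    _ ≤ A * B := by gcongr

/-- The analytic upper bound for the Padé forms. -/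
theorem norm_padeFun_le {ν : ℚ} (hν0 : 0 ≤ ν) (hν1 : ν ≤ 1) (r : ℕ) {e : ι → ℂ}
    (he : Function.Injective e) {p : Polynomial ℂ} (hp : p.natDegree < Fintype.card ι)
    {h t q κ : ℂ} {κ' : ι → ℂ} {E τ η B : ℝ} (hE : 0 < E) (heE : ∀ i, ‖e i‖ ≤ E)
    (htτ : ‖t‖ * E ≤ τ) (hτ : τ ≤ 1 / 4) (hη : ∀ i, ‖κ' i - κ‖ ≤ η)
    (hB : ∀ i, ∑ a ∈ range (r + 1), ‖locCoeff r e p i a‖ * (E / 2) ^ a ≤ B) :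
    ‖padeFun ν r (h * t) (fun i => h * (1 - t * e i)) e
        (fun i => q * (1 - t * e i) ^ (ν : ℂ) * κ' i) p‖ * E ^ r ≤
      Fintype.card ι * (‖q‖ * ‖h‖ ^ r * B *
        (2 * 8 ^ r * τ ^ (Fintype.card ι * r) * ‖κ‖ + 2 * 5 ^ r * η)) := by
  set n := Fintype.card ι with hn
  have hn1 : 1 ≤ n := by omega
  have hτ0 : 0 ≤ τ := le_trans (by positivity) htτ
  have hx : ∀ i, ‖-t * e i‖ ≤ τ := fun i => by
    rw [norm_mul, norm_neg]
    exact (mul_le_mul_of_nonneg_left (heE i) (norm_nonneg t)).trans htτ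
  have hB0 : ∀ i : ι, 0 ≤ B := fun i => (sum_nonneg fun a _ => by positivity).trans (hB i)
  have hc : ∀ m, ‖((Ring.choose ((r : ℚ) + ν) m : ℚ) : ℂ)‖ ≤ 2 ^ r := fun m => by
    rw [Complex.norm_ratCast]
    exact_mod_cast abs_choose_add_le hν0 hν1 r m
  set R : ι → ℂ := fun i => ∑ m ∈ range (r + 1), ((Ring.choose ((r : ℚ) + ν) m : ℚ) : ℂ) *
    (-t) ^ m * (1 + -t * e i) ^ (r - m) * locCoeff r e p i (r - m) with hR
  set T : ι → ℂ := fun i => ∑ m ∈ range (r + 1), ((Ring.choose ((r : ℚ) + ν) m : ℚ) : ℂ) *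
    (-t) ^ m * ((1 + -t * e i) ^ (ν : ℂ) * (1 + -t * e i) ^ (r - m) -
      ∑ l ∈ range (n * r - m), ((Ring.choose (((r - m : ℕ) : ℚ) + ν) l : ℚ) : ℂ) *
        (-t * e i) ^ l) * locCoeff r e p i (r - m) with hT
  have hres : ∀ i, padeRes ν r (h * t) (fun i => h * (1 - t * e i)) e p i = h ^ r * R i := by
    intro i
    rw [padeRes, hR, mul_sum]
    refine sum_congr rfl fun m hm => ?_
    have hm' : m ≤ r := Nat.lt_succ_iff.1 (mem_range.1 hm)
    rw [show h ^ r = h ^ m * h ^ (r - m) by rw [← pow_add]; congr 1; omega, mul_pow,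
      ← mul_neg, mul_pow, neg_mul, ← sub_eq_add_neg]
    ring
  have hmain : ∑ i, (1 + -t * e i) ^ (ν : ℂ) * R i = ∑ i, T i := by
    rw [← sub_eq_zero, ← sum_sub_distrib, ← sum_truncated_eq_zero ν r he hp t]
    refine sum_congr rfl fun i _ => ?_
    rw [hR, hT, mul_sum, ← sum_sub_distrib]
    refine sum_congr rfl fun m _ => ?_
    ring
  have hΛ : padeFun ν r (h * t) (fun i => h * (1 - t * e i)) e
      (fun i => q * (1 - t * e i) ^ (ν : ℂ) * κ' i) p =
      q * h ^ r * ∑ i, (κ * T i + (1 + -t * e i) ^ (ν : ℂ) * (κ' i - κ) * R i) := by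
    rw [padeFun_apply, sum_add_distrib, ← mul_sum, ← hmain, mul_sum, ← sum_add_distrib, mul_sum]
    refine sum_congr rfl fun i _ => ?_
    rw [hres, sub_eq_add_neg, neg_mul]
    ring
  have hTb : ∀ i, ‖T i * E ^ r‖ ≤ 2 * 8 ^ r * τ ^ (n * r) * B := by
    intro i
    rw [hT, sum_mul]
    refine sum_le_of_norm_locCoeff_le (by positivity) (hB i) fun m hm => ?_
    have h1 := norm_one_add_cpow_sub_le hν0 hν1 (r - m) (n * r - m) (hx i)
      (hτ.trans_lt (by norm_num))
    have h2 : 2 ^ (r - m) * τ ^ (n * r - m) / (1 - τ) ≤ 2 * 2 ^ (r - m) * τ ^ (n * r - m) := by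
      rw [div_le_iff₀ (by linarith)]
      have : 0 ≤ 2 ^ (r - m) * τ ^ (n * r - m) := by positivity
      nlinarith
    have h3 : ‖t‖ ^ m * E ^ m ≤ τ ^ m := by
      rw [← mul_pow]
      gcongr
    have hmn : m ≤ n * r := hm.trans (Nat.le_mul_of_pos_left r hn1)
    have h8 : (2 : ℝ) ^ r * 2 ^ (r - m) * 2 ^ (r - m) ≤ 8 ^ r := by
      calc (2 : ℝ) ^ r * 2 ^ (r - m) * 2 ^ (r - m) ≤ 2 ^ r * 2 ^ r * 2 ^ r := by
            gcongr <;> norm_num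
        _ = 8 ^ r := by rw [← mul_pow, ← mul_pow]; norm_num
    rw [norm_mul, norm_mul, norm_mul, norm_mul, norm_pow, norm_neg, norm_pow, Complex.norm_real,
      Real.norm_of_nonneg hE.le]
    calc _ ≤ 2 ^ r * ‖t‖ ^ m * (2 * 2 ^ (r - m) * τ ^ (n * r - m)) *
          ‖locCoeff r e p i (r - m)‖ * E ^ r := by
          gcongr
          exacts [hc m, h1.trans h2]
      _ = 2 * (2 ^ r * 2 ^ (r - m) * 2 ^ (r - m)) * ((‖t‖ ^ m * E ^ m) * τ ^ (n * r - m)) *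
          (‖locCoeff r e p i (r - m)‖ * (E / 2) ^ (r - m)) := by
          rw [show E ^ r = E ^ m * E ^ (r - m) by rw [← pow_add]; congr 1; omega, div_pow]
          field_simp
      _ ≤ 2 * 8 ^ r * (τ ^ m * τ ^ (n * r - m)) *
          (‖locCoeff r e p i (r - m)‖ * (E / 2) ^ (r - m)) := by
          gcongr
      _ = _ := by rw [← pow_add, Nat.add_sub_cancel' hmn]
  have hRb : ∀ i, ‖R i * E ^ r‖ ≤ 5 ^ r * B := by
    intro i
    rw [hR, sum_mul]
    refine sum_le_of_norm_locCoeff_le (by positivity) (hB i) fun m hm => ?_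
    have h1 : ‖1 + -t * e i‖ ≤ 5 / 4 :=
      (norm_add_le _ _).trans (by rw [norm_one]; linarith [hx i])
    have h3 : ‖t‖ ^ m * E ^ m ≤ 1 := by
      rw [← mul_pow]
      exact pow_le_one₀ (by positivity) (by linarith)
    have h5 : (2 : ℝ) ^ r * (5 / 4) ^ (r - m) * 2 ^ (r - m) ≤ 5 ^ r := by
      calc (2 : ℝ) ^ r * (5 / 4) ^ (r - m) * 2 ^ (r - m) ≤ 2 ^ r * (5 / 4) ^ r * 2 ^ r := by
            gcongr <;> norm_num
        _ = 5 ^ r := by rw [← mul_pow, ← mul_pow]; norm_num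
    rw [norm_mul, norm_mul, norm_mul, norm_mul, norm_pow, norm_pow, norm_neg, norm_pow,
      Complex.norm_real, Real.norm_of_nonneg hE.le]
    calc _ ≤ 2 ^ r * ‖t‖ ^ m * (5 / 4) ^ (r - m) *
          ‖locCoeff r e p i (r - m)‖ * E ^ r := by
          gcongr
          exact hc m
      _ = (2 ^ r * (5 / 4) ^ (r - m) * 2 ^ (r - m)) * (‖t‖ ^ m * E ^ m) *
          (‖locCoeff r e p i (r - m)‖ * (E / 2) ^ (r - m)) := by
          rw [show E ^ r = E ^ m * E ^ (r - m) by rw [← pow_add]; congr 1; omega, div_pow (E)]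
          field_simp
      _ ≤ 5 ^ r * 1 * (‖locCoeff r e p i (r - m)‖ * (E / 2) ^ (r - m)) := by
          gcongr
      _ = _ := by rw [mul_one]
  have hsum : ‖(∑ i, (κ * T i + (1 + -t * e i) ^ (ν : ℂ) * (κ' i - κ) * R i)) * E ^ r‖ ≤
      n * (‖κ‖ * (2 * 8 ^ r * τ ^ (n * r) * B) + 2 * η * (5 ^ r * B)) := by
    rw [sum_mul, hn, ← nsmul_eq_mul]
    refine (norm_sum_le _ _).trans (sum_le_card_nsmul _ _ _ fun i _ => ?_)
    rw [add_mul]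
    refine (norm_add_le _ _).trans (add_le_add ?_ ?_)
    · rw [mul_assoc, norm_mul]
      gcongr
      exact hTb i
    · rw [mul_assoc, norm_mul, norm_mul]
      have hη0 : 0 ≤ η := (norm_nonneg _).trans (hη i)
      gcongr
      exacts [norm_one_add_cpow_le hν0 hν1 ((hx i).trans hτ), hη i, hRb i]
  rw [hΛ, norm_mul, norm_mul, norm_pow]
  have h1 : ‖(E : ℂ) ^ r‖ = E ^ r := by
    rw [norm_pow, Complex.norm_real, Real.norm_of_nonneg hE.le]
  rw [norm_mul, h1] at hsum
  calc _ = ‖q‖ * ‖h‖ ^ r *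
      (‖∑ i, (κ * T i + (1 + -t * e i) ^ (ν : ℂ) * (κ' i - κ) * R i)‖ * E ^ r) := by ring
    _ ≤ ‖q‖ * ‖h‖ ^ r * (n * (‖κ‖ * (2 * 8 ^ r * τ ^ (n * r) * B) + 2 * η * (5 ^ r * B))) := by
      gcongr
    _ = _ := by ring

end PadeTruncation

section PadeNorm

open PowerSeries Finset

/-- The weighted `ℓ¹`-norm of the first `r + 1` coefficients of a power series. -/
noncomputable def truncNorm (r : ℕ) (ρ : ℝ) (f : ℂ⟦X⟧) : ℝ :=
  ∑ a ∈ range (r + 1), ‖coeff a f‖ * ρ ^ a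

theorem truncNorm_nonneg (r : ℕ) {ρ : ℝ} (hρ : 0 ≤ ρ) (f : ℂ⟦X⟧) : 0 ≤ truncNorm r ρ f :=
  sum_nonneg fun _ _ => by positivity

theorem truncNorm_mul_le (r : ℕ) {ρ : ℝ} (hρ : 0 ≤ ρ) (f g : ℂ⟦X⟧) :
    truncNorm r ρ (f * g) ≤ truncNorm r ρ f * truncNorm r ρ g := by
  have h1 : truncNorm r ρ (f * g) ≤ ∑ a ∈ range (r + 1), ∑ p ∈ antidiagonal a,
      (‖coeff p.1 f‖ * ρ ^ p.1) * (‖coeff p.2 g‖ * ρ ^ p.2) := by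
    refine sum_le_sum fun a _ => ?_
    rw [coeff_mul]
    calc _ ≤ (∑ p ∈ antidiagonal a, ‖coeff p.1 f‖ * ‖coeff p.2 g‖) * ρ ^ a := by
          gcongr
          exact norm_sum_le_of_le _ fun p _ => norm_mul_le _ _
      _ = _ := by
          rw [sum_mul]
          refine sum_congr rfl fun p hp => ?_
          rw [← mem_antidiagonal.1 hp, pow_add]
          ring
  refine h1.trans ?_
  have hdisj : (↑(range (r + 1)) : Set ℕ).PairwiseDisjoint
      (fun a => (antidiagonal a : Finset (ℕ × ℕ))) := by
    intro a _ b _ hab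
    rw [Function.onFun, Finset.disjoint_left]
    intro p hp hp'
    exact hab ((mem_antidiagonal.1 hp).symm.trans (mem_antidiagonal.1 hp'))
  rw [truncNorm, truncNorm, sum_mul_sum, ← sum_product', ← sum_biUnion hdisj]
  refine sum_le_sum_of_subset_of_nonneg ?_ fun p _ _ => by positivity
  intro p hp
  obtain ⟨a, ha, hp⟩ := mem_biUnion.1 hp
  have h1 := mem_range.1 ha
  have h2 := mem_antidiagonal.1 hp
  rw [mem_product, mem_range, mem_range]
  omega

theorem truncNorm_one (r : ℕ) (ρ : ℝ) : truncNorm r ρ 1 = 1 := by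
  rw [truncNorm, sum_eq_single 0]
  · simp
  · intro b _ hb
    simp [coeff_one, hb]
  · simp

theorem truncNorm_prod_le (r : ℕ) {ρ : ℝ} (hρ : 0 ≤ ρ) {ι : Type*} (s : Finset ι)
    (f : ι → ℂ⟦X⟧) : truncNorm r ρ (∏ i ∈ s, f i) ≤ ∏ i ∈ s, truncNorm r ρ (f i) := by
  classical
  induction s using Finset.induction_on with
  | empty => simp [truncNorm_one]
  | insert a s ha ih =>
    rw [prod_insert ha, prod_insert ha]
    exact (truncNorm_mul_le r hρ _ _).trans
      (mul_le_mul_of_nonneg_left ih (truncNorm_nonneg r hρ _))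

theorem truncNorm_linear_le (r : ℕ) {ρ : ℝ} (hρ : 0 ≤ ρ) (a b : ℂ) :
    truncNorm r ρ (C a * X + C b) ≤ ‖a‖ * ρ + ‖b‖ := by
  have h : ∀ j, coeff j (C a * X + C b : ℂ⟦X⟧) = if j = 0 then b else if j = 1 then a else 0 := by
    intro j
    rcases j with _ | _ | j <;> simp [coeff_C, coeff_X]
  rw [truncNorm, sum_range_succ']
  have h2 : ∑ k ∈ range r, ‖coeff (k + 1) (C a * X + C b : ℂ⟦X⟧)‖ * ρ ^ (k + 1) ≤ ‖a‖ * ρ := by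
    cases r with
    | zero => simpa using by positivity
    | succ r =>
      rw [sum_range_succ', sum_eq_zero]
      · simp [h]
      · intro j _
        simp [h]
  refine add_le_add h2 ?_
  simp [h]

theorem sum_choose_div_two_pow_le (r N : ℕ) :
    ∑ a ∈ range N, ((r + a).choose r : ℝ) / 2 ^ a ≤ 2 ^ (r + 1) := by
  induction r with
  | zero =>
    have := sum_geometric_two_le N
    simpa [div_eq_mul_inv] using this
  | succ r ih =>
    have key : ∑ a ∈ range N, ((r + 1 + a).choose (r + 1) : ℝ) / 2 ^ a ≤
        ∑ a ∈ range N, ((r + a).choose r : ℝ) / 2 ^ a +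
        1 / 2 * ∑ a ∈ range N, ((r + 1 + a).choose (r + 1) : ℝ) / 2 ^ a := by
      cases N with
      | zero => simp
      | succ N =>
        rw [sum_range_succ' (fun a => ((r + 1 + a).choose (r + 1) : ℝ) / 2 ^ a),
          sum_range_succ' (fun a => ((r + a).choose r : ℝ) / 2 ^ a)]
        have h1 : ∀ a, ((r + 1 + (a + 1)).choose (r + 1) : ℝ) / 2 ^ (a + 1) =
            ((r + (a + 1)).choose r : ℝ) / 2 ^ (a + 1) +
            1 / 2 * (((r + 1 + a).choose (r + 1) : ℝ) / 2 ^ a) := by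
          intro a
          rw [show r + 1 + (a + 1) = (r + 1 + a) + 1 by ring, Nat.choose_succ_succ]
          rw [show r + (a + 1) = r + 1 + a by ring]
          push_cast
          rw [pow_succ]
          field_simp
        have h2 : ∑ a ∈ range N, ((r + 1 + a).choose (r + 1) : ℝ) / 2 ^ a ≤
            ∑ a ∈ range N, ((r + 1 + (a + 1)).choose (r + 1) : ℝ) / 2 ^ (a + 1) +
              ((r + 1 + 0).choose (r + 1) : ℝ) / 2 ^ 0 := by
          rw [← sum_range_succ' (fun a => ((r + 1 + a).choose (r + 1) : ℝ) / 2 ^ a),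
            sum_range_succ (fun a => ((r + 1 + a).choose (r + 1) : ℝ) / 2 ^ a)]
          have : (0 : ℝ) ≤ ((r + 1 + N).choose (r + 1) : ℝ) / 2 ^ N := by positivity
          linarith
        have h3 : ∑ a ∈ range N, ((r + 1 + (a + 1)).choose (r + 1) : ℝ) / 2 ^ (a + 1) =
            ∑ a ∈ range N, ((r + (a + 1)).choose r : ℝ) / 2 ^ (a + 1) +
            1 / 2 * ∑ a ∈ range N, ((r + 1 + a).choose (r + 1) : ℝ) / 2 ^ a := by
          rw [mul_sum, ← sum_add_distrib]
          exact sum_congr rfl fun a _ => h1 a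
        simp only [add_zero, Nat.choose_self, pow_zero, div_one, Nat.cast_one] at h2 ⊢
        linarith
    rw [pow_succ]
    linarith

theorem norm_pow_mul_truncNorm_invPow_le (r : ℕ) {δ : ℂ} {E : ℝ} (hδ : ‖δ‖ ≤ E) :
    ‖δ‖ ^ (2 * r + 1) * truncNorm r (E / 2) (invPow r δ) ≤ E ^ r * 2 ^ (r + 1) := by
  have hE : 0 ≤ E := (norm_nonneg δ).trans hδ
  rcases eq_or_ne δ 0 with rfl | h0
  · rw [norm_zero, zero_pow (by omega), zero_mul]
    positivity
  have h1 : ‖δ‖ ≠ 0 := norm_ne_zero_iff.2 h0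
  refine le_trans ?_ (mul_le_mul_of_nonneg_left (sum_choose_div_two_pow_le r (r + 1))
    (pow_nonneg hE r))
  rw [truncNorm, mul_sum, mul_sum]
  refine sum_le_sum fun a ha => ?_
  have ha' : a ≤ r := Nat.lt_succ_iff.1 (mem_range.1 ha)
  rw [invPow, coeff_mk, norm_mul, norm_mul, norm_pow, norm_neg, norm_one, one_pow, one_mul,
    norm_pow, norm_inv, Complex.norm_natCast, div_pow,
    show ‖δ‖ ^ (2 * r + 1) = ‖δ‖ ^ (r - a) * ‖δ‖ ^ (r + 1 + a) by
      rw [← pow_add]; congr 1; omega,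
    show E ^ r = E ^ (r - a) * E ^ a by rw [← pow_add]; congr 1; omega]
  calc _ = ‖δ‖ ^ (r - a) * E ^ a * (((r + a).choose r : ℝ) / 2 ^ a) := by
        have h3 := pow_ne_zero (r + 1 + a) h1
        rw [inv_pow]
        field_simp
    _ ≤ E ^ (r - a) * E ^ a * (((r + a).choose r : ℝ) / 2 ^ a) := by gcongr

variable {ι : Type*} [Fintype ι] [DecidableEq ι]

theorem norm_pow_mul_sum_locCoeff_le (r : ℕ) {e : ι → ℂ} {i : ι} {V v c : ℂ} {s : ℕ}
    {E A : ℝ} (hE : 0 ≤ E) (hei : ‖e i‖ ≤ E) (he : ∀ l, ‖e i - e l‖ ≤ E)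
    (hV : V = v * ∏ l ∈ univ.erase i, (e i - e l)) (hv : ‖v‖ ≤ A) :
    ‖V‖ ^ (2 * r + 1) * ∑ a ∈ range (r + 1),
      ‖locCoeff r e ((Polynomial.C c * Polynomial.X) ^ s) i a‖ * (E / 2) ^ a ≤
      A ^ (2 * r + 1) * (E ^ r * 2 ^ (r + 1)) ^ (Fintype.card ι - 1) * (2 * ‖c‖ * E) ^ s := by
  have hE2 : 0 ≤ E / 2 := by positivity
  have h0 : ((Polynomial.taylor (e i) ((Polynomial.C c * Polynomial.X) ^ s) :
      Polynomial ℂ) : ℂ⟦X⟧) = ∏ _j ∈ range s, (C c * X + C (c * e i)) := by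
    rw [Polynomial.taylor_pow, Polynomial.taylor_mul, Polynomial.taylor_C, Polynomial.taylor_X,
      prod_const, card_range, Polynomial.coe_pow, Polynomial.coe_mul, Polynomial.coe_add,
      Polynomial.coe_C, Polynomial.coe_C, Polynomial.coe_X, mul_add, ← map_mul]
  have h1 : truncNorm r (E / 2) ((Polynomial.taylor (e i) ((Polynomial.C c * Polynomial.X) ^ s) :
      Polynomial ℂ) : ℂ⟦X⟧) ≤ (2 * ‖c‖ * E) ^ s := by
    rw [h0]
    refine (truncNorm_prod_le r hE2 _ _).trans ?_
    rw [prod_const, card_range]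
    refine pow_le_pow_left₀ (truncNorm_nonneg r hE2 _) ?_ s
    refine (truncNorm_linear_le r hE2 _ _).trans ?_
    rw [norm_mul]
    have : ‖c‖ * ‖e i‖ ≤ ‖c‖ * E := by gcongr
    nlinarith [norm_nonneg c, mul_nonneg (norm_nonneg c) hE]
  have h2 : (∏ l ∈ univ.erase i, ‖e i - e l‖) ^ (2 * r + 1) * truncNorm r (E / 2) (locInv r e i) ≤
      (E ^ r * 2 ^ (r + 1)) ^ (Fintype.card ι - 1) := by
    rw [locInv, ← card_univ, ← card_erase_of_mem (mem_univ i), ← prod_const]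
    calc _ ≤ (∏ l ∈ univ.erase i, ‖e i - e l‖) ^ (2 * r + 1) *
          ∏ l ∈ univ.erase i, truncNorm r (E / 2) (invPow r (e i - e l)) := by
          gcongr
          exact truncNorm_prod_le r hE2 _ _
      _ = ∏ l ∈ univ.erase i, ‖e i - e l‖ ^ (2 * r + 1) *
          truncNorm r (E / 2) (invPow r (e i - e l)) := by
          rw [← prod_pow, ← prod_mul_distrib]
      _ ≤ _ := by
          refine prod_le_prod (fun l _ => ?_) fun l _ => norm_pow_mul_truncNorm_invPow_le r (he l)
          exact mul_nonneg (by positivity) (truncNorm_nonneg r hE2 _)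
  have h3 : ∑ a ∈ range (r + 1),
      ‖locCoeff r e ((Polynomial.C c * Polynomial.X) ^ s) i a‖ * (E / 2) ^ a ≤
      (2 * ‖c‖ * E) ^ s * truncNorm r (E / 2) (locInv r e i) := by
    refine (truncNorm_mul_le r hE2 _ _).trans ?_
    exact mul_le_mul_of_nonneg_right h1 (truncNorm_nonneg r hE2 _)
  have h4 : ‖V‖ ^ (2 * r + 1) = ‖v‖ ^ (2 * r + 1) *
      (∏ l ∈ univ.erase i, ‖e i - e l‖) ^ (2 * r + 1) := by
    rw [hV, norm_mul, norm_prod, mul_pow]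
  rw [h4]
  have hA : 0 ≤ A := (norm_nonneg v).trans hv
  have hp : 0 ≤ ∏ l ∈ univ.erase i, ‖e i - e l‖ := prod_nonneg fun _ _ => norm_nonneg _
  calc _ ≤ ‖v‖ ^ (2 * r + 1) * (∏ l ∈ univ.erase i, ‖e i - e l‖) ^ (2 * r + 1) *
        ((2 * ‖c‖ * E) ^ s * truncNorm r (E / 2) (locInv r e i)) := by gcongr
    _ = ‖v‖ ^ (2 * r + 1) * ((∏ l ∈ univ.erase i, ‖e i - e l‖) ^ (2 * r + 1) *
        truncNorm r (E / 2) (locInv r e i)) * (2 * ‖c‖ * E) ^ s := by ring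
    _ ≤ _ := by
      have h5 := truncNorm_nonneg r hE2 (locInv r e i)
      gcongr

theorem norm_pow_mul_padeFun_le {ν : ℚ} (hν0 : 0 ≤ ν) (hν1 : ν ≤ 1) (r : ℕ) {e : ι → ℂ}
    (he : Function.Injective e) {s : ℕ} (hs : s < Fintype.card ι)
    {h t q κ V c : ℂ} {κ' : ι → ℂ} {E τ η A : ℝ} (hE : 1 ≤ E) (heE : ∀ i, ‖e i‖ ≤ E)
    (heE' : ∀ i l, ‖e i - e l‖ ≤ E) (hc : 1 ≤ ‖c‖)
    (hV : ∀ i, ∃ v, ‖v‖ ≤ A ∧ V = v * ∏ l ∈ univ.erase i, (e i - e l)) (hV0 : V ≠ 0)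
    (htτ : ‖t‖ * E ≤ τ) (hτ : τ ≤ 1 / 4) (hη : ∀ i, ‖κ' i - κ‖ ≤ η) :
    ‖V ^ (2 * r + 1) * padeFun ν r (h * t) (fun i => h * (1 - t * e i)) e
        (fun i => q * (1 - t * e i) ^ (ν : ℂ) * κ' i) ((Polynomial.C c * Polynomial.X) ^ s)‖ *
        E ^ r ≤
      Fintype.card ι * (‖q‖ * ‖h‖ ^ r * (A ^ (2 * r + 1) *
        (E ^ (r + 1) * 2 ^ (r + 2) * ‖c‖) ^ (Fintype.card ι - 1)) *
        (2 * 8 ^ r * τ ^ (Fintype.card ι * r) * ‖κ‖ + 2 * 5 ^ r * η)) := by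
  have hVp : 0 < ‖V‖ ^ (2 * r + 1) := pow_pos (norm_pos_iff.2 hV0) _
  have hE0 : 0 < E := by linarith
  have hB : ∀ i, ∑ a ∈ range (r + 1),
      ‖locCoeff r e ((Polynomial.C c * Polynomial.X) ^ s) i a‖ * (E / 2) ^ a ≤
      A ^ (2 * r + 1) * (E ^ (r + 1) * 2 ^ (r + 2) * ‖c‖) ^ (Fintype.card ι - 1) /
        ‖V‖ ^ (2 * r + 1) := by
    intro i
    obtain ⟨v, hv, hVv⟩ := hV i
    have hA : 0 ≤ A := (norm_nonneg v).trans hv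
    rw [le_div_iff₀ hVp, mul_comm]
    refine (norm_pow_mul_sum_locCoeff_le r hE0.le (heE i) (heE' i) hVv hv).trans ?_
    rw [mul_assoc]
    refine mul_le_mul_of_nonneg_left ?_ (pow_nonneg hA _)
    calc (E ^ r * 2 ^ (r + 1)) ^ (Fintype.card ι - 1) * (2 * ‖c‖ * E) ^ s
        ≤ (E ^ r * 2 ^ (r + 1)) ^ (Fintype.card ι - 1) *
          (2 * ‖c‖ * E) ^ (Fintype.card ι - 1) := by
          gcongr
          · nlinarith
          · omega
      _ = _ := by
          rw [← mul_pow]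
          ring
  have hdeg : ((Polynomial.C c * Polynomial.X) ^ s : Polynomial ℂ).natDegree <
      Fintype.card ι := by
    refine lt_of_le_of_lt ?_ hs
    refine Polynomial.natDegree_pow_le.trans ?_
    have := (Polynomial.natDegree_C_mul_le c (Polynomial.X : Polynomial ℂ)).trans
      Polynomial.natDegree_X_le
    nlinarith
  have := norm_padeFun_le hν0 hν1 r he hdeg (h := h) (q := q) hE0 heE htτ hτ hη hB
  rw [norm_mul, norm_pow, mul_assoc]
  calc _ ≤ ‖V‖ ^ (2 * r + 1) * _ := mul_le_mul_of_nonneg_left this hVp.le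
    _ = _ := by
      have h3 := hVp.ne'
      field_simp

end PadeNorm

section CubicPade

open Finset

theorem eq_one_of_pow_three_eq_one {z : ℂ} (h : z ^ 3 = 1) (h1 : ‖z - 1‖ ≤ 1 / 2) : z = 1 := by
  by_contra hne
  have h2 : (z - 1) * ((z - 1) + 3) = -3 := by
    apply mul_left_cancel₀ (sub_ne_zero.2 hne)
    linear_combination h
  have h3 := congrArg norm h2
  rw [norm_mul, norm_neg] at h3
  have h4 : ‖(z - 1) + 3‖ ≤ ‖z - 1‖ + 3 := (norm_add_le _ _).trans (by simp)
  have h5 : ‖(3 : ℂ)‖ = 3 := by simp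
  rw [h5] at h3
  nlinarith [norm_nonneg (z - 1)]

theorem norm_cpow_sub_one_le {ν : ℚ} (h0 : 0 ≤ ν) (h1 : ν ≤ 1) {x : ℂ} {τ : ℝ} (hx : ‖x‖ ≤ τ)
    (hτ : τ ≤ 1 / 8) : ‖(1 - x) ^ (ν : ℂ) - 1‖ ≤ 1 / 7 := by
  have h := norm_one_add_cpow_sub_le h0 h1 0 1
    (x := -x) (by rwa [norm_neg]) (hτ.trans_lt (by norm_num))
  simp only [pow_zero, mul_one, range_one, sum_singleton, Ring.choose_zero_right, Rat.cast_one,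
    pow_one, one_mul, ← sub_eq_add_neg] at h
  refine h.trans ?_
  rw [div_le_iff₀ (by linarith)]
  linarith

theorem norm_cube_sub_le {x y : ℂ} {J δ : ℝ} (hJ : ‖y‖ = J) (hδ : ‖x - y‖ ≤ δ)
    (h : δ ≤ J / 100) : ‖x ^ 3 - y ^ 3‖ ≤ 4 * δ * J ^ 2 := by
  have h1 : x ^ 3 - y ^ 3 = (x - y) * (3 * y ^ 2 + 3 * y * (x - y) + (x - y) ^ 2) := by ring
  have h2 : ‖3 * y ^ 2 + 3 * y * (x - y) + (x - y) ^ 2‖ ≤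
      3 * J ^ 2 + 3 * J * δ + δ ^ 2 := by
    refine (norm_add_le _ _).trans (add_le_add ((norm_add_le _ _).trans (add_le_add ?_ ?_)) ?_)
    · simp [hJ]
    · rw [norm_mul, norm_mul, hJ]
      have : 0 ≤ J := hJ ▸ norm_nonneg y
      simp only [Complex.norm_ofNat]
      gcongr
    · rw [norm_pow]
      gcongr
  have h0 : 0 ≤ δ := (norm_nonneg _).trans hδ
  rw [h1, norm_mul, show 4 * δ * J ^ 2 = δ * (4 * J ^ 2) by ring]
  refine mul_le_mul hδ (h2.trans ?_) (norm_nonneg _) h0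
  nlinarith

set_option maxHeartbeats 1000000 in
/-- Upper and lower bounds for the cubic Padé forms. -/
theorem cubic_pade {L : Type*} [Field L] [CharZero L] [IsGalois ℚ L] (φ : L →+* ℂ)
    {ξ η ξ' η' s h : L} {f : ℤ} (hf : f = 1 ∨ f = -1)
    (hξ : ξ ^ 3 = h - 3 * f * (s / 2)) (hη : η ^ 3 = h + 3 * f * (s / 2))
    (iξ : IsIntegral ℤ ξ) (iη : IsIntegral ℤ η) (iξ' : IsIntegral ℤ ξ') (iη' : IsIntegral ℤ η')
    (is : IsIntegral ℤ s) (hs0 : s ≠ 0) (hη'0 : η' ≠ 0)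
    (hσ : ∀ σ : L ≃ₐ[ℚ] L, ∃ ζ : L, ζ ^ 3 = 1 ∧
      ((σ ξ = ζ * ξ ∧ σ η = ζ ^ 2 * η ∧ σ ξ' = ζ * ξ' ∧ σ η' = ζ ^ 2 * η' ∧ σ s = s) ∨
        (σ ξ = ζ * η ∧ σ η = ζ ^ 2 * ξ ∧ σ ξ' = ζ * η' ∧ σ η' = ζ ^ 2 * ξ' ∧ σ s = -s)))
    {μ μ' : ℂ} {E J δ J' δ' : ℝ} (hE : 1 ≤ E) (hsE : ‖φ s‖ ≤ E)
    (hμ : ‖μ‖ = J) (hμ' : ‖μ'‖ = J') (hδ : δ ≤ J / 100)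
    (hξμ : ‖φ ξ - μ‖ ≤ δ) (hημ : ‖φ η - μ‖ ≤ δ) (hξμ' : ‖φ ξ' - μ'‖ ≤ δ')
    (hημ' : ‖φ η' - μ'‖ ≤ δ') (hJE : 30 * E ≤ J ^ 3) (r : ℕ) :
    1 ≤ 36 * E * J * ((480 * E ^ 2 / J ^ 3) ^ r * J' + (33 * J ^ 3) ^ r * δ') := by
  have hJ0 : 0 ≤ J := hμ ▸ norm_nonneg μ
  have hJ3 : 0 < J ^ 3 := by linarith
  have hJ : 0 < J := lt_of_le_of_ne hJ0 fun h0 => by rw [← h0] at hJ3; norm_num at hJ3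
  have hfL : ((f : ℤ) : L) ^ 2 = 1 := by rcases hf with rfl | rfl <;> simp
  have hf0 : ((f : ℤ) : L) ≠ 0 := fun h0 => by rw [h0] at hfL; norm_num at hfL
  have hfn : ‖((f : ℤ) : ℂ)‖ = 1 := by rcases hf with rfl | rfl <;> simp
  have hh : h = (ξ ^ 3 + η ^ 3) / 2 := by rw [hξ, hη]; ring
  have hhφ : ‖φ h - μ ^ 3‖ ≤ J ^ 3 / 10 := by
    have e1 : φ h - μ ^ 3 = ((φ ξ ^ 3 - μ ^ 3) + (φ η ^ 3 - μ ^ 3)) / 2 := by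
      rw [hh, map_div₀, map_add, map_pow, map_pow, map_ofNat]
      ring
    rw [e1, norm_div, Complex.norm_ofNat]
    have := norm_add_le_of_le (norm_cube_sub_le hμ hξμ hδ) (norm_cube_sub_le hμ hημ hδ)
    have h3 : 4 * δ * J ^ 2 ≤ J ^ 3 / 25 := by nlinarith [sq_nonneg J]
    linarith
  have hμ3 : ‖μ ^ 3‖ = J ^ 3 := by rw [norm_pow, hμ]
  have hh1 : ‖φ h‖ ≤ 11 / 10 * J ^ 3 := by
    have := norm_le_insert' (φ h) (μ ^ 3)
    linarith
  have hh2 : 9 / 10 * J ^ 3 ≤ ‖φ h‖ := by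
    have := norm_le_insert (φ h) (μ ^ 3)
    linarith
  have hφh : φ h ≠ 0 := norm_pos_iff.1 (by linarith)
  have nz : ∀ z : L, ‖φ z - μ‖ ≤ δ → 99 / 100 * J ≤ ‖φ z‖ := fun z hz => by
    have := norm_le_insert (φ z) μ
    linarith
  have hφξ : φ ξ ≠ 0 := norm_pos_iff.1 (by linarith [nz ξ hξμ])
  have hφη : φ η ≠ 0 := norm_pos_iff.1 (by linarith [nz η hημ])
  have hξ0 : ξ ≠ 0 := fun h0 => hφξ (by rw [h0, map_zero])
  have hη0 : η ≠ 0 := fun h0 => hφη (by rw [h0, map_zero])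
  have hφ2 : φ 2 = 2 := map_ofNat φ 2
  have hφ3 : φ 3 = 3 := map_ofNat φ 3
  set e : Fin 2 → L := ![s / 2, -(s / 2)] with he
  set H : Fin 2 → L := ![ξ ^ 3, η ^ 3] with hH
  set w : Fin 2 → L := ![ξ * η', η * ξ'] with hw
  set t : ℂ := φ (3 * f) / φ h with ht
  set τ : ℝ := 3 * E / ‖φ h‖ with hτ
  have hτ8 : τ ≤ 1 / 8 := by
    rw [hτ, div_le_iff₀ (by linarith)]
    linarith
  have htn : ‖t‖ * E ≤ τ := by
    rw [ht, hτ, norm_div, map_mul, map_ofNat, map_intCast, norm_mul, hfn, Complex.norm_ofNat]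
    apply le_of_eq
    ring
  have hht : φ h * t = φ (3 * f) := by rw [ht]; field_simp
  have hs2 : ‖φ s / 2‖ ≤ E / 2 := by
    rw [norm_div, Complex.norm_ofNat]
    linarith
  have heE : ∀ i, ‖φ (e i)‖ ≤ E := by
    intro i
    fin_cases i <;> simp [he, hφ2] <;> linarith
  have heE' : ∀ i l, ‖φ (e i) - φ (e l)‖ ≤ E := by
    intro i l
    have h1 : ‖φ s / 2 + φ s / 2‖ ≤ E := by rwa [add_halves]
    have h2 : ‖-(φ s / 2) - φ s / 2‖ ≤ E := by
      rwa [← neg_add', norm_neg, add_halves]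
    have h0 : (0 : ℝ) ≤ E := by linarith
    fin_cases i <;> fin_cases l <;> simp [he, h0, hφ2]
    · simpa using h1
    · exact h2
  have hpow : ∀ z : ℂ, 1 - z ≠ 0 → ((1 - z) ^ ((1 / 3 : ℚ) : ℂ)) ^ 3 = 1 - z := by
    intro z hz
    rw [← Complex.cpow_nat_mul]
    norm_num
  have hH1 : φ (H 0) = φ h * (1 - t * φ (e 0)) := by
    rw [mul_sub, ← mul_assoc, hht, mul_one, ← map_mul, ← map_sub]
    exact congrArg φ hξ
  have hH2 : φ (H 1) = φ h * (1 - t * φ (e 1)) := by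
    rw [mul_sub, ← mul_assoc, hht, mul_one, ← map_mul, ← map_sub]
    refine congrArg φ (hη.trans ?_)
    simp [he]
  have hx : ∀ i, ‖t * φ (e i)‖ ≤ τ := fun i => by
    rw [norm_mul]
    exact (mul_le_mul_of_nonneg_left (heE i) (norm_nonneg t)).trans htn
  set b : Fin 2 → ℂ := fun i => (1 - t * φ (e i)) ^ ((1 / 3 : ℚ) : ℂ) with hb
  have hb1 : ∀ i, ‖b i - 1‖ ≤ 1 / 7 := fun i => norm_cpow_sub_one_le (by norm_num) (by norm_num) (hx i) hτ8
  have hbn : ∀ i, 6 / 7 ≤ ‖b i‖ := fun i => by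
    have := norm_le_insert (b i) 1
    rw [norm_one] at this
    linarith [hb1 i]
  have hb0 : ∀ i, b i ≠ 0 := fun i => norm_pos_iff.1 (by linarith [hbn i])
  have hb3 : ∀ i, φ h * b i ^ 3 = φ (H i) := by
    intro i
    have h0 : 1 - t * φ (e i) ≠ 0 := fun h0 => by
      have := hx i
      rw [← sub_eq_zero.1 h0, norm_one] at this
      linarith
    rw [hb, hpow _ h0]
    fin_cases i
    exacts [hH1.symm, hH2.symm]
  set y : ℂ := φ ξ / b 0 with hy
  have hξy : φ ξ = y * b 0 := by rw [hy]; field_simp [hb0 0]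
  have hy3 : y ^ 3 = φ h := by
    have h3 := hb3 0
    rw [hH] at h3
    simp only [Matrix.cons_val_zero, map_pow] at h3
    rw [hy, div_pow, ← h3]
    have := hb0 0
    field_simp
  have hy0 : y ≠ 0 := div_ne_zero hφξ (hb0 0)
  have hηy : φ η = y * b 1 := by
    have h3 := hb3 1
    rw [hH, ← hy3, ← mul_pow] at h3
    simp only [Matrix.cons_val_one, Matrix.cons_val_fin_one, map_pow] at h3
    have hyb : y * b 1 ≠ 0 := mul_ne_zero hy0 (hb0 1)
    have h4 : φ η / (y * b 1) = 1 := by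
      apply eq_one_of_pow_three_eq_one
      · rw [div_pow, h3, div_self]
        exact pow_ne_zero 3 hφη
      · have h5 : φ η / (y * b 1) - 1 =
            (φ η * (b 0 - b 1) + (φ η - φ ξ) * b 1) / (φ ξ * b 1) := by
          have := hb0 0
          have := hb0 1
          rw [hy]
          field_simp
          ring
        rw [h5, norm_div, div_le_iff₀ (norm_pos_iff.2 (mul_ne_zero hφξ (hb0 1))), norm_mul]
        have h6 : ‖b 0 - b 1‖ ≤ 2 / 7 := by
          calc _ = ‖(b 0 - 1) - (b 1 - 1)‖ := by congr 1; ring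
            _ ≤ _ := norm_sub_le _ _
            _ ≤ _ := by linarith [hb1 0, hb1 1]
        have h7 : ‖φ η - φ ξ‖ ≤ 2 * δ := by
          calc _ = ‖(φ η - μ) - (φ ξ - μ)‖ := by congr 1; ring
            _ ≤ _ := norm_sub_le _ _
            _ ≤ _ := by linarith
        have h8 : ‖φ η‖ ≤ 101 / 100 * J := by
          have := norm_le_insert' (φ η) μ
          linarith
        have h9 := nz ξ hξμ
        have h10 := hbn 1
        refine (norm_add_le _ _).trans ?_
        rw [norm_mul, norm_mul]
        have h11 : ‖φ η‖ * ‖b 0 - b 1‖ ≤ 101 / 100 * J * (2 / 7) := by gcongr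
        have h12 : ‖φ η - φ ξ‖ * ‖b 1‖ ≤ J / 50 * ‖b 1‖ := by gcongr; linarith
        have h13 : 99 / 100 * J * ‖b 1‖ ≤ ‖φ ξ‖ * ‖b 1‖ := by gcongr
        have h14 : J * (6 / 7) ≤ J * ‖b 1‖ := by gcongr
        nlinarith
    exact (div_eq_one_iff_eq hyb).1 h4
  have hyn : ‖y‖ ≤ 11 / 10 * J := by
    refine le_of_pow_le_pow_left₀ (n := 3) (by norm_num) (by positivity) ?_
    rw [← norm_pow, hy3, mul_pow]
    nlinarith
  have h20 : (2 : L) ≠ 0 := two_ne_zero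
  have hei : Function.Injective e := by
    intro i j hij
    have h2 : s / 2 ≠ -(s / 2) := fun h0 => hs0 (by linear_combination h0)
    fin_cases i <;> fin_cases j <;> simp [he] at hij ⊢
    · exact h2 hij
    · exact h2 hij.symm
  have hVe : ∀ i, ∃ v : L, (v = 1 ∨ v = -1) ∧ s = v * ∏ l ∈ univ.erase i, (e i - e l) := by
    intro i
    fin_cases i
    · refine ⟨1, Or.inl rfl, ?_⟩
      have : (univ : Finset (Fin 2)).erase 0 = {1} := by decide
      simp [this, he]
    · refine ⟨-1, Or.inr rfl, ?_⟩
      have : (univ : Finset (Fin 2)).erase 1 = {0} := by decide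
      simp [this, he]
  have i2 : ∀ n : ℤ, IsIntegral ℤ ((n : ℤ) : L) := fun n => isIntegral_algebraMap (x := n)
  obtain ⟨k, hk, hlow⟩ := exists_one_le_norm_padeFun φ (ν := 1 / 3) (by
      intro m hm
      have h3 : (3 * m : ℤ) = 1 := by
        have : (3 * m : ℚ) = 1 := by rw [← hm]; norm_num
        exact_mod_cast this
      omega) r (h := h) (g := 3 * f) (D := 3 ^ r) (V := s) (c := 2) (H := H) (e := e) (w := w)
    (i₀ := 0) (mul_ne_zero three_ne_zero hf0) (pow_ne_zero _ three_ne_zero) h20 hs0 hei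
    (by intro i; fin_cases i <;> simp [hH, he, hξ, hη])
    (by intro i; fin_cases i <;> simp [hH, hξ0, hη0]) (by simp [hw, hξ0, hη'0])
    (by
      intro m hm
      obtain ⟨z, hz⟩ := nine_pow_mul_choose_third r m
      have h1 := congrArg (fun q : ℚ => (q : L)) hz
      simp only [Rat.cast_mul, Rat.cast_pow, Rat.cast_ofNat, Rat.cast_intCast] at h1
      have h2 : (3 : L) ^ r * ((Ring.choose ((r : ℚ) + 1 / 3) m : ℚ) : L) * (3 * f) ^ m =
          ((3 ^ (r - m) * z * f ^ m : ℤ) : L) := by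
        push_cast
        rw [← h1, show (3 : L) ^ r = 3 ^ (r - m) * 3 ^ m by rw [← pow_add]; congr 1; omega,
          mul_pow, show (9 : L) = 3 * 3 by norm_num, mul_pow]
        ring
      rw [h2]
      exact i2 _)
    (by
      intro i l
      fin_cases i <;> fin_cases l <;> simp [he, isIntegral_zero]
      · simpa using is
      · rw [← neg_add', add_halves]
        exact is.neg)
    (by exact_mod_cast i2 2)
    (by
      intro i
      fin_cases i <;> simp [he, mul_div_cancel₀, h20, is])
    (by intro i; fin_cases i <;> simp [hH, iξ.pow, iη.pow])
    (by intro i; fin_cases i <;> simp [hw, iξ.mul iη', iη.mul iξ'])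
    (by
      intro i
      obtain ⟨v, hv, hs⟩ := hVe i
      refine ⟨v, ?_, hs⟩
      rcases hv with rfl | rfl
      exacts [isIntegral_one, isIntegral_one.neg])
    (by
      intro σ
      obtain ⟨ζ, hζ, hc⟩ := hσ σ
      have hfσ : σ ((f : ℤ) : L) = f := map_intCast σ f
      have hσ2 : σ 2 = 2 := map_ofNat σ 2
      refine ⟨by rw [map_mul, map_ofNat, hfσ], by rw [map_pow, map_ofNat], map_ofNat σ 2, ?_, ?_⟩
      · rcases hc with ⟨-, -, -, -, h⟩ | ⟨-, -, -, -, h⟩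
        exacts [Or.inl h, Or.inr h]
      · have h6 : ζ ^ 6 = 1 := by rw [show 6 = 3 * 2 by rfl, pow_mul, hζ, one_pow]
        rcases hc with ⟨h1, h2, h3, h4, h5⟩ | ⟨h1, h2, h3, h4, h5⟩
        · refine ⟨Equiv.refl _, fun i => ?_⟩
          fin_cases i <;> simp [hH, he, hw, h1, h2, h3, h4, h5, hσ2, mul_pow, hζ, ← pow_mul, h6]
          · linear_combination ξ * η' * hζ
          · linear_combination η * ξ' * hζ
        · refine ⟨Equiv.swap 0 1, fun i => ?_⟩
          fin_cases i <;> simp [hH, he, hw, h1, h2, h3, h4, h5, hσ2, mul_pow, hζ, ← pow_mul, h6,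
            neg_div]
          · linear_combination η * ξ' * hζ
          · linear_combination ξ * η' * hζ)
  have hup := norm_pow_mul_padeFun_le (ν := 1 / 3) (by norm_num) (by norm_num) r
    (e := fun i => φ (e i)) (φ.injective.comp hei) hk (h := φ h) (t := t) (q := y) (κ := μ')
    (V := φ s) (c := φ 2) (κ' := ![φ η', φ ξ']) (E := E) (τ := τ) (η := δ') (A := 1) hE heE heE'
    (by rw [hφ2]; simp) (by
      intro i
      obtain ⟨v, hv, hs⟩ := hVe i
      refine ⟨φ v, ?_, ?_⟩
      · rcases hv with rfl | rfl <;> simp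
      · conv_lhs => rw [hs]
        simp only [map_mul, map_prod, map_sub]) ((map_ne_zero φ).2 hs0) htn
    (hτ8.trans (by norm_num)) (by intro i; fin_cases i <;> simp [hξμ', hημ'])
  have hHφ : (fun i => φ h * (1 - t * φ (e i))) = fun i => φ (H i) := by
    ext i
    fin_cases i
    exacts [hH1.symm, hH2.symm]
  have hwφ : (fun i => y * (1 - t * φ (e i)) ^ ((1 / 3 : ℚ) : ℂ) * ![φ η', φ ξ'] i) =
      fun i => φ (w i) := by
    ext i
    change y * b i * _ = _
    fin_cases i <;> simp [hw, hξy, hηy]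
  rw [hht, hHφ, hwφ] at hup
  have h2n : ‖φ 2‖ = 2 := by rw [hφ2]; simp
  have h3n : ‖φ (3 ^ r)‖ = 3 ^ r := by rw [map_pow, hφ3]; simp
  rw [mul_assoc, norm_mul, h3n] at hlow
  rw [Fintype.card_fin, hμ', h2n] at hup
  have hδ0 : 0 ≤ δ' := (norm_nonneg _).trans hξμ'
  have hJ'0 : 0 ≤ J' := hμ' ▸ norm_nonneg _
  have hEr : 0 < E ^ r := by positivity
  have hfin : E ^ r ≤ 3 ^ r * (2 * (‖y‖ * ‖φ h‖ ^ r * (1 ^ (2 * r + 1) *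
      (E ^ (r + 1) * 2 ^ (r + 2) * 2) ^ (2 - 1)) *
      (2 * 8 ^ r * τ ^ (2 * r) * J' + 2 * 5 ^ r * δ'))) := by
    calc E ^ r ≤ 3 ^ r * (‖(φ s) ^ (2 * r + 1) * padeFun (1 / 3) r (φ (3 * f))
          (fun i => φ (H i)) (fun i => φ (e i)) (fun i => φ (w i))
          ((Polynomial.C (φ 2) * Polynomial.X) ^ k)‖ * E ^ r) := by
          rw [← mul_assoc]
          exact le_mul_of_one_le_left hEr.le hlow
      _ ≤ _ := mul_le_mul_of_nonneg_left (by exact_mod_cast hup) (by positivity)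
  have hhpos : 0 < ‖φ h‖ := norm_pos_iff.2 hφh
  have e1 : ‖φ h‖ ^ r * τ ^ (2 * r) = (9 * E ^ 2 / ‖φ h‖) ^ r := by
    rw [pow_mul, ← mul_pow]
    congr 1
    rw [hτ]
    field_simp
    ring
  have hfin2 : 1 ≤ 32 * E * ‖y‖ * ((48 * (9 * E ^ 2 / ‖φ h‖)) ^ r * J' +
      (30 * ‖φ h‖) ^ r * δ') := by
    have : E ^ r * 1 ≤ E ^ r * (32 * E * ‖y‖ * ((48 * (9 * E ^ 2 / ‖φ h‖)) ^ r * J' +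
      (30 * ‖φ h‖) ^ r * δ')) := by
      rw [mul_one]
      refine hfin.trans (le_of_eq ?_)
      have h48 : (48 : ℝ) ^ r = 3 ^ r * 2 ^ r * 8 ^ r := by rw [← mul_pow, ← mul_pow]; norm_num
      have h30 : (30 : ℝ) ^ r = 3 ^ r * 2 ^ r * 5 ^ r := by rw [← mul_pow, ← mul_pow]; norm_num
      rw [mul_pow 48, mul_pow 30, ← e1, h48, h30]
      ring
    exact le_of_mul_le_mul_left this hEr
  refine hfin2.trans ?_
  have e2 : 48 * (9 * E ^ 2 / ‖φ h‖) ≤ 480 * E ^ 2 / J ^ 3 := by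
    rw [← mul_div_assoc, div_le_div_iff₀ hhpos hJ3]
    nlinarith [sq_nonneg E, mul_le_mul_of_nonneg_left hh2 (sq_nonneg E)]
  have e3 : 30 * ‖φ h‖ ≤ 33 * J ^ 3 := by linarith
  have e4 : 32 * E * ‖y‖ ≤ 36 * E * J := by
    have := mul_le_mul_of_nonneg_left hyn (zero_le_one.trans hE)
    have := mul_nonneg (zero_le_one.trans hE) hJ0
    linarith
  refine mul_le_mul e4 (add_le_add (mul_le_mul_of_nonneg_right ?_ hJ'0)
    (mul_le_mul_of_nonneg_right ?_ hδ0)) (by positivity) (by positivity)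
  · exact pow_le_pow_left₀ (by positivity) e2 r
  · exact pow_le_pow_left₀ (by positivity) e3 r

end CubicPade

section CubicPair

variable {L : Type*} [Field L]

/-- If `t₁ = a`, `t₂ = b`, `t₃ = c` are the roots of a cubic form, the numbers
`cubForm a b c x y`, `cubForm b c a x y`, `cubForm c a b x y` are proportional to the values of
its linear factors and sum to zero. -/
def cubForm (a b c : L) (x y : ℤ) : L := (b - c) * (x - a * y)

theorem cubForm_add_add (a b c : L) (x y : ℤ) :
    cubForm a b c x y + cubForm b c a x y + cubForm c a b x y = 0 := by
  unfold cubForm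
  ring

/-- A square root of the discriminant of a cubic form. -/
def cubDisc (a b c : L) : L := (b - c) * (c - a) * (a - b)

theorem cubForm_mul_mul (a b c : L) (x y : ℤ) :
    cubForm a b c x y * cubForm b c a x y * cubForm c a b x y =
      cubDisc a b c * ((x - a * y) * (x - b * y) * (x - c * y)) := by
  unfold cubForm cubDisc
  ring

theorem cubForm_mul_sub (a b c : L) (x y x' y' : ℤ) :
    cubForm a b c x y * cubForm b c a x' y' - cubForm b c a x y * cubForm a b c x' y' =
      cubDisc a b c * ((x * y' - y * x' : ℤ) : L) := by
  unfold cubForm cubDisc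
  push_cast
  ring

theorem cubForm_galois {ω m₁ m₂ m₃ m₁' m₂' m₃' V : L} (hω : ω ^ 2 + ω + 1 = 0)
    (hm : m₁ + m₂ + m₃ = 0) (hm' : m₁' + m₂' + m₃' = 0) (σ : L →+* L)
    (hσω : σ ω = ω ∨ σ ω = ω ^ 2)
    (h : (σ m₁ = m₁ ∧ σ m₂ = m₂ ∧ σ m₁' = m₁' ∧ σ m₂' = m₂' ∧ σ V = V) ∨
      (σ m₁ = m₂ ∧ σ m₂ = m₃ ∧ σ m₁' = m₂' ∧ σ m₂' = m₃' ∧ σ V = V) ∨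
      (σ m₁ = m₃ ∧ σ m₂ = m₁ ∧ σ m₁' = m₃' ∧ σ m₂' = m₁' ∧ σ V = V) ∨
      (σ m₁ = -m₂ ∧ σ m₂ = -m₁ ∧ σ m₁' = -m₂' ∧ σ m₂' = -m₁' ∧ σ V = -V) ∨
      (σ m₁ = -m₁ ∧ σ m₂ = -m₃ ∧ σ m₁' = -m₁' ∧ σ m₂' = -m₃' ∧ σ V = -V) ∨
      (σ m₁ = -m₃ ∧ σ m₂ = -m₂ ∧ σ m₁' = -m₃' ∧ σ m₂' = -m₂' ∧ σ V = -V)) :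
    ∃ ζ : L, ζ ^ 3 = 1 ∧
      ((σ (m₂ - ω * m₁) = ζ * (m₂ - ω * m₁) ∧
        σ (m₂ - ω ^ 2 * m₁) = ζ ^ 2 * (m₂ - ω ^ 2 * m₁) ∧
        σ (m₂' - ω * m₁') = ζ * (m₂' - ω * m₁') ∧
        σ (m₂' - ω ^ 2 * m₁') = ζ ^ 2 * (m₂' - ω ^ 2 * m₁') ∧
        σ ((ω ^ 2 - ω) * V) = (ω ^ 2 - ω) * V) ∨
      (σ (m₂ - ω * m₁) = ζ * (m₂ - ω ^ 2 * m₁) ∧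
        σ (m₂ - ω ^ 2 * m₁) = ζ ^ 2 * (m₂ - ω * m₁) ∧
        σ (m₂' - ω * m₁') = ζ * (m₂' - ω ^ 2 * m₁') ∧
        σ (m₂' - ω ^ 2 * m₁') = ζ ^ 2 * (m₂' - ω * m₁') ∧
        σ ((ω ^ 2 - ω) * V) = -((ω ^ 2 - ω) * V))) := by
  have h3 : ω ^ 3 = 1 := by linear_combination (ω - 1) * hω
  obtain rfl : m₃ = -m₁ - m₂ := by linear_combination hm
  obtain rfl : m₃' = -m₁' - m₂' := by linear_combination hm'
  clear hm hm'
  simp only [map_sub, map_mul, map_pow]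
  rcases hσω with hw | hw <;>
    rcases h with h | h | h | h | h | h <;> obtain ⟨h1, h2, h3, h4, h5⟩ := h <;>
    simp only [h1, h2, h3, h4, h5, hw] <;>
    first
    | refine ⟨1, by ring, Or.inl ⟨?_, ?_, ?_, ?_, ?_⟩⟩ <;> grind
    | refine ⟨1, by ring, Or.inr ⟨?_, ?_, ?_, ?_, ?_⟩⟩ <;> grind
    | refine ⟨ω, by grind, Or.inl ⟨?_, ?_, ?_, ?_, ?_⟩⟩ <;> grind
    | refine ⟨ω, by grind, Or.inr ⟨?_, ?_, ?_, ?_, ?_⟩⟩ <;> grind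
    | refine ⟨ω ^ 2, by grind, Or.inl ⟨?_, ?_, ?_, ?_, ?_⟩⟩ <;> grind
    | refine ⟨ω ^ 2, by grind, Or.inr ⟨?_, ?_, ?_, ?_, ?_⟩⟩ <;> grind

/-- A ring endomorphism fixing the elementary symmetric functions of three distinct elements
permutes them. -/
theorem map_roots_cubic {a b c : L} (σ : L →+* L) (hab : a ≠ b) (hac : a ≠ c) (hbc : b ≠ c)
    (h1 : σ (a + b + c) = a + b + c) (h2 : σ (a * b + a * c + b * c) = a * b + a * c + b * c)
    (h3 : σ (a * b * c) = a * b * c) :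
    (σ a = a ∧ σ b = b ∧ σ c = c) ∨ (σ a = b ∧ σ b = c ∧ σ c = a) ∨
    (σ a = c ∧ σ b = a ∧ σ c = b) ∨ (σ a = b ∧ σ b = a ∧ σ c = c) ∨
    (σ a = a ∧ σ b = c ∧ σ c = b) ∨ (σ a = c ∧ σ b = b ∧ σ c = a) := by
  have key : ∀ z, (z = a ∨ z = b ∨ z = c) → σ z = a ∨ σ z = b ∨ σ z = c := by
    intro z hz
    have h0 : z ^ 3 - (a + b + c) * z ^ 2 + (a * b + a * c + b * c) * z - a * b * c = 0 := by
      rcases hz with rfl | rfl | rfl <;> ring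
    have h0' := congrArg σ h0
    rw [map_sub, map_add, map_sub, map_mul, map_mul, h1, h2, h3, map_pow, map_pow, map_zero] at h0'
    have h4 : (σ z - a) * ((σ z - b) * (σ z - c)) = 0 := by linear_combination h0'
    rcases mul_eq_zero.1 h4 with h | h
    · exact Or.inl (sub_eq_zero.1 h)
    · rcases mul_eq_zero.1 h with h | h
      · exact Or.inr (Or.inl (sub_eq_zero.1 h))
      · exact Or.inr (Or.inr (sub_eq_zero.1 h))
  have i1 : σ a ≠ σ b := fun h => hab (σ.injective h)
  have i2 : σ a ≠ σ c := fun h => hac (σ.injective h)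
  have i3 : σ b ≠ σ c := fun h => hbc (σ.injective h)
  have ha := key a (Or.inl rfl)
  have hb := key b (Or.inr (Or.inl rfl))
  have hc := key c (Or.inr (Or.inr rfl))
  clear key h1 h2 h3
  grind

theorem norm_eq_one_of_cyclotomic {z : ℂ} (h : z ^ 2 + z + 1 = 0) : ‖z‖ = 1 := by
  have h3 : z ^ 3 = 1 := by linear_combination (z - 1) * h
  exact Complex.norm_eq_one_of_pow_eq_one h3 (by norm_num)

theorem cubForm_pade [CharZero L] [IsGalois ℚ L] (φ : L →+* ℂ) {a b c ω : L}
    (hω : ω ^ 2 + ω + 1 = 0) (hab : a ≠ b) (hac : a ≠ c) (hbc : b ≠ c) {s₁ s₂ s₃ : ℤ}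
    (h1 : a + b + c = s₁) (h2 : a * b + a * c + b * c = s₂) (h3 : a * b * c = s₃)
    (ia : IsIntegral ℤ a) (ib : IsIntegral ℤ b) (ic : IsIntegral ℤ c)
    {x y x' y' f : ℤ} (hf : f = 1 ∨ f = -1)
    (hxy : (x - a * y) * (x - b * y) * (x - c * y) = f) {d δ' J J' : ℝ} (hd1 : 1 ≤ d)
    (hd : ‖φ (cubDisc a b c)‖ = d) (hJ : ‖φ (cubForm b c a x y)‖ = J)
    (hJ' : ‖φ (cubForm b c a x' y')‖ = J') (hδ : ‖φ (cubForm a b c x y)‖ ≤ J / 100)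
    (hδ' : ‖φ (cubForm a b c x' y')‖ = δ') (hlt : δ' < J') (hJd : 60 * d ≤ J ^ 3) (r : ℕ) :
    1 ≤ 72 * d * J * ((1920 * d ^ 2 / J ^ 3) ^ r * J' + (33 * J ^ 3) ^ r * δ') := by
  have hωn : ‖φ ω‖ = 1 := norm_eq_one_of_cyclotomic (by
    rw [← map_pow, ← map_add, ← map_one φ, ← map_add, hω, map_zero])
  have iω : IsIntegral ℤ ω := by
    have h3 : ω ^ 3 = 1 := by linear_combination (ω - 1) * hω
    exact IsIntegral.of_pow (n := 3) (by norm_num) (by rw [h3]; exact isIntegral_one)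
  have im : ∀ {a b c : L}, IsIntegral ℤ a → IsIntegral ℤ b → IsIntegral ℤ c → ∀ x y : ℤ,
      IsIntegral ℤ (cubForm a b c x y) := fun ia ib ic x y =>
    (ib.sub ic).mul ((isIntegral_algebraMap (x := x)).sub
      (ia.mul (isIntegral_algebraMap (x := y))))
  have hV0 : cubDisc a b c ≠ 0 :=
    mul_ne_zero (mul_ne_zero (sub_ne_zero.2 hbc) (sub_ne_zero.2 hac.symm)) (sub_ne_zero.2 hab)
  have iV : IsIntegral ℤ (cubDisc a b c) := ((ib.sub ic).mul (ic.sub ia)).mul (ia.sub ib)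
  have hωω : ω ^ 2 - ω ≠ 0 := by
    intro h0
    have h4 : (3 : L) = 0 := by grind
    exact three_ne_zero h4
  have hsum := cubForm_add_add a b c x y
  have hsum' := cubForm_add_add a b c x' y'
  have hprod := cubForm_mul_mul a b c x y
  rw [hxy] at hprod
  set m₁ := cubForm a b c x y with hm₁
  set m₂ := cubForm b c a x y with hm₂
  set m₃ := cubForm c a b x y with hm₃
  set m₁' := cubForm a b c x' y' with hm₁'
  set m₂' := cubForm b c a x' y' with hm₂'
  set m₃' := cubForm c a b x' y' with hm₃'
  have hcube : (m₂ - ω * m₁) ^ 3 - (m₂ - ω ^ 2 * m₁) ^ 3 =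
      -(3 * (f * ((ω ^ 2 - ω) * cubDisc a b c))) := by
    have e1 : m₃ = -m₁ - m₂ := by linear_combination hsum
    rw [e1] at hprod
    have h3 : ω ^ 3 = 1 := by linear_combination (ω - 1) * hω
    linear_combination (-3 * (ω ^ 2 - ω)) * hprod + (m₁ ^ 3 * ω ^ 3 - 3 * m₂ * ω * m₁ ^ 2) * h3
  have key := cubic_pade φ (ξ := m₂ - ω * m₁) (η := m₂ - ω ^ 2 * m₁) (ξ' := m₂' - ω * m₁')
    (η' := m₂' - ω ^ 2 * m₁') (s := (ω ^ 2 - ω) * cubDisc a b c)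
    (h := ((m₂ - ω * m₁) ^ 3 + (m₂ - ω ^ 2 * m₁) ^ 3) / 2) (f := f) hf
    (by linear_combination hcube / 2) (by linear_combination -hcube / 2)
    ((im ib ic ia x y).sub (iω.mul (im ia ib ic x y)))
    ((im ib ic ia x y).sub ((iω.pow 2).mul (im ia ib ic x y)))
    ((im ib ic ia x' y').sub (iω.mul (im ia ib ic x' y')))
    ((im ib ic ia x' y').sub ((iω.pow 2).mul (im ia ib ic x' y')))
    (((iω.pow 2).sub iω).mul iV) (mul_ne_zero hωω hV0)
    (by
      intro h0
      have h4 := congrArg (fun z => ‖φ z‖) (sub_eq_zero.1 h0)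
      simp only [map_mul, map_pow, norm_mul, norm_pow, hωn, hJ', hδ'] at h4
      linarith)
    (by
      intro σ
      refine cubForm_galois (m₃ := m₃) (m₃' := m₃') hω hsum hsum' (σ : L →+* L) ?_ ?_
      · have h4 : (σ ω - ω) * (σ ω - ω ^ 2) = 0 := by
          have h5 := congrArg σ hω
          rw [map_add, map_add, map_pow, map_one, map_zero] at h5
          linear_combination h5 + (-σ ω + ω - 1) * hω
        rcases mul_eq_zero.1 h4 with h | h
        exacts [Or.inl (sub_eq_zero.1 h), Or.inr (sub_eq_zero.1 h)]
      · have h4 := map_roots_cubic (σ : L →+* L) hab hac hbc (by rw [h1]; exact map_intCast _ _)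
          (by rw [h2]; exact map_intCast _ _) (by rw [h3]; exact map_intCast _ _)
        have hx : ∀ n : ℤ, (σ : L →+* L) (n : L) = n := fun n => map_intCast _ n
        simp only [hm₁, hm₂, hm₃, hm₁', hm₂', hm₃', cubForm, cubDisc, map_mul, map_sub, hx]
        rcases h4 with h | h | h | h | h | h <;> obtain ⟨h1, h2, h3⟩ := h <;>
          simp only [h1, h2, h3]
        · exact Or.inl (by simp)
        · exact Or.inr (Or.inl ⟨by trivial, by trivial, by trivial, by trivial, by ring⟩)
        · exact Or.inr (Or.inr (Or.inl ⟨by trivial, by trivial, by trivial, by trivial, by ring⟩))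
        · refine Or.inr (Or.inr (Or.inr (Or.inl ⟨?_, ?_, ?_, ?_, ?_⟩))) <;> ring
        · refine Or.inr (Or.inr (Or.inr (Or.inr (Or.inl ⟨?_, ?_, ?_, ?_, ?_⟩)))) <;> ring
        · refine Or.inr (Or.inr (Or.inr (Or.inr (Or.inr ⟨?_, ?_, ?_, ?_, ?_⟩)))) <;> ring)
    (μ := φ m₂) (μ' := φ m₂') (E := 2 * d) (δ := ‖φ m₁‖) (δ' := δ') (by linarith)
    (by
      rw [map_mul, norm_mul, hd]
      refine mul_le_mul_of_nonneg_right ?_ (by linarith)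
      rw [map_sub, map_pow]
      refine (norm_sub_le _ _).trans ?_
      rw [norm_pow, hωn]
      norm_num) hJ hJ' hδ
    (by
      rw [← map_sub, sub_sub_cancel_left, map_neg, norm_neg, map_mul, norm_mul, hωn, one_mul])
    (by
      rw [← map_sub, sub_sub_cancel_left, map_neg, norm_neg, map_mul, norm_mul, map_pow, norm_pow,
        hωn, one_pow, one_mul])
    (by
      rw [← map_sub, sub_sub_cancel_left, map_neg, norm_neg, map_mul, norm_mul, hωn, one_mul, hδ'])
    (by
      rw [← map_sub, sub_sub_cancel_left, map_neg, norm_neg, map_mul, norm_mul, map_pow, norm_pow,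
        hωn, one_pow, one_mul, hδ'])
    (by linarith) r
  convert key using 1
  ring

end CubicPair

section Window

open Filter

theorem exists_window {a b P Q X Y : ℝ} {R : ℕ} (h : ∀ r : ℕ, 1 ≤ a * P ^ r * X + b * Q ^ r / Y)
    (hQ : 2 ≤ Q) (hb : 0 < b) (hY : 0 < Y) (hR : 2 * b * Q ^ R ≤ Y) :
    ∃ r, R ≤ r ∧ 1 ≤ 2 * (a * P ^ r * X) ∧ Y < 2 * b * Q ^ (r + 1) := by
  classical
  have hex : ∃ n : ℕ, Y < 2 * b * Q ^ n := by
    obtain ⟨n, hn⟩ := pow_unbounded_of_one_lt (Y / (2 * b)) (show 1 < Q by linarith)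
    exact ⟨n, by rwa [div_lt_iff₀' (by positivity)] at hn⟩
  have hn := Nat.find_spec hex
  have hmin := fun m => Nat.find_min (H := hex) (m := m)
  set n := Nat.find hex
  have hRn : R < n := by
    by_contra! hle
    have : Q ^ n ≤ Q ^ R := pow_le_pow_right₀ (by linarith) hle
    have := mul_le_mul_of_nonneg_left this (show 0 ≤ 2 * b by positivity)
    linarith
  obtain ⟨r, hr⟩ : ∃ r, n = r + 1 := ⟨n - 1, by omega⟩
  refine ⟨r, by omega, ?_, hr ▸ hn⟩
  have h1 := not_lt.1 (hmin r (by omega))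
  have h2 : b * Q ^ r / Y ≤ 1 / 2 := by
    rw [div_le_iff₀ hY]
    linarith
  linarith [h r]

theorem exists_monotone_enum {α : Type*} (S : Finset α) (J : α → ℝ) {n : ℕ} (hn : n ≤ S.card) :
    ∃ a : Fin n → α, Function.Injective a ∧ (∀ i, a i ∈ S) ∧ Monotone (J ∘ a) := by
  obtain ⟨T, hT, hc⟩ := Finset.exists_subset_card_eq hn
  let b : Fin n → α := fun i => (T.equivFinOfCardEq hc).symm i
  refine ⟨b ∘ Tuple.sort (J ∘ b), ?_, fun i => hT (Subtype.coe_prop _),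
    Tuple.monotone_sort (J ∘ b)⟩
  exact (Subtype.val_injective.comp (Equiv.injective _)).comp (Equiv.injective _)

theorem cubic_growth {c C D x y : ℝ} (k : ℕ) (hD : 1 ≤ D) (hc : 1 ≤ c) (h : c * D ^ k ≤ x)
    (hy : 20 / 21 * x ^ 2 - x ≤ y) (hC : C ≤ 20 / 21 * c ^ 2 - c) : C * D ^ (2 * k) ≤ y := by
  have h1 : 1 ≤ D ^ k := one_le_pow₀ hD
  rw [mul_comm 2 k, pow_mul]
  have h2 : C * (D ^ k) ^ 2 ≤ (20 / 21 * c ^ 2 - c) * (D ^ k) ^ 2 := by gcongr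
  have h3 : 1 ≤ c * D ^ k := one_le_mul_of_one_le_of_one_le hc h1
  have h4 : c * D ^ k ≤ c * (D ^ k) ^ 2 := by nlinarith
  nlinarith

end Window

section CubicRay

variable {L : Type*} [Field L]

theorem norm_mul_sq_le_of_ray {u₁ u₂ u₃ : ℂ} {D : ℝ} (hD : 1 ≤ D) (h0 : u₁ + u₂ + u₃ = 0)
    (h : ‖u₁‖ * ‖u₂‖ * ‖u₃‖ = D ^ 3) (h2 : 25 / 9 * D ≤ ‖u₂‖) (h3 : 25 / 9 * D ≤ ‖u₃‖) :
    ‖u₁‖ * ‖u₂‖ ^ 2 ≤ 21 / 20 * D ^ 3 := by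
  have h1 : ‖u₁‖ ≤ 81 / 625 * D := by
    have h4 : ‖u₁‖ * ((25 / 9 * D) * (25 / 9 * D)) ≤ D ^ 3 := by
      rw [← h, mul_assoc ‖u₁‖ ‖u₂‖]
      gcongr
    have h5 : ‖u₁‖ * (625 / 81) * D ^ 2 ≤ D * D ^ 2 := by nlinarith
    have := le_of_mul_le_mul_right h5 (by positivity)
    linarith
  have h4 : ‖u₂‖ ≤ ‖u₁‖ + ‖u₃‖ := by
    rw [show u₂ = -(u₁ + u₃) by linear_combination h0, norm_neg]
    exact norm_add_le _ _
  have h5 : 953 / 1000 * ‖u₂‖ ≤ ‖u₃‖ := by linarith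
  have h6 : ‖u₁‖ * ‖u₂‖ * (953 / 1000 * ‖u₂‖) ≤ D ^ 3 := by
    rw [← h]
    gcongr
  have : 0 < D ^ 3 := by positivity
  nlinarith

theorem ray_gap {j j' δ δ' D : ℝ} (hD : 0 < D) (hj : 0 < j) (hjj : j ≤ j')
    (hδ : δ * j ^ 2 ≤ 21 / 20 * D) (hδ' : δ' * j' ^ 2 ≤ 21 / 20 * D)
    (h : D ≤ δ * j' + δ' * j) : 20 / 21 * j ^ 2 - j ≤ j' := by
  have hj' : 0 < j' := hj.trans_le hjj
  have h1 : δ ≤ 21 / 20 * D / j ^ 2 := by rwa [le_div_iff₀ (by positivity)]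
  have h2 : δ' ≤ 21 / 20 * D / j' ^ 2 := by rwa [le_div_iff₀ (by positivity)]
  have h3 : D ≤ 21 / 20 * D / j ^ 2 * j' + 21 / 20 * D / j' ^ 2 * j :=
    h.trans (add_le_add (mul_le_mul_of_nonneg_right h1 hj'.le)
      (mul_le_mul_of_nonneg_right h2 hj.le))
  have h4 : D / j' ^ 2 * j ≤ D / j ^ 2 * j := by gcongr
  have h5 : D * 1 ≤ D * (21 / 20 * (j' + j) / j ^ 2) := by
    calc D * 1 ≤ 21 / 20 * D / j ^ 2 * j' + 21 / 20 * (D / j' ^ 2 * j) := by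
          rw [mul_one]; exact h3.trans (le_of_eq (by ring))
      _ ≤ 21 / 20 * D / j ^ 2 * j' + 21 / 20 * (D / j ^ 2 * j) := by gcongr
      _ = _ := by ring
  have h6 := le_of_mul_le_mul_left h5 hD
  rw [le_div_iff₀ (by positivity)] at h6
  linarith

set_option maxHeartbeats 1000000 in
theorem card_cubic_ray_le [CharZero L] [IsGalois ℚ L] (φ : L →+* ℂ) {a b c ω : L}
    (hω : ω ^ 2 + ω + 1 = 0) (hab : a ≠ b) (hac : a ≠ c) (hbc : b ≠ c) {s₁ s₂ s₃ : ℤ}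
    (h1 : a + b + c = s₁) (h2 : a * b + a * c + b * c = s₂) (h3 : a * b * c = s₃)
    (ia : IsIntegral ℤ a) (ib : IsIntegral ℤ b) (ic : IsIntegral ℤ c)
    {D : ℝ} (hD : 1 ≤ D) (hdD : ‖φ (cubDisc a b c)‖ = D ^ 3) {S : Finset (ℤ × ℤ)}
    (hS : ∀ p ∈ S, ∃ f : ℤ, (f = 1 ∨ f = -1) ∧
      ((p.1 : L) - a * p.2) * (p.1 - b * p.2) * (p.1 - c * p.2) = f)
    (hdist : ∀ p ∈ S, ∀ q ∈ S, p ≠ q → p.1 * q.2 - p.2 * q.1 ≠ 0)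
    (hray : ∀ p ∈ S, 25 / 9 * D ≤ ‖φ (cubForm b c a p.1 p.2)‖ ∧
      25 / 9 * D ≤ ‖φ (cubForm c a b p.1 p.2)‖) : S.card ≤ 8 := by
  by_contra! hcard
  set J : ℤ × ℤ → ℝ := fun p => ‖φ (cubForm b c a p.1 p.2)‖ with hJ
  set δ : ℤ × ℤ → ℝ := fun p => ‖φ (cubForm a b c p.1 p.2)‖ with hδ
  have hsmall : ∀ p ∈ S, δ p * J p ^ 2 ≤ 21 / 20 * D ^ 3 := by
    intro p hp
    refine norm_mul_sq_le_of_ray hD ?_ ?_ (hray p hp).1 (hray p hp).2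
    · rw [← map_add, ← map_add, cubForm_add_add, map_zero]
    · obtain ⟨f, hf, hp⟩ := hS p hp
      rw [← norm_mul, ← norm_mul, ← map_mul, ← map_mul, cubForm_mul_mul, hp, map_mul, norm_mul,
        hdD]
      rcases hf with rfl | rfl <;> simp
  have hJ0 : ∀ p ∈ S, 25 / 9 * D ≤ J p := fun p hp => (hray p hp).1
  have hgap : ∀ p ∈ S, ∀ q ∈ S, p ≠ q → J p ≤ J q → 20 / 21 * J p ^ 2 - J p ≤ J q := by
    intro p hp q hq hne hle
    refine ray_gap (D := D ^ 3) (by positivity) (by linarith [hJ0 p hp]) hle (hsmall p hp)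
      (hsmall q hq) ?_
    have h4 := congrArg (fun z => ‖φ z‖) (cubForm_mul_sub a b c p.1 p.2 q.1 q.2)
    simp only [map_sub, map_mul, norm_mul, hdD, map_intCast] at h4
    have h5 : (1 : ℝ) ≤ ‖((p.1 * q.2 - p.2 * q.1 : ℤ) : ℂ)‖ := by
      rw [Complex.norm_intCast, ← Int.cast_abs]
      exact_mod_cast Int.one_le_abs (hdist p hp q hq hne)
    calc D ^ 3 ≤ D ^ 3 * ‖((p.1 * q.2 - p.2 * q.1 : ℤ) : ℂ)‖ :=
          le_mul_of_one_le_right (by positivity) h5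
      _ ≤ _ := by
        rw [← h4]
        refine (norm_sub_le _ _).trans ?_
        rw [norm_mul, norm_mul, mul_comm (‖φ (cubForm b c a p.1 p.2)‖)]
  obtain ⟨s, hinj, hsS, hmono⟩ := exists_monotone_enum S J (n := 9) hcard
  have hstep : ∀ i j : Fin 9, i < j → 20 / 21 * J (s i) ^ 2 - J (s i) ≤ J (s j) :=
    fun i j hij => hgap _ (hsS i) _ (hsS j) (fun h => hij.ne (hinj h)) (hmono hij.le)
  have e1 : 25 / 9 * D ^ 1 ≤ J (s 0) := by simpa using hJ0 _ (hsS 0)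
  have e2 := cubic_growth (C := 457 / 100) 1 hD (by norm_num) e1 (hstep 0 1 (by decide))
    (by norm_num)
  have e3 := cubic_growth (C := 153 / 10) (2 * 1) hD (by norm_num) e2 (hstep 1 2 (by decide))
    (by norm_num)
  have e4 := cubic_growth (C := 207) _ hD (by norm_num) e3 (hstep 2 3 (by decide))
    (by norm_num)
  have e5 := cubic_growth (C := 40600) _ hD (by norm_num) e4 (hstep 3 4 (by decide))
    (by norm_num)
  norm_num at e5
  have hD16 : 1 ≤ D ^ 16 := one_le_pow₀ hD
  have big : ∀ i : Fin 9, 4 ≤ i → 40600 ≤ J (s i) := fun i hi =>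
    le_trans (by linarith) (e5.trans (hmono hi))
  have step2 : ∀ i j : Fin 9, 4 ≤ i → i < j → 95 / 100 * J (s i) ^ 2 ≤ J (s j) := by
    intro i j hi hij
    have := hstep i j hij
    nlinarith [big i hi]
  have f6 := step2 4 5 (by decide) (by decide)
  have f7 := step2 5 6 (by decide) (by decide)
  have f8 := step2 6 7 (by decide) (by decide)
  have f9 := step2 7 8 (by decide) (by decide)
  have hb := big 4 le_rfl
  obtain ⟨f, hf, hp⟩ := hS _ (hsS 4)
  have sm := hsmall _ (hsS 4)
  have sm' := hsmall _ (hsS 8)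
  set j := J (s 4) with hj
  set X := J (s 8) with hX
  have hj0 : 0 < j := by linarith
  have g9 : 46 / 100 * j ^ 16 ≤ X := by
    have g7 : 95 / 100 * (95 / 100 * j ^ 2) ^ 2 ≤ J (s 6) :=
      le_trans (by gcongr) f7
    have g8 : 95 / 100 * (95 / 100 * (95 / 100 * j ^ 2) ^ 2) ^ 2 ≤ J (s 7) :=
      le_trans (by gcongr) f8
    have g9 : 95 / 100 * (95 / 100 * (95 / 100 * (95 / 100 * j ^ 2) ^ 2) ^ 2) ^ 2 ≤ X :=
      le_trans (by gcongr) f9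
    have : 0 < j ^ 16 := by positivity
    ring_nf at g9
    linarith
  have hDj : D ^ 16 ≤ j := by linarith
  have hD3 : D ^ 3 ≤ D ^ 16 := pow_le_pow_right₀ hD (by norm_num)
  have hX0 : 0 < X := lt_of_lt_of_le (by positivity) g9
  have hXj : j ≤ X := hmono (by decide : (4 : Fin 9) ≤ 8)
  have hδ1 : δ (s 4) ≤ j / 100 := by
    have : δ (s 4) * j ^ 2 ≤ j / 100 * j ^ 2 := sm.trans (by nlinarith)
    exact le_of_mul_le_mul_right this (by positivity)
  have hδ2 : δ (s 8) ≤ 21 / 20 * D ^ 3 / X ^ 2 := by rwa [le_div_iff₀ (by positivity)]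
  have hδX : δ (s 8) < X := by
    have : δ (s 8) * X ^ 2 < X * X ^ 2 := sm'.trans_lt (by nlinarith)
    exact lt_of_mul_lt_mul_right this (by positivity)
  have hpade := cubForm_pade φ hω hab hac hbc h1 h2 h3 ia ib ic hf hp (x' := (s 8).1)
    (y' := (s 8).2) (one_le_pow₀ hD) hdD hj.symm hX.symm hδ1 rfl hδX (by nlinarith)
  have hmain : ∀ r : ℕ, 1 ≤ (72 * D ^ 3 * j) * (1920 * D ^ 6 / j ^ 3) ^ r * X +
      (378 / 5 * D ^ 6 * j) * (33 * j ^ 3) ^ r / X ^ 2 := by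
    intro r
    refine (hpade r).trans ?_
    calc _ ≤ 72 * D ^ 3 * j * ((1920 * (D ^ 3) ^ 2 / j ^ 3) ^ r * X +
          (33 * j ^ 3) ^ r * (21 / 20 * D ^ 3 / X ^ 2)) := by
          change 72 * D ^ 3 * j * (_ + _ * δ (s 8)) ≤ _
          gcongr
      _ = _ := by ring
  have hD0 : 0 < D := by linarith
  obtain ⟨r, hr, w1, w2⟩ := exists_window (R := 7) hmain (by nlinarith) (by positivity)
    (by positivity) (by
      calc 2 * (378 / 5 * D ^ 6 * j) * (33 * j ^ 3) ^ 7
          = (2 * (378 / 5) * 33 ^ 7) * (D ^ 6 * j ^ 22) := by ring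
        _ ≤ (2 * (378 / 5) * 33 ^ 7) * (j * j ^ 22) := by
            gcongr
            exact (pow_le_pow_right₀ hD (by norm_num)).trans hDj
        _ ≤ (46 / 100 * j ^ 16) ^ 2 := by
            have : (40600 : ℝ) ^ 9 ≤ j ^ 9 := by gcongr
            have h23 : 0 < j ^ 23 := by positivity
            nlinarith
        _ ≤ X ^ 2 := by gcongr)
  set P := 1920 * D ^ 6 / j ^ 3 with hP
  have hP0 : 0 < P := by positivity
  have hPQ : P ^ 2 * (33 * j ^ 3) = 121651200 * D ^ 12 / j ^ 3 := by
    rw [hP]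
    field_simp
    norm_num
  have hJ3 : (40600 * D ^ 16) ^ 3 ≤ j ^ 3 := by gcongr
  have hPQ1 : P ^ 2 * (33 * j ^ 3) ≤ 1 := by
    rw [hPQ, div_le_one (by positivity)]
    refine le_trans ?_ hJ3
    have h48 : D ^ 12 ≤ D ^ 48 := pow_le_pow_right₀ hD (by norm_num)
    rw [mul_pow, ← pow_mul]
    exact mul_le_mul (by norm_num) h48 (by positivity) (by positivity)
  have hcon : (1 : ℝ) < 1 := by
    calc (1 : ℝ) ≤ (2 * ((72 * D ^ 3 * j) * P ^ r * X)) ^ 2 := one_le_pow₀ w1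
      _ = (2 * (72 * D ^ 3 * j)) ^ 2 * (P ^ r) ^ 2 * X ^ 2 := by ring
      _ < (2 * (72 * D ^ 3 * j)) ^ 2 * (P ^ r) ^ 2 *
          (2 * (378 / 5 * D ^ 6 * j) * (33 * j ^ 3) ^ (r + 1)) := by gcongr
      _ = (2 * (72 * D ^ 3 * j)) ^ 2 * (2 * (378 / 5 * D ^ 6 * j)) * (33 * j ^ 3) *
          (P ^ 2 * (33 * j ^ 3)) ^ r := by
          rw [mul_pow (P ^ 2), pow_succ _ r]
          generalize (33 * j ^ 3) ^ r = z, P = y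
          ring
      _ ≤ (2 * (72 * D ^ 3 * j)) ^ 2 * (2 * (378 / 5 * D ^ 6 * j)) * (33 * j ^ 3) *
          (P ^ 2 * (33 * j ^ 3)) ^ 7 :=
          mul_le_mul_of_nonneg_left (pow_le_pow_of_le_one (by positivity) hPQ1 hr)
            (by positivity)
      _ = ((2 * 72) ^ 2 * (2 * (378 / 5)) * 33 * 121651200 ^ 7) * D ^ 96 / j ^ 15 := by
          rw [hPQ]
          field_simp
      _ ≤ 1 := by
          rw [div_le_one (by positivity)]
          have h15 : (40600 * D ^ 16) ^ 15 ≤ j ^ 15 := by gcongr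
          refine le_trans ?_ h15
          have : D ^ 96 ≤ D ^ 240 := pow_le_pow_right₀ hD (by norm_num)
          rw [mul_pow 40600, ← pow_mul]
          refine mul_le_mul (by norm_num) this (by positivity) (by positivity)
  exact lt_irrefl _ hcon

end CubicRay

section Classes

open Finset

/-- Primitive integer vectors that fall into classes of size at most `k` modulo a prime `p`. -/
theorem card_le_of_dvd_det (p : ℕ) [Fact p.Prime] (k : ℕ) {S : Finset (ℤ × ℤ)}
    (hS : ∀ s ∈ S, IsCoprime s.1 s.2)
    (hk : ∀ T ⊆ S, (∀ s ∈ T, ∀ t ∈ T, (p : ℤ) ∣ s.1 * t.2 - s.2 * t.1) → T.card ≤ k) :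
    S.card ≤ k * (p + 1) := by
  classical
  let c : ℤ × ℤ → Option (ZMod p) := fun s =>
    if (s.2 : ZMod p) = 0 then none else some (s.1 / s.2)
  have h := card_le_mul_card_image_of_maps_to (f := c) (s := S) (t := univ)
    (fun _ _ => mem_univ _) k (fun b _ => by
      refine hk _ (filter_subset _ _) fun s hs t ht => ?_
      obtain ⟨hs, rfl⟩ := mem_filter.1 hs
      obtain ⟨ht, hst⟩ := mem_filter.1 ht
      rw [← ZMod.intCast_zmod_eq_zero_iff_dvd]
      push_cast
      by_cases h1 : (s.2 : ZMod p) = 0 <;> by_cases h2 : (t.2 : ZMod p) = 0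
      · simp [h1, h2]
      · simp [c, h1, h2] at hst
      · simp [c, h1, h2] at hst
      · simp only [c, h1, h2, if_false, Option.some.injEq] at hst
        field_simp at hst
        linear_combination -hst)
  rwa [card_univ, Fintype.card_option, ZMod.card] at h

end Classes

section CubicCount

open Finset

variable {L : Type*} [Field L] [CharZero L] [IsGalois ℚ L]

theorem one_le_norm_cubDisc (φ : L →+* ℂ) {a b c : L}
    (hab : a ≠ b) (hac : a ≠ c) (hbc : b ≠ c) {s₁ s₂ s₃ : ℤ}
    (h1 : a + b + c = s₁) (h2 : a * b + a * c + b * c = s₂) (h3 : a * b * c = s₃)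
    (ia : IsIntegral ℤ a) (ib : IsIntegral ℤ b) (ic : IsIntegral ℤ c) :
    1 ≤ ‖φ (cubDisc a b c)‖ := by
  refine one_le_norm_of_galois φ (((ib.sub ic).mul (ic.sub ia)).mul (ia.sub ib))
    (mul_ne_zero (mul_ne_zero (sub_ne_zero.2 hbc) (sub_ne_zero.2 hac.symm)) (sub_ne_zero.2 hab))
    fun σ => ?_
  have h4 := map_roots_cubic (σ : L →+* L) hab hac hbc (by rw [h1]; exact map_intCast _ _)
    (by rw [h2]; exact map_intCast _ _) (by rw [h3]; exact map_intCast _ _)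
  simp only [RingHom.coe_coe] at h4
  simp only [cubDisc, map_mul, map_sub]
  rcases h4 with h | h | h | h | h | h <;> obtain ⟨h1, h2, h3⟩ := h <;> simp only [h1, h2, h3]
  · simp
  · exact Or.inl (by ring)
  · exact Or.inl (by ring)
  all_goals exact Or.inr (by ring)

theorem ray_of_le_of_le {u₁ u₂ u₃ : ℂ} {D : ℝ} (hD : 1 ≤ D) (h0 : u₁ + u₂ + u₃ = 0)
    (h : ‖u₁‖ * ‖u₂‖ * ‖u₃‖ = D ^ 3) (h12 : ‖u₁‖ ≤ ‖u₂‖) (h13 : ‖u₁‖ ≤ ‖u₃‖)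
    (hB : 3 * D ≤ ‖u₁‖ ∨ 3 * D ≤ ‖u₂‖ ∨ 3 * D ≤ ‖u₃‖) :
    25 / 9 * D ≤ ‖u₂‖ ∧ 25 / 9 * D ≤ ‖u₃‖ := by
  have t2 : ‖u₂‖ ≤ ‖u₁‖ + ‖u₃‖ := by
    rw [show u₂ = -(u₁ + u₃) by linear_combination h0, norm_neg]
    exact norm_add_le _ _
  have t3 : ‖u₃‖ ≤ ‖u₁‖ + ‖u₂‖ := by
    rw [show u₃ = -(u₁ + u₂) by linear_combination h0, norm_neg]
    exact norm_add_le _ _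
  have key : ∀ m x y : ℝ, 0 ≤ m → m ≤ x → m ≤ y → x ≤ m + y → 3 * D ≤ x → m * x * y = D ^ 3 →
      25 / 9 * D ≤ x ∧ 25 / 9 * D ≤ y := by
    intro m x y hm hmx hmy hxy hx hp
    have hx0 : 0 ≤ x := hm.trans hmx
    have e1 : m ^ 2 * 3 ≤ D ^ 2 := by
      have : m ^ 2 * 3 * D ≤ D ^ 2 * D := by
        calc m ^ 2 * 3 * D = m * (3 * D) * m := by ring
          _ ≤ m * x * y := by gcongr
          _ = D ^ 2 * D := by rw [hp]; ring
      exact le_of_mul_le_mul_right this (by linarith)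
    have e2 : m ≤ 6 / 10 * D := by nlinarith
    have e3 : 24 / 10 * D ≤ y := by linarith
    have e4 : m * (3 * 2.4) ≤ D := by
      have : m * (3 * 2.4) * D ^ 2 ≤ D * D ^ 2 := by
        calc m * (3 * 2.4) * D ^ 2 = m * (3 * D) * (24 / 10 * D) := by ring
          _ ≤ m * x * y := by gcongr
          _ = D * D ^ 2 := by rw [hp]; ring
      exact le_of_mul_le_mul_right this (by positivity)
    constructor <;> linarith
  rcases hB with hB | hB | hB
  · constructor <;> linarith
  · exact key _ _ _ (norm_nonneg u₁) h12 h13 t2 hB h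
  · exact (key _ _ _ (norm_nonneg u₁) h13 h12 t3 hB (by rw [← h]; ring)).symm

theorem card_cubic_tiny_le (φ : L →+* ℂ) {a b c : L} {D : ℝ} (hD : 1 ≤ D)
    (hdD : ‖φ (cubDisc a b c)‖ = D ^ 3) {S : Finset (ℤ × ℤ)}
    (hprim : ∀ p ∈ S, IsCoprime p.1 p.2)
    (hdist : ∀ p ∈ S, ∀ q ∈ S, p ≠ q → p.1 * q.2 - p.2 * q.1 ≠ 0)
    (htiny : ∀ p ∈ S, ‖φ (cubForm a b c p.1 p.2)‖ < 3 * D ∧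
      ‖φ (cubForm b c a p.1 p.2)‖ < 3 * D) : S.card ≤ 20 := by
  have : Fact (Nat.Prime 19) := ⟨by norm_num⟩
  refine card_le_of_dvd_det 19 1 hprim fun T hT hdvd => card_le_one.2 fun p hp q hq => ?_
  by_contra hne
  have h0 := hdist p (hT hp) q (hT hq) hne
  have h1 : (19 : ℤ) ≤ |p.1 * q.2 - p.2 * q.1| :=
    Int.le_of_dvd (abs_pos.2 h0) ((dvd_abs _ _).2 (hdvd p hp q hq))
  have h4 := congrArg (fun z => ‖φ z‖) (cubForm_mul_sub a b c p.1 p.2 q.1 q.2)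
  simp only [map_sub, map_mul, norm_mul, hdD, map_intCast, Complex.norm_intCast] at h4
  have h5 : (19 : ℝ) ≤ |((p.1 * q.2 - p.2 * q.1 : ℤ) : ℝ)| := by
    rw [← Int.cast_abs]
    exact_mod_cast h1
  obtain ⟨p1, p2⟩ := htiny p (hT hp)
  obtain ⟨q1, q2⟩ := htiny q (hT hq)
  have h6 : D ^ 3 * 19 ≤ 3 * D * (3 * D) + 3 * D * (3 * D) := by
    calc D ^ 3 * 19 ≤ D ^ 3 * |((p.1 * q.2 - p.2 * q.1 : ℤ) : ℝ)| := by gcongr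
      _ ≤ _ := by
        rw [← h4]
        refine (norm_sub_le _ _).trans ?_
        rw [norm_mul, norm_mul]
        gcongr
  nlinarith [sq_nonneg D, mul_nonneg (sq_nonneg D) (sub_nonneg.2 hD)]

/-- A monic cubic form with integer coefficients and nonzero discriminant takes the values `±1`
at no more than `44` pairwise nonproportional integer points. -/
theorem card_cubic_le (φ : L →+* ℂ) {a b c ω : L}
    (hω : ω ^ 2 + ω + 1 = 0) (hab : a ≠ b) (hac : a ≠ c) (hbc : b ≠ c) {s₁ s₂ s₃ : ℤ}
    (h1 : a + b + c = s₁) (h2 : a * b + a * c + b * c = s₂) (h3 : a * b * c = s₃)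
    (ia : IsIntegral ℤ a) (ib : IsIntegral ℤ b) (ic : IsIntegral ℤ c) {S : Finset (ℤ × ℤ)}
    (hS : ∀ p ∈ S, ∃ f : ℤ, (f = 1 ∨ f = -1) ∧
      ((p.1 : L) - a * p.2) * (p.1 - b * p.2) * (p.1 - c * p.2) = f)
    (hdist : ∀ p ∈ S, ∀ q ∈ S, p ≠ q → p.1 * q.2 - p.2 * q.1 ≠ 0) : S.card ≤ 44 := by
  classical
  have hd1 := one_le_norm_cubDisc φ hab hac hbc h1 h2 h3 ia ib ic
  obtain ⟨D, hD0, hdD⟩ : ∃ D : ℝ, 0 ≤ D ∧ D ^ 3 = ‖φ (cubDisc a b c)‖ :=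
    ⟨‖φ (cubDisc a b c)‖ ^ ((1 : ℝ) / 3), by positivity, by
      rw [← Real.rpow_natCast, ← Real.rpow_mul (norm_nonneg _)]
      norm_num⟩
  have hD : 1 ≤ D := by
    rw [← hdD] at hd1
    by_contra! hlt
    exact absurd hd1 (not_le.2 (pow_lt_one₀ hD0 hlt (by norm_num)))
  have hprim : ∀ p ∈ S, IsCoprime p.1 p.2 := by
    intro p hp
    obtain ⟨f, hf, h⟩ := hS p hp
    have h4 : p.1 ^ 3 - s₁ * p.1 ^ 2 * p.2 + s₂ * p.1 * p.2 ^ 2 - s₃ * p.2 ^ 3 = f := by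
      have : ((p.1 ^ 3 - s₁ * p.1 ^ 2 * p.2 + s₂ * p.1 * p.2 ^ 2 - s₃ * p.2 ^ 3 : ℤ) : L) = f := by
        push_cast
        rw [← h, ← h1, ← h2, ← h3]
        ring
      exact_mod_cast this
    have hff : f * f = 1 := by rcases hf with rfl | rfl <;> norm_num
    refine ⟨f * (p.1 ^ 2 - s₁ * p.1 * p.2 + s₂ * p.2 ^ 2), f * (-s₃ * p.2 ^ 2), ?_⟩
    linear_combination f * h4 + hff
  let n : L → L → L → ℤ × ℤ → ℝ := fun a b c p => ‖φ (cubForm a b c p.1 p.2)‖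
  let S₀ := S.filter fun p => n a b c p < 3 * D ∧ n b c a p < 3 * D
  let S₁ := S.filter fun p => 25 / 9 * D ≤ n b c a p ∧ 25 / 9 * D ≤ n c a b p
  let S₂ := S.filter fun p => 25 / 9 * D ≤ n c a b p ∧ 25 / 9 * D ≤ n a b c p
  let S₃ := S.filter fun p => 25 / 9 * D ≤ n a b c p ∧ 25 / 9 * D ≤ n b c a p
  have hcov : S ⊆ S₀ ∪ S₁ ∪ S₂ ∪ S₃ := by
    intro p hp
    have hsum : φ (cubForm a b c p.1 p.2) + φ (cubForm b c a p.1 p.2) +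
        φ (cubForm c a b p.1 p.2) = 0 := by
      rw [← map_add, ← map_add, cubForm_add_add, map_zero]
    have hpr : n a b c p * n b c a p * n c a b p = D ^ 3 := by
      obtain ⟨f, hf, hp⟩ := hS p hp
      rw [hdD, ← norm_mul, ← norm_mul, ← map_mul, ← map_mul, cubForm_mul_mul, hp, map_mul,
        norm_mul]
      rcases hf with rfl | rfl <;> simp
    simp only [mem_union, S₀, S₁, S₂, S₃, mem_filter, hp, true_and]
    by_cases hB : 3 * D ≤ n a b c p ∨ 3 * D ≤ n b c a p ∨ 3 * D ≤ n c a b p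
    · rcases le_total (n a b c p) (n b c a p) with h12 | h12 <;>
        rcases le_total (n a b c p) (n c a b p) with h13 | h13 <;>
        rcases le_total (n b c a p) (n c a b p) with h23 | h23
      · exact Or.inl (Or.inl (Or.inr (ray_of_le_of_le hD hsum hpr h12 h13 hB)))
      · exact Or.inl (Or.inl (Or.inr (ray_of_le_of_le hD hsum hpr h12 h13 hB)))
      · exact Or.inl (Or.inl (Or.inr (ray_of_le_of_le hD hsum hpr h12 (h12.trans h23) hB)))
      · exact Or.inr (ray_of_le_of_le hD (by rw [← hsum]; ring) (by rw [← hpr]; ring) h13 h23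
          (by tauto))
      · exact Or.inl (Or.inr (ray_of_le_of_le hD (by rw [← hsum]; ring) (by rw [← hpr]; ring) h23
          h12 (by tauto)))
      · exact Or.inr (ray_of_le_of_le hD (by rw [← hsum]; ring) (by rw [← hpr]; ring)
          (h23.trans h12) h23 (by tauto))
      · exact Or.inl (Or.inr (ray_of_le_of_le hD (by rw [← hsum]; ring) (by rw [← hpr]; ring) h23
          h12 (by tauto)))
      · exact Or.inr (ray_of_le_of_le hD (by rw [← hsum]; ring) (by rw [← hpr]; ring) h13 h23
          (by tauto))
    · push Not at hB
      exact Or.inl (Or.inl (Or.inl ⟨hB.1, hB.2.1⟩))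
  have sub : ∀ (q : ℤ × ℤ → Prop) [DecidablePred q], ∀ p ∈ S.filter q, p ∈ S :=
    fun q _ p hp => (mem_filter.1 hp).1
  have hc₀ : S₀.card ≤ 20 := card_cubic_tiny_le φ hD hdD.symm
    (fun p hp => hprim p (sub _ p hp)) (fun p hp q hq => hdist p (sub _ p hp) q (sub _ q hq))
    (fun p hp => (mem_filter.1 hp).2)
  have hc₁ : S₁.card ≤ 8 := card_cubic_ray_le φ hω hab hac hbc h1 h2 h3 ia ib ic hD hdD.symm
    (fun p hp => hS p (sub _ p hp)) (fun p hp q hq => hdist p (sub _ p hp) q (sub _ q hq))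
    (fun p hp => (mem_filter.1 hp).2)
  have hc₂ : S₂.card ≤ 8 := card_cubic_ray_le φ hω hbc hab.symm hac.symm
    (by rw [← h1]; ring) (by rw [← h2]; ring) (by rw [← h3]; ring) ib ic ia hD
    (by rw [hdD]; unfold cubDisc; congr 2; ring)
    (fun p hp => by
      obtain ⟨f, hf, h⟩ := hS p (sub _ p hp)
      exact ⟨f, hf, by rw [← h]; ring⟩)
    (fun p hp q hq => hdist p (sub _ p hp) q (sub _ q hq))
    (fun p hp => (mem_filter.1 hp).2)
  have hc₃ : S₃.card ≤ 8 := card_cubic_ray_le φ hω hac.symm hbc.symm hab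
    (by rw [← h1]; ring) (by rw [← h2]; ring) (by rw [← h3]; ring) ic ia ib hD
    (by rw [hdD]; unfold cubDisc; congr 2; ring)
    (fun p hp => by
      obtain ⟨f, hf, h⟩ := hS p (sub _ p hp)
      exact ⟨f, hf, by rw [← h]; ring⟩)
    (fun p hp q hq => hdist p (sub _ p hp) q (sub _ q hq))
    (fun p hp => (mem_filter.1 hp).2)
  have := card_le_card hcov
  have := card_union_le (S₀ ∪ S₁ ∪ S₂) S₃
  have := card_union_le (S₀ ∪ S₁) S₂
  have := card_union_le S₀ S₁
  omega

end CubicCount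

section QuarticPade

open Finset

theorem eq_one_of_sq_eq_one {z : ℂ} (h : z ^ 2 = 1) (h1 : ‖z - 1‖ ≤ 1 / 2) : z = 1 := by
  rcases mul_self_eq_one_iff.1 (show z * z = 1 by rw [← sq, h]) with h | h
  · exact h
  · rw [h] at h1
    norm_num at h1

theorem norm_sq_sub_le {x y : ℂ} {J δ : ℝ} (hJ : ‖y‖ = J) (hδ : ‖x - y‖ ≤ δ)
    (h : δ ≤ J / 100) : ‖x ^ 2 - y ^ 2‖ ≤ J ^ 2 / 40 := by
  have h1 : x ^ 2 - y ^ 2 = (x - y) * (2 * y + (x - y)) := by ring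
  have h2 : ‖2 * y + (x - y)‖ ≤ 2 * J + δ :=
    (norm_add_le _ _).trans (add_le_add (by simp [hJ]) hδ)
  have h0 : 0 ≤ δ := (norm_nonneg _).trans hδ
  rw [h1, norm_mul]
  refine (mul_le_mul hδ h2 (norm_nonneg _) h0).trans ?_
  nlinarith

set_option maxHeartbeats 1000000 in
/-- Upper and lower bounds for the quartic Padé forms. -/
theorem quartic_pade {L : Type*} [Field L] [CharZero L] [IsGalois ℚ L] (φ : L →+* ℂ)
    {x x' e : Fin 3 → L} {V h : L} {f : ℤ} (hf : f = 1 ∨ f = -1)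
    (hx : ∀ i, x i ^ 2 = h - 4 * f * e i) (ix : ∀ i, IsIntegral ℤ (x i))
    (ix' : ∀ i, IsIntegral ℤ (x' i)) (i3e : ∀ i, IsIntegral ℤ (3 * e i))
    (iee : ∀ i l, IsIntegral ℤ (e i - e l)) (hei : Function.Injective e)
    {E : ℝ} (hE : 1 ≤ E)
    (hV : ∀ i, ∃ v, IsIntegral ℤ v ∧ ‖φ v‖ ≤ E ∧ V = v * ∏ l ∈ univ.erase i, (e i - e l))
    (hV0 : V ≠ 0) (hx'0 : x' 0 ≠ 0)
    (hσ : ∀ σ : L ≃ₐ[ℚ] L, (σ V = V ∨ σ V = -V) ∧ ∃ π : Fin 3 ≃ Fin 3, ∀ i,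
      ∃ ε : L, ε ^ 2 = 1 ∧ σ (x i) = ε * x (π i) ∧ σ (x' i) = ε * x' (π i) ∧ σ (e i) = e (π i))
    {μ μ' : ℂ} {J δ J' δ' : ℝ} (heE : ∀ i, ‖φ (e i)‖ ≤ E) (heE' : ∀ i l, ‖φ (e i - e l)‖ ≤ E)
    (hμ : ‖μ‖ = J) (hμ' : ‖μ'‖ = J') (hδ : δ ≤ J / 100) (hxμ : ∀ i, ‖φ (x i) - μ‖ ≤ δ)
    (hxμ' : ∀ i, ‖φ (x' i) - μ'‖ ≤ δ') (hJE : 160 * E ≤ J ^ 2) (r : ℕ) :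
    1 ≤ 960 * E ^ 3 * J * ((2600 * E ^ 6 / J ^ 4) ^ r * J' + (22 * E ^ 3 * J ^ 2) ^ r * δ') := by
  have hJ0 : 0 ≤ J := hμ ▸ norm_nonneg μ
  have hJ2 : 0 < J ^ 2 := by linarith
  have hJ : 0 < J := lt_of_le_of_ne hJ0 fun h0 => by rw [← h0] at hJ2; norm_num at hJ2
  have hfn : ‖((f : ℤ) : ℂ)‖ = 1 := by rcases hf with rfl | rfl <;> simp
  have hf0 : ((f : ℤ) : L) ≠ 0 := by rcases hf with rfl | rfl <;> simp
  have hg : ‖φ (4 * f)‖ = 4 := by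
    rw [map_mul, map_ofNat, map_intCast, norm_mul, hfn, Complex.norm_ofNat, mul_one]
  have hhφ : ‖φ h - μ ^ 2‖ ≤ J ^ 2 / 20 := by
    have e1 : φ h - μ ^ 2 = (φ (x 0) ^ 2 - μ ^ 2) + φ (4 * f) * φ (e 0) := by
      rw [← map_pow, hx, map_sub, map_mul _ _ (e 0)]
      ring
    rw [e1]
    refine (norm_add_le_of_le (norm_sq_sub_le hμ (hxμ 0) hδ) le_rfl).trans ?_
    rw [norm_mul, hg]
    linarith [heE 0]
  have hμ2 : ‖μ ^ 2‖ = J ^ 2 := by rw [norm_pow, hμ]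
  have hh1 : ‖φ h‖ ≤ 11 / 10 * J ^ 2 := by
    have := norm_le_insert' (φ h) (μ ^ 2)
    linarith
  have hh2 : 9 / 10 * J ^ 2 ≤ ‖φ h‖ := by
    have := norm_le_insert (φ h) (μ ^ 2)
    linarith
  have hhpos : 0 < ‖φ h‖ := by linarith
  have hφh : φ h ≠ 0 := norm_pos_iff.1 hhpos
  have nz : ∀ i, 99 / 100 * J ≤ ‖φ (x i)‖ := fun i => by
    have := norm_le_insert (φ (x i)) μ
    linarith [hxμ i]
  have hφx : ∀ i, φ (x i) ≠ 0 := fun i => norm_pos_iff.1 (by linarith [nz i])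
  have hx0 : ∀ i, x i ≠ 0 := fun i h0 => hφx i (by rw [h0, map_zero])
  set t : ℂ := φ (4 * f) / φ h with ht
  set τ : ℝ := 4 * E / ‖φ h‖ with hτ
  have hτ8 : τ ≤ 1 / 8 := by
    rw [hτ, div_le_iff₀ (by linarith)]
    linarith
  have htn : ‖t‖ * E ≤ τ := by
    rw [ht, hτ, norm_div, hg]
    exact le_of_eq (by ring)
  have hht : φ h * t = φ (4 * f) := by rw [ht]; field_simp
  have hpow : ∀ z : ℂ, 1 - z ≠ 0 → ((1 - z) ^ ((1 / 2 : ℚ) : ℂ)) ^ 2 = 1 - z := by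
    intro z hz
    rw [← Complex.cpow_nat_mul]
    norm_num
  have hH : ∀ i, φ h * (1 - t * φ (e i)) = φ (x i ^ 2) := fun i => by
    rw [mul_sub, ← mul_assoc, hht, mul_one, ← map_mul, ← map_sub, hx]
  have hxτ : ∀ i, ‖t * φ (e i)‖ ≤ τ := fun i => by
    rw [norm_mul]
    exact (mul_le_mul_of_nonneg_left (heE i) (norm_nonneg t)).trans htn
  set b : Fin 3 → ℂ := fun i => (1 - t * φ (e i)) ^ ((1 / 2 : ℚ) : ℂ) with hb
  have hb1 : ∀ i, ‖b i - 1‖ ≤ 1 / 7 := fun i =>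
    norm_cpow_sub_one_le (by norm_num) (by norm_num) (hxτ i) hτ8
  have hbn : ∀ i, 6 / 7 ≤ ‖b i‖ := fun i => by
    have := norm_le_insert (b i) 1
    rw [norm_one] at this
    linarith [hb1 i]
  have hb0 : ∀ i, b i ≠ 0 := fun i => norm_pos_iff.1 (by linarith [hbn i])
  have hb2 : ∀ i, φ h * b i ^ 2 = φ (x i) ^ 2 := by
    intro i
    have h0 : 1 - t * φ (e i) ≠ 0 := fun h0 => by
      have := hxτ i
      rw [← sub_eq_zero.1 h0, norm_one] at this
      linarith
    rw [hb, hpow _ h0, hH, map_pow]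
  set y : ℂ := φ (x 0) / b 0 with hy
  have hx0y : φ (x 0) = y * b 0 := by rw [hy]; field_simp [hb0 0]
  have hy2 : y ^ 2 = φ h := by
    rw [hy, div_pow, ← hb2]
    have := hb0 0
    field_simp
  have hy0 : y ≠ 0 := div_ne_zero (hφx 0) (hb0 0)
  have hxy : ∀ i, φ (x i) = y * b i := by
    intro i
    have h3 := hb2 i
    rw [← hy2, ← mul_pow] at h3
    have hyb : y * b i ≠ 0 := mul_ne_zero hy0 (hb0 i)
    have h4 : φ (x i) / (y * b i) = 1 := by
      apply eq_one_of_sq_eq_one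
      · rw [div_pow, h3, div_self]
        exact pow_ne_zero 2 (hφx i)
      · have h5 : φ (x i) / (y * b i) - 1 =
            (φ (x i) * (b 0 - b i) + (φ (x i) - φ (x 0)) * b i) / (φ (x 0) * b i) := by
          have := hb0 0
          have := hb0 i
          have := hφx 0
          rw [hy]
          field_simp
          ring
        rw [h5, norm_div, div_le_iff₀ (norm_pos_iff.2 (mul_ne_zero (hφx 0) (hb0 i))), norm_mul]
        have h6 : ‖b 0 - b i‖ ≤ 2 / 7 := by
          calc _ = ‖(b 0 - 1) - (b i - 1)‖ := by congr 1; ring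
            _ ≤ _ := norm_sub_le _ _
            _ ≤ _ := by linarith [hb1 0, hb1 i]
        have h7 : ‖φ (x i) - φ (x 0)‖ ≤ 2 * δ := by
          calc _ = ‖(φ (x i) - μ) - (φ (x 0) - μ)‖ := by congr 1; ring
            _ ≤ _ := norm_sub_le _ _
            _ ≤ _ := by linarith [hxμ 0, hxμ i]
        have h8 : ‖φ (x i)‖ ≤ 101 / 100 * J := by
          have := norm_le_insert' (φ (x i)) μ
          linarith [hxμ i]
        have h9 := nz 0
        have h10 := hbn i
        refine (norm_add_le _ _).trans ?_
        rw [norm_mul, norm_mul]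
        have h11 : ‖φ (x i)‖ * ‖b 0 - b i‖ ≤ 101 / 100 * J * (2 / 7) := by gcongr
        have h12 : ‖φ (x i) - φ (x 0)‖ * ‖b i‖ ≤ J / 50 * ‖b i‖ := by gcongr; linarith
        have h13 : 99 / 100 * J * ‖b i‖ ≤ ‖φ (x 0)‖ * ‖b i‖ := by gcongr
        have h14 : J * (6 / 7) ≤ J * ‖b i‖ := by gcongr
        nlinarith
    exact (div_eq_one_iff_eq hyb).1 h4
  have hyn : ‖y‖ ≤ 11 / 10 * J := by
    refine le_of_pow_le_pow_left₀ (n := 2) (by norm_num) (by positivity) ?_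
    rw [← norm_pow, hy2, mul_pow]
    nlinarith
  have i2 : ∀ n : ℤ, IsIntegral ℤ ((n : ℤ) : L) := fun n => isIntegral_algebraMap (x := n)
  obtain ⟨k, hk, hlow⟩ := exists_one_le_norm_padeFun φ (ν := 1 / 2) (by
      intro m hm
      have h3 : (2 * m : ℤ) = 1 := by
        have : (2 * m : ℚ) = 1 := by rw [← hm]; norm_num
        exact_mod_cast this
      omega) r (h := h) (g := 4 * f) (D := 1) (V := V) (c := 3) (H := fun i => x i ^ 2)
    (e := e) (w := fun i => x i * x' i)
    (i₀ := 0) (mul_ne_zero (OfNat.ofNat_ne_zero 4) hf0) one_ne_zero three_ne_zero hV0 hei hx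
    (fun i => pow_ne_zero 2 (hx0 i)) (mul_ne_zero (hx0 0) hx'0)
    (by
      intro m _
      obtain ⟨z, hz⟩ := four_pow_mul_choose_half r m
      have h1 := congrArg (fun q : ℚ => (q : L)) hz
      simp only [Rat.cast_mul, Rat.cast_pow, Rat.cast_ofNat, Rat.cast_intCast] at h1
      have h2 : (1 : L) * ((Ring.choose ((r : ℚ) + 1 / 2) m : ℚ) : L) * (4 * f) ^ m =
          ((z * f ^ m : ℤ) : L) := by
        push_cast
        rw [← h1]
        ring
      rw [h2]
      exact i2 _)
    iee (by exact_mod_cast i2 3) i3e (fun i => (ix i).pow 2) (fun i => (ix i).mul (ix' i))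
    (fun i => by
      obtain ⟨v, hv, -, hs⟩ := hV i
      exact ⟨v, hv, hs⟩)
    (by
      intro σ
      obtain ⟨hσV, π, hπ⟩ := hσ σ
      have hfσ : σ ((f : ℤ) : L) = f := map_intCast σ f
      refine ⟨by rw [map_mul, map_ofNat, hfσ], map_one σ, map_ofNat σ 3, hσV, π, fun i => ?_⟩
      obtain ⟨ε, hε, h1, h2, h3⟩ := hπ i
      refine ⟨?_, h3, ?_⟩
      · simp only [map_pow, h1, mul_pow, hε, one_mul]
      · simp only [map_mul, h1, h2]
        linear_combination x (π i) * x' (π i) * hε)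
  have hφ3 : φ 3 = 3 := map_ofNat φ 3
  have hup := norm_pow_mul_padeFun_le (ν := 1 / 2) (by norm_num) (by norm_num) r
    (e := fun i => φ (e i)) (φ.injective.comp hei) hk (h := φ h) (t := t) (q := y) (κ := μ')
    (V := φ V) (c := φ 3) (κ' := fun i => φ (x' i)) (E := E) (τ := τ) (η := δ') (A := E) hE heE
    (fun i l => by rw [← map_sub]; exact heE' i l)
    (by rw [hφ3]; simp) (by
      intro i
      obtain ⟨v, -, hv, hs⟩ := hV i
      refine ⟨φ v, hv, ?_⟩
      conv_lhs => rw [hs]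
      simp only [map_mul, map_prod, map_sub]) ((map_ne_zero φ).2 hV0) htn
    (hτ8.trans (by norm_num)) hxμ'
  have hHφ : (fun i => φ h * (1 - t * φ (e i))) = fun i => φ (x i ^ 2) := funext hH
  have hwφ : (fun i => y * (1 - t * φ (e i)) ^ ((1 / 2 : ℚ) : ℂ) * φ (x' i)) =
      fun i => φ (x i * x' i) := by
    ext i
    change y * b i * _ = _
    rw [map_mul, hxy]
  rw [hht, hHφ, hwφ] at hup
  have h3n : ‖φ 3‖ = 3 := by rw [hφ3]; simp
  rw [map_one, one_mul] at hlow
  rw [Fintype.card_fin, hμ', h3n] at hup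
  have hδ0 : 0 ≤ δ' := (norm_nonneg _).trans (hxμ' 0)
  have hJ'0 : 0 ≤ J' := hμ' ▸ norm_nonneg _
  have hE0 : 0 < E := by linarith
  have hEr : 0 < E ^ r := by positivity
  have hfin : E ^ r ≤ 3 * (‖y‖ * ‖φ h‖ ^ r * (E ^ (2 * r + 1) *
      (E ^ (r + 1) * 2 ^ (r + 2) * 3) ^ (3 - 1)) *
      (2 * 8 ^ r * τ ^ (3 * r) * J' + 2 * 5 ^ r * δ')) :=
    (le_mul_of_one_le_left hEr.le hlow).trans (by exact_mod_cast hup)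
  have e1 : ‖φ h‖ ^ r * τ ^ (3 * r) = (64 * E ^ 3 / ‖φ h‖ ^ 2) ^ r := by
    rw [pow_mul, ← mul_pow]
    congr 1
    rw [hτ]
    field_simp
    norm_num
  have hfin2 : 1 ≤ 864 * E ^ 3 * ‖y‖ * ((32 * E ^ 3 * (64 * E ^ 3 / ‖φ h‖ ^ 2)) ^ r * J' +
      (20 * E ^ 3 * ‖φ h‖) ^ r * δ') := by
    have : E ^ r * 1 ≤ E ^ r * (864 * E ^ 3 * ‖y‖ *
        ((32 * E ^ 3 * (64 * E ^ 3 / ‖φ h‖ ^ 2)) ^ r * J' +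
        (20 * E ^ 3 * ‖φ h‖) ^ r * δ')) := by
      rw [mul_one]
      refine hfin.trans (le_of_eq ?_)
      have h32 : (32 : ℝ) ^ r = 2 ^ r * 2 ^ r * 8 ^ r := by
        rw [← mul_pow, ← mul_pow]; norm_num
      have h20 : (20 : ℝ) ^ r = 2 ^ r * 2 ^ r * 5 ^ r := by
        rw [← mul_pow, ← mul_pow]; norm_num
      rw [mul_pow (32 * E ^ 3), mul_pow 32, mul_pow (20 * E ^ 3), mul_pow 20, ← e1, h32, h20]
      ring
    exact le_of_mul_le_mul_left this hEr
  refine hfin2.trans ?_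
  have e2 : 32 * E ^ 3 * (64 * E ^ 3 / ‖φ h‖ ^ 2) ≤ 2600 * E ^ 6 / J ^ 4 := by
    rw [← mul_div_assoc, div_le_div_iff₀ (by positivity) (by positivity)]
    have h4 : (9 / 10 * J ^ 2) ^ 2 ≤ ‖φ h‖ ^ 2 := by gcongr
    have := mul_le_mul_of_nonneg_left h4 (show 0 ≤ E ^ 6 by positivity)
    have : 0 ≤ E ^ 6 * J ^ 4 := by positivity
    nlinarith
  have e3 : 20 * E ^ 3 * ‖φ h‖ ≤ 22 * E ^ 3 * J ^ 2 := by
    have := mul_le_mul_of_nonneg_left hh1 (show 0 ≤ E ^ 3 by positivity)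
    linarith
  have e4 : 864 * E ^ 3 * ‖y‖ ≤ 960 * E ^ 3 * J := by
    have := mul_le_mul_of_nonneg_left hyn (show 0 ≤ E ^ 3 by positivity)
    have : 0 ≤ E ^ 3 * J := by positivity
    linarith
  refine mul_le_mul e4 (add_le_add (mul_le_mul_of_nonneg_right ?_ hJ'0)
    (mul_le_mul_of_nonneg_right ?_ hδ0)) (by positivity) (by positivity)
  · exact pow_le_pow_left₀ (by positivity) e2 r
  · exact pow_le_pow_left₀ (by positivity) e3 r

end QuarticPade

section QuarticForms

variable {L : Type*} [Field L]

/-- The products of two differences of four elements, one for each partition into pairs. -/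
def quaE (α : Fin 4 → L) : Fin 3 → L :=
  ![(α 0 - α 1) * (α 2 - α 3), (α 0 - α 2) * (α 3 - α 1), (α 0 - α 3) * (α 1 - α 2)]

/-- Products of two linear factors of a quartic form that involve the root `α 0`. -/
def quaA (α : Fin 4 → L) (x y : ℤ) : Fin 3 → L :=
  ![(x - α 0 * y) * (x - α 1 * y) * (α 2 - α 3), (x - α 0 * y) * (x - α 2 * y) * (α 3 - α 1),
    (x - α 0 * y) * (x - α 3 * y) * (α 1 - α 2)]

/-- Products of two linear factors of a quartic form that do not involve the root `α 0`. -/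
def quaB (α : Fin 4 → L) (x y : ℤ) : Fin 3 → L :=
  ![(x - α 2 * y) * (x - α 3 * y) * (α 0 - α 1), (x - α 3 * y) * (x - α 1 * y) * (α 0 - α 2),
    (x - α 1 * y) * (x - α 2 * y) * (α 0 - α 3)]

/-- Square roots of the values of three linear combinations of a quartic form and its Hessian. -/
def quaX (α : Fin 4 → L) (x y : ℤ) (i : Fin 3) : L := quaB α x y i - quaA α x y i

/-- The roots of the cubic resolvent, normalised to have trace zero. -/
def quaRes (α : Fin 4 → L) (i : Fin 3) : L := (quaE α i - quaE α (i + 1)) / 3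

theorem quaA_mul_quaB (α : Fin 4 → L) (x y : ℤ) (i : Fin 3) :
    quaA α x y i * quaB α x y i = (∏ j, (x - α j * y)) * quaE α i := by
  fin_cases i <;> simp [quaA, quaB, quaE, Fin.prod_univ_four] <;> ring

theorem quaA_sum (α : Fin 4 → L) (x y : ℤ) :
    quaA α x y 0 + quaA α x y 1 + quaA α x y 2 = 0 := by
  simp [quaA]
  ring

theorem quaB_one (α : Fin 4 → L) (x y : ℤ) : quaB α x y 1 = quaB α x y 0 + quaA α x y 2 := by
  simp [quaA, quaB]
  ring

theorem quaB_two (α : Fin 4 → L) (x y : ℤ) : quaB α x y 2 = quaB α x y 0 - quaA α x y 1 := by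
  simp [quaA, quaB]
  ring

theorem quaE_sum (α : Fin 4 → L) : quaE α 0 + quaE α 1 + quaE α 2 = 0 := by
  simp [quaE]
  ring

theorem quaRes_sub [CharZero L] (α : Fin 4 → L) :
    quaRes α 0 - quaRes α 1 = -quaE α 1 ∧ quaRes α 1 - quaRes α 2 = -quaE α 2 ∧
      quaRes α 2 - quaRes α 0 = -quaE α 0 := by
  have h3 : (3 : L) ≠ 0 := three_ne_zero
  have h := quaE_sum α
  refine ⟨?_, ?_, ?_⟩
  · change (quaE α 0 - quaE α 1) / 3 - (quaE α 1 - quaE α 2) / 3 = _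
    field_simp
    linear_combination h
  · change (quaE α 1 - quaE α 2) / 3 - (quaE α 2 - quaE α 0) / 3 = _
    field_simp
    linear_combination h
  · change (quaE α 2 - quaE α 0) / 3 - (quaE α 0 - quaE α 1) / 3 = _
    field_simp
    linear_combination h

theorem quaX_sq_sub [CharZero L] (α : Fin 4 → L) (x y : ℤ) (i : Fin 3) :
    quaX α x y i ^ 2 = (quaX α x y 0 ^ 2 + 4 * (∏ j, (x - α j * y)) * quaRes α 0) -
      4 * (∏ j, (x - α j * y)) * quaRes α i := by
  obtain ⟨h1, -, h3⟩ := quaRes_sub α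
  have a0 := quaA_mul_quaB α x y 0
  have a1 := quaA_mul_quaB α x y 1
  have hs := quaA_sum α x y
  have b1 := quaB_one α x y
  have b2 := quaB_two α x y
  fin_cases i <;> simp only [quaX, Fin.zero_eta, Fin.mk_one, Fin.reduceFinMk]
  · ring
  · grind
  · grind

/-- Two quadruples whose resolvent data agree up to order and signs. -/
def QuaSimilar (β α : Fin 4 → L) : Prop :=
  (∏ i, quaE β i = ∏ i, quaE α i ∨ ∏ i, quaE β i = -∏ i, quaE α i) ∧
    ∃ π : Fin 3 ≃ Fin 3, ∀ i, quaRes β i = quaRes α (π i) ∧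
      ∃ ε : L, ε ^ 2 = 1 ∧ ∀ x y, quaX β x y i = ε * quaX α x y (π i)

theorem QuaSimilar.trans {α β γ : Fin 4 → L} (h : QuaSimilar γ β) (h' : QuaSimilar β α) :
    QuaSimilar γ α := by
  obtain ⟨h1, π, hπ⟩ := h
  obtain ⟨h1', π', hπ'⟩ := h'
  refine ⟨?_, π.trans π', fun i => ?_⟩
  · rcases h1 with h1 | h1 <;> rcases h1' with h2 | h2 <;> rw [h1, h2] <;> simp
  · obtain ⟨e1, ε, hε, h⟩ := hπ i
    obtain ⟨e1', ε', hε', h'⟩ := hπ' (π i)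
    exact ⟨e1.trans e1', ε * ε', by rw [mul_pow, hε, hε', one_mul], fun x y => by
      rw [h, h', mul_assoc]; rfl⟩

theorem quaSimilar_comp (τ : Equiv.Perm (Fin 4)) :
    ∀ α : Fin 4 → L, QuaSimilar (α ∘ τ) α := by
  have hτ : τ ∈ Submonoid.closure
      (Set.range fun i : Fin 3 => Equiv.swap i.castSucc i.succ) := by
    rw [Equiv.Perm.mclosure_swap_castSucc_succ]
    trivial
  induction hτ using Submonoid.closure_induction with
  | one =>
    exact fun α => ⟨Or.inl rfl, Equiv.refl _, fun i => ⟨rfl, 1, one_pow 2, fun x y => by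
      rw [one_mul]; rfl⟩⟩
  | mul τ τ' _ _ h h' => exact fun α => (h' (α ∘ τ)).trans (h α)
  | mem τ h =>
    obtain ⟨i, rfl⟩ := h
    intro α
    have key : ∀ β : Fin 4 → L, (∏ i, quaE β i = ∏ i, quaE α i ∨ ∏ i, quaE β i = -∏ i, quaE α i) →
        (∃ π : Fin 3 ≃ Fin 3, ∀ i, quaRes β i = quaRes α (π i) ∧
          ((∀ x y, quaX β x y i = quaX α x y (π i)) ∨
            ∀ x y, quaX β x y i = -quaX α x y (π i))) → QuaSimilar β α := by
      rintro β h1 ⟨π, h⟩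
      refine ⟨h1, π, fun i => ⟨(h i).1, ?_⟩⟩
      rcases (h i).2 with h2 | h2
      · exact ⟨1, one_pow 2, fun x y => by rw [h2, one_mul]⟩
      · exact ⟨-1, neg_one_sq, fun x y => by rw [h2, neg_one_mul]⟩
    have s : ∀ i j : Fin 4, (α ∘ Equiv.swap i j) i = α j ∧ (α ∘ Equiv.swap i j) j = α i ∧
        ∀ k, k ≠ i → k ≠ j → (α ∘ Equiv.swap i j) k = α k := fun i j =>
      ⟨congrArg α (Equiv.swap_apply_left i j), congrArg α (Equiv.swap_apply_right i j),
        fun k hi hj => congrArg α (Equiv.swap_apply_of_ne_of_ne hi hj)⟩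
    fin_cases i
    · obtain ⟨h0, h1, h⟩ := s 0 1
      have h2 := h 2 (by decide) (by decide)
      have h3 := h 3 (by decide) (by decide)
      refine key (α ∘ Equiv.swap 0 1) (Or.inr ?_) ⟨Equiv.swap 0 2, fun i => ?_⟩
      · simp only [Fin.prod_univ_three, quaE, Matrix.cons_val, h0, h1, h2, h3]
        ring
      · have t0 : Equiv.swap (0 : Fin 3) 2 0 = 2 := by decide
        have t1 : Equiv.swap (0 : Fin 3) 2 1 = 1 := by decide
        have t2 : Equiv.swap (0 : Fin 3) 2 2 = 0 := by decide
        fin_cases i <;>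
          simp only [Fin.zero_eta, Fin.mk_one, Fin.reduceFinMk, t0, t1, t2, quaRes, quaX, quaA,
            quaB, quaE, Fin.reduceAdd, Matrix.cons_val, h0, h1, h2, h3]
        all_goals first
          | exact ⟨by ring1, Or.inl fun x y => by ring1⟩
          | exact ⟨by ring1, Or.inr fun x y => by ring1⟩
    · obtain ⟨h1, h2, h⟩ := s 1 2
      have h0 := h 0 (by decide) (by decide)
      have h3 := h 3 (by decide) (by decide)
      refine key (α ∘ Equiv.swap 1 2) (Or.inr ?_) ⟨Equiv.swap 1 2, fun i => ?_⟩
      · simp only [Fin.prod_univ_three, quaE, Matrix.cons_val, h0, h1, h2, h3]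
        ring
      · have t0 : Equiv.swap (1 : Fin 3) 2 0 = 0 := by decide
        have t1 : Equiv.swap (1 : Fin 3) 2 1 = 2 := by decide
        have t2 : Equiv.swap (1 : Fin 3) 2 2 = 1 := by decide
        fin_cases i <;>
          simp only [Fin.zero_eta, Fin.mk_one, Fin.reduceFinMk, t0, t1, t2, quaRes, quaX, quaA,
            quaB, quaE, Fin.reduceAdd, Matrix.cons_val, h0, h1, h2, h3]
        all_goals exact ⟨by ring1, Or.inl fun x y => by ring1⟩
    · obtain ⟨h2, h3, h⟩ := s 2 3
      have h0 := h 0 (by decide) (by decide)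
      have h1 := h 1 (by decide) (by decide)
      refine key (α ∘ Equiv.swap 2 3) (Or.inr ?_) ⟨Equiv.swap 0 2, fun i => ?_⟩
      · simp only [Fin.prod_univ_three, quaE, Matrix.cons_val, h0, h1, h2, h3]
        ring
      · have t0 : Equiv.swap (0 : Fin 3) 2 0 = 2 := by decide
        have t1 : Equiv.swap (0 : Fin 3) 2 1 = 1 := by decide
        have t2 : Equiv.swap (0 : Fin 3) 2 2 = 0 := by decide
        fin_cases i <;>
          simp only [Fin.zero_eta, Fin.mk_one, Fin.reduceFinMk, t0, t1, t2, quaRes, quaX, quaA,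
            quaB, quaE, Fin.reduceAdd, Matrix.cons_val, h0, h1, h2, h3]
        all_goals exact ⟨by ring1, Or.inl fun x y => by ring1⟩

end QuarticForms

section QuarticPade

variable {L : Type*} [Field L] [CharZero L] [IsGalois ℚ L]

theorem isIntegral_linear {z : L} (hz : IsIntegral ℤ z) (x y : ℤ) : IsIntegral ℤ (x - z * y) :=
  (isIntegral_algebraMap (x := x)).sub (hz.mul (isIntegral_algebraMap (x := y)))

theorem isIntegral_quaX {α : Fin 4 → L} (iα : ∀ i, IsIntegral ℤ (α i)) (x y : ℤ) (i : Fin 3) :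
    IsIntegral ℤ (quaX α x y i) := by
  have h := fun i => isIntegral_linear (iα i) x y
  have h' := fun i j => (iα i).sub (iα j)
  fin_cases i
  · exact (((h 2).mul (h 3)).mul (h' 0 1)).sub (((h 0).mul (h 1)).mul (h' 2 3))
  · exact (((h 3).mul (h 1)).mul (h' 0 2)).sub (((h 0).mul (h 2)).mul (h' 3 1))
  · exact (((h 1).mul (h 2)).mul (h' 0 3)).sub (((h 0).mul (h 3)).mul (h' 1 2))

theorem isIntegral_quaE {α : Fin 4 → L} (iα : ∀ i, IsIntegral ℤ (α i)) (i : Fin 3) :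
    IsIntegral ℤ (quaE α i) := by
  have h' := fun i j => (iα i).sub (iα j)
  fin_cases i
  · exact (h' 0 1).mul (h' 2 3)
  · exact (h' 0 2).mul (h' 3 1)
  · exact (h' 0 3).mul (h' 1 2)

theorem quaE_ne_zero {α : Fin 4 → L} (hα : Function.Injective α) (i : Fin 3) :
    quaE α i ≠ 0 := by
  have h' : ∀ i j, i ≠ j → α i - α j ≠ 0 := fun i j hij => sub_ne_zero.2 (hα.ne hij)
  fin_cases i
  · exact mul_ne_zero (h' 0 1 (by decide)) (h' 2 3 (by decide))
  · exact mul_ne_zero (h' 0 2 (by decide)) (h' 3 1 (by decide))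
  · exact mul_ne_zero (h' 0 3 (by decide)) (h' 1 2 (by decide))

theorem quaSimilar_galois {α : Fin 4 → L}
    (hσ : ∀ σ : L ≃ₐ[ℚ] L, ∃ τ : Equiv.Perm (Fin 4), ∀ i, σ (α i) = α (τ i)) (σ : L ≃ₐ[ℚ] L) :
    (σ (∏ i, quaE α i) = ∏ i, quaE α i ∨ σ (∏ i, quaE α i) = -∏ i, quaE α i) ∧
      ∃ π : Fin 3 ≃ Fin 3, ∀ i, σ (quaRes α i) = quaRes α (π i) ∧
        ∃ ε : L, ε ^ 2 = 1 ∧ ∀ x y, σ (quaX α x y i) = ε * quaX α x y (π i) := by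
  obtain ⟨τ, hτ⟩ := hσ σ
  have hE : ∀ i, σ (quaE α i) = quaE (α ∘ τ) i := by
    intro i
    fin_cases i <;> simp [quaE, hτ]
  have hR : ∀ i, σ (quaRes α i) = quaRes (α ∘ τ) i := fun i => by
    simp only [quaRes, map_div₀, map_sub, hE, map_ofNat]
  have hX : ∀ x y i, σ (quaX α x y i) = quaX (α ∘ τ) x y i := by
    intro x y i
    fin_cases i <;> simp [quaX, quaA, quaB, hτ]
  obtain ⟨h1, π, h2⟩ := quaSimilar_comp τ α
  simp only [map_prod, hE, hR, hX]
  exact ⟨h1, π, h2⟩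

/-- Upper and lower bounds for the Padé forms attached to two points of a quartic form. -/
theorem quaForm_pade (φ : L →+* ℂ) {α : Fin 4 → L} (hα : Function.Injective α)
    (iα : ∀ i, IsIntegral ℤ (α i))
    (hσ : ∀ σ : L ≃ₐ[ℚ] L, ∃ τ : Equiv.Perm (Fin 4), ∀ i, σ (α i) = α (τ i))
    {x y x' y' f : ℤ} (hf : f = 1 ∨ f = -1) (hxy : ∏ j, ((x : L) - α j * y) = f)
    {E δ δ' J J' : ℝ} (hE1 : 1 ≤ E) (hE : ∀ i, ‖φ (quaE α i)‖ ≤ E)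
    (hJ : ‖φ (quaB α x y 0)‖ = J) (hJ' : ‖φ (quaB α x' y' 0)‖ = J')
    (hδ : ‖φ (quaA α x y 1)‖ + ‖φ (quaA α x y 2)‖ ≤ δ)
    (hδ' : ‖φ (quaA α x' y' 1)‖ + ‖φ (quaA α x' y' 2)‖ ≤ δ')
    (hδJ : δ ≤ J / 100) (hlt : δ' < J') (hJE : 160 * E ≤ J ^ 2) (r : ℕ) :
    1 ≤ 960 * E ^ 3 * J * ((2600 * E ^ 6 / J ^ 4) ^ r * J' + (22 * E ^ 3 * J ^ 2) ^ r * δ') := by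
  have h3 : (3 : L) ≠ 0 := three_ne_zero
  have hX : ∀ x y i, ‖φ (quaX α x y i) - φ (quaB α x y 0)‖ ≤
      ‖φ (quaA α x y 1)‖ + ‖φ (quaA α x y 2)‖ := by
    intro x y i
    have hs := quaA_sum α x y
    have b1 := quaB_one α x y
    have b2 := quaB_two α x y
    rw [← map_sub]
    have e0 : quaX α x y 0 - quaB α x y 0 = quaA α x y 1 + quaA α x y 2 := by
      rw [quaX]
      linear_combination -hs
    have e1 : quaX α x y 1 - quaB α x y 0 = quaA α x y 2 - quaA α x y 1 := by
      rw [quaX, b1]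
      ring
    have e2 : quaX α x y 2 - quaB α x y 0 = -(quaA α x y 1 + quaA α x y 2) := by
      rw [quaX, b2]
      ring
    fin_cases i <;> simp only [Fin.zero_eta, Fin.mk_one, Fin.reduceFinMk]
    · rw [e0, map_add]
      exact norm_add_le _ _
    · rw [e1, map_sub, add_comm]
      exact norm_sub_le _ _
    · rw [e2, map_neg, norm_neg, map_add]
      exact norm_add_le _ _
  obtain ⟨r1, r2, r3⟩ := quaRes_sub α
  have hee : ∀ i l, i = l ∨ ∃ k, quaRes α i - quaRes α l = quaE α k ∨
      quaRes α i - quaRes α l = -quaE α k := by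
    intro i l
    fin_cases i <;> fin_cases l <;> simp only [Fin.zero_eta, Fin.mk_one, Fin.reduceFinMk]
    · exact Or.inl trivial
    · exact Or.inr ⟨1, Or.inr r1⟩
    · exact Or.inr ⟨0, Or.inl (by linear_combination -r3)⟩
    · exact Or.inr ⟨1, Or.inl (by linear_combination -r1)⟩
    · exact Or.inl trivial
    · exact Or.inr ⟨2, Or.inr r2⟩
    · exact Or.inr ⟨0, Or.inr r3⟩
    · exact Or.inr ⟨2, Or.inl (by linear_combination -r2)⟩
    · exact Or.inl trivial
  have hE0 := quaE_ne_zero hα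
  have iE := isIntegral_quaE iα
  refine quartic_pade φ (x := quaX α x y) (x' := quaX α x' y') (e := quaRes α)
    (V := ∏ i, quaE α i) (h := quaX α x y 0 ^ 2 + 4 * f * quaRes α 0) hf
    (fun i => by rw [← hxy]; exact quaX_sq_sub α x y i) (isIntegral_quaX iα x y)
    (isIntegral_quaX iα x' y') (fun i => ?_) (fun i l => ?_) (fun i l hil => ?_) hE1 (fun i => ?_)
    (Finset.prod_ne_zero_iff.2 fun i _ => hE0 i) ?_ ?_ (μ := φ (quaB α x y 0))
    (μ' := φ (quaB α x' y' 0)) (fun i => ?_) (fun i l => ?_) hJ hJ' hδJ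
    (fun i => (hX x y i).trans hδ) (fun i => (hX x' y' i).trans hδ') hJE r
  · have : 3 * quaRes α i = quaE α i - quaE α (i + 1) := by
      rw [quaRes]
      field_simp
    rw [this]
    exact (iE i).sub (iE _)
  · rcases hee i l with rfl | ⟨k, h | h⟩
    · rw [sub_self]
      exact isIntegral_zero
    · rw [h]
      exact iE k
    · rw [h]
      exact (iE k).neg
  · rcases hee i l with h | ⟨k, h | h⟩
    · exact h
    · exact absurd (by rw [← h, hil, sub_self]) (hE0 k)
    · exact absurd (by rw [← neg_eq_zero, ← h, hil, sub_self]) (hE0 k)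
  · refine ⟨-quaE α (i + 2), (iE _).neg, by rw [map_neg, norm_neg]; exact hE _, ?_⟩
    fin_cases i <;> simp only [Fin.zero_eta, Fin.mk_one, Fin.reduceFinMk, Fin.reduceAdd,
      Fin.prod_univ_three]
    · rw [show Finset.univ.erase (0 : Fin 3) = {1, 2} by decide, Finset.prod_pair (by decide), r1,
        ← neg_sub (quaRes α 2), r3]
      ring
    · rw [show Finset.univ.erase (1 : Fin 3) = {2, 0} by decide, Finset.prod_pair (by decide), r2,
        ← neg_sub (quaRes α 0), r1]
      ring
    · rw [show Finset.univ.erase (2 : Fin 3) = {0, 1} by decide, Finset.prod_pair (by decide), r3,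
        ← neg_sub (quaRes α 1), r2]
      ring
  · intro h0
    have := hX x' y' 0
    rw [h0, map_zero, zero_sub, norm_neg, hJ'] at this
    linarith
  · intro σ
    obtain ⟨h1, π, h2⟩ := quaSimilar_galois hσ σ
    refine ⟨h1, π, fun i => ?_⟩
    obtain ⟨h3, ε, hε, h4⟩ := h2 i
    exact ⟨ε, hε, h4 x y, h4 x' y', h3⟩
  · have : φ (quaRes α i) = (φ (quaE α i) - φ (quaE α (i + 1))) / 3 := by
      rw [quaRes, map_div₀, map_sub, map_ofNat]
    rw [this, norm_div, Complex.norm_ofNat, div_le_iff₀ (by norm_num)]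
    linarith [norm_sub_le (φ (quaE α i)) (φ (quaE α (i + 1))), hE i, hE (i + 1)]
  · rcases hee i l with rfl | ⟨k, h | h⟩
    · rw [sub_self, map_zero, norm_zero]
      linarith
    · rw [h]
      exact hE k
    · rw [h, map_neg, norm_neg]
      exact hE k

end QuarticPade

section QuarticRay

variable {L : Type*} [Field L]

theorem quaB_gap (α : Fin 4 → L) (x y x' y' : ℤ) :
    ((x - α 0 * y) * (x' - α 1 * y')) ^ 2 * (quaB α x y 0 * quaB α x y 1 * quaB α x y 2) *
        quaB α x' y' 0 =
      (α 0 - α 1) ^ 2 * (∏ j, (x - α j * y)) ^ 2 * (quaB α x' y' 1 * quaB α x' y' 2) := by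
  simp only [quaB, Fin.prod_univ_four, Matrix.cons_val]
  generalize α 0 - α 1 = d₁, α 0 - α 2 = d₂, α 0 - α 3 = d₃
  generalize (x : L) - α 0 * y = l₀, (x : L) - α 1 * y = l₁, (x : L) - α 2 * y = l₂,
    (x : L) - α 3 * y = l₃
  generalize (x' : L) - α 1 * y' = l₁', (x' : L) - α 2 * y' = l₂', (x' : L) - α 3 * y' = l₃'
  ring

theorem quartic_gap {j j' t t' : ℝ} (hj : 4 ≤ j) (hjj : j ≤ j')
    (ht : t ^ 2 * ((15 / 16 * j) ^ 2 * j) * j' ≤ (17 / 16 * j') ^ 2)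
    (ht' : t' ^ 2 * ((15 / 16 * j') ^ 2 * j') * j ≤ (17 / 16 * j) ^ 2)
    (h : 1 ≤ t + t') : 39 / 100 * j ^ 3 ≤ j' := by
  have key : ∀ t u v : ℝ, 0 < u → 0 < v →
      t ^ 2 * ((15 / 16 * u) ^ 2 * u) * v ≤ (17 / 16 * v) ^ 2 → t ^ 2 * u ^ 3 ≤ 289 / 225 * v := by
    intro t u v hu hv h
    have : t ^ 2 * u ^ 3 * v ≤ 289 / 225 * v * v := by linarith
    exact le_of_mul_le_mul_right this hv
  have h0 : 0 < j := by linarith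
  have h0' : 0 < j' := by linarith
  have h1 := key t j j' h0 h0' ht
  have h2 := key t' j' j h0' h0 ht'
  have h3 : t' ^ 2 ≤ (17 / 60) ^ 2 := by
    have h4 : t' ^ 2 * 16 * j ≤ 289 / 225 * j := by
      refine le_trans ?_ h2
      rw [mul_assoc]
      gcongr
      have : 4 ^ 2 * j ≤ j' ^ 2 * j' := by gcongr; linarith
      linarith
    linarith [le_of_mul_le_mul_right h4 h0]
  have h5 : t' ≤ 17 / 60 := le_of_pow_le_pow_left₀ (by norm_num) (by norm_num) h3
  have h6 : (43 / 60) ^ 2 ≤ t ^ 2 := by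
    gcongr
    linarith
  have h7 := mul_le_mul_of_nonneg_right h6 (show 0 ≤ j ^ 3 by positivity)
  have : 0 < j ^ 3 := by positivity
  linarith

theorem quartic_growth {c C G x y : ℝ} (k : ℕ) (hG : 1 ≤ G) (hc : 0 ≤ c) (h : c * G ^ k ≤ x)
    (hy : 39 / 100 * x ^ 3 ≤ y) (hC : C ≤ 39 / 100 * c ^ 3) : C * G ^ (3 * k) ≤ y := by
  rw [mul_comm 3 k, pow_mul]
  calc C * (G ^ k) ^ 3 ≤ 39 / 100 * c ^ 3 * (G ^ k) ^ 3 := by gcongr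
    _ = 39 / 100 * (c * G ^ k) ^ 3 := by ring
    _ ≤ 39 / 100 * x ^ 3 := by gcongr
    _ ≤ y := hy

/-- The estimates for a point of a quartic form close to the root `α 0`. -/
theorem quartic_ray (φ : L →+* ℂ) {α : Fin 4 → L} {x y f : ℤ} (hf : f = 1 ∨ f = -1)
    (hxy : ∏ j, ((x : L) - α j * y) = f) {G : ℝ} (hG : 0 < G)
    (hE : ∀ i, ‖φ (quaE α i)‖ ≤ G ^ 2) (hB : ∀ i, 4 * G ≤ ‖φ (quaB α x y i)‖) :
    (∀ i, 15 / 16 * ‖φ (quaB α x y 0)‖ ≤ ‖φ (quaB α x y i)‖) ∧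
    (∀ i, ‖φ (quaB α x y i)‖ ≤ 17 / 16 * ‖φ (quaB α x y 0)‖) ∧
    ‖φ (quaA α x y 1)‖ + ‖φ (quaA α x y 2)‖ ≤ 11 / 5 * G ^ 2 / ‖φ (quaB α x y 0)‖ := by
  have hA : ∀ i, ‖φ (quaA α x y i)‖ * ‖φ (quaB α x y i)‖ ≤ G ^ 2 := by
    intro i
    rw [← norm_mul, ← map_mul, quaA_mul_quaB, hxy, map_mul, norm_mul]
    refine le_of_eq_of_le ?_ (hE i)
    rcases hf with rfl | rfl <;> simp
  have hA' : ∀ i, ‖φ (quaA α x y i)‖ ≤ G / 4 := by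
    intro i
    have h1 : ‖φ (quaA α x y i)‖ * (4 * G) ≤ G / 4 * (4 * G) := by
      calc _ ≤ ‖φ (quaA α x y i)‖ * ‖φ (quaB α x y i)‖ := by gcongr; exact hB i
        _ ≤ _ := (hA i).trans_eq (by ring)
    exact le_of_mul_le_mul_right h1 (by positivity)
  set J := ‖φ (quaB α x y 0)‖ with hJ
  have hJ0 := hB 0
  rw [← hJ] at hJ0
  have hJp : 0 < J := by linarith
  have b1 : ‖φ (quaB α x y 1) - φ (quaB α x y 0)‖ ≤ G / 4 := by
    rw [← map_sub, quaB_one, add_sub_cancel_left]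
    exact hA' 2
  have b2 : ‖φ (quaB α x y 2) - φ (quaB α x y 0)‖ ≤ G / 4 := by
    rw [← map_sub, quaB_two, sub_sub_cancel_left, map_neg, norm_neg]
    exact hA' 1
  have lo : ∀ i, 15 / 16 * J ≤ ‖φ (quaB α x y i)‖ := by
    have l1 := norm_le_insert (φ (quaB α x y 1)) (φ (quaB α x y 0))
    have l2 := norm_le_insert (φ (quaB α x y 2)) (φ (quaB α x y 0))
    intro i
    fin_cases i <;> simp only [Fin.zero_eta, Fin.mk_one, Fin.reduceFinMk] <;> linarith
  refine ⟨lo, ?_, ?_⟩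
  · have l1 := norm_le_insert' (φ (quaB α x y 1)) (φ (quaB α x y 0))
    have l2 := norm_le_insert' (φ (quaB α x y 2)) (φ (quaB α x y 0))
    intro i
    fin_cases i <;> simp only [Fin.zero_eta, Fin.mk_one, Fin.reduceFinMk] <;> linarith
  · have : ∀ i, ‖φ (quaA α x y i)‖ ≤ 16 / 15 * G ^ 2 / J := fun i => by
      rw [le_div_iff₀ hJp]
      have : ‖φ (quaA α x y i)‖ * (15 / 16 * J) ≤ G ^ 2 :=
        (mul_le_mul_of_nonneg_left (lo i) (norm_nonneg _)).trans (hA i)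
      linarith
    refine (add_le_add (this 1) (this 2)).trans ?_
    rw [← add_div]
    gcongr
    nlinarith

set_option maxHeartbeats 1000000 in
theorem card_quartic_ray_le [CharZero L] [IsGalois ℚ L] (φ : L →+* ℂ) {α : Fin 4 → L}
    (hα : Function.Injective α) (iα : ∀ i, IsIntegral ℤ (α i))
    (hσ : ∀ σ : L ≃ₐ[ℚ] L, ∃ τ : Equiv.Perm (Fin 4), ∀ i, σ (α i) = α (τ i))
    {G : ℝ} (hG : 1 ≤ G) (hE : ∀ i, ‖φ (quaE α i)‖ ≤ G ^ 2) {S : Finset (ℤ × ℤ)}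
    (hS : ∀ p ∈ S, ∃ f : ℤ, (f = 1 ∨ f = -1) ∧ ∏ j, ((p.1 : L) - α j * p.2) = f)
    (hdist : ∀ p ∈ S, ∀ q ∈ S, p ≠ q → p.1 * q.2 - p.2 * q.1 ≠ 0)
    (hray : ∀ p ∈ S, ∀ i, 4 * G ≤ ‖φ (quaB α p.1 p.2 i)‖) : S.card ≤ 6 := by
  by_contra! hcard
  have hG0 : 0 < G := by linarith
  set J : ℤ × ℤ → ℝ := fun p => ‖φ (quaB α p.1 p.2 0)‖ with hJ
  have hJ0 : ∀ p ∈ S, 4 * G ≤ J p := fun p hp => hray p hp 0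
  have hrayp := fun p (hp : p ∈ S) => quartic_ray φ (hS p hp).choose_spec.1
    (hS p hp).choose_spec.2 hG0 hE (hray p hp)
  have hgap : ∀ p ∈ S, ∀ q ∈ S, p ≠ q → J p ≤ J q → 39 / 100 * J p ^ 3 ≤ J q := by
    intro p hp q hq hne hle
    have hab : 0 < ‖φ (α 0 - α 1)‖ :=
      norm_pos_iff.2 ((map_ne_zero φ).2 (sub_ne_zero.2 (hα.ne (by decide))))
    have ht : ∀ p ∈ S, ∀ q ∈ S,
        (‖φ ((p.1 - α 0 * p.2) * (q.1 - α 1 * q.2))‖ / ‖φ (α 0 - α 1)‖) ^ 2 *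
          ((15 / 16 * J p) ^ 2 * J p) * J q ≤ (17 / 16 * J q) ^ 2 := by
      intro p hp q hq
      obtain ⟨f, hf, h⟩ := hS p hp
      have hgap := congrArg (fun z => ‖φ z‖) (quaB_gap α p.1 p.2 q.1 q.2)
      have hff : ((f : ℤ) : L) ^ 2 = 1 := by rcases hf with rfl | rfl <;> simp
      simp only [h, hff, mul_one] at hgap
      rw [map_mul, map_mul, map_mul φ (_ * _) (quaB α p.1 p.2 2), map_mul φ (quaB α p.1 p.2 0),
        map_mul, map_mul φ (quaB α q.1 q.2 1)] at hgap
      simp only [map_pow, norm_mul, norm_pow] at hgap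
      rw [div_pow, div_mul_eq_mul_div, div_mul_eq_mul_div, div_le_iff₀ (by positivity)]
      have l1 := (hrayp p hp).1 1
      have l2 := (hrayp p hp).1 2
      have u1 := (hrayp q hq).2.1 1
      have u2 := (hrayp q hq).2.1 2
      calc _ ≤ ‖φ ((p.1 - α 0 * p.2) * (q.1 - α 1 * q.2))‖ ^ 2 *
            (‖φ (quaB α p.1 p.2 0)‖ * ‖φ (quaB α p.1 p.2 1)‖ * ‖φ (quaB α p.1 p.2 2)‖) *
            ‖φ (quaB α q.1 q.2 0)‖ := by
            refine mul_le_mul_of_nonneg_right (mul_le_mul_of_nonneg_left ?_ (by positivity))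
              (norm_nonneg _)
            calc (15 / 16 * J p) ^ 2 * J p = J p * (15 / 16 * J p) * (15 / 16 * J p) := by ring
              _ ≤ _ := by
                have := hJ0 p hp
                have : 0 ≤ J p := by linarith
                gcongr
        _ = _ := hgap
        _ ≤ ‖φ (α 0 - α 1)‖ ^ 2 * ((17 / 16 * J q) * (17 / 16 * J q)) := by gcongr
        _ = _ := by ring
    refine quartic_gap (by linarith [hJ0 p hp]) hle (ht p hp q hq) (ht q hq p hp) ?_
    rw [← add_div, one_le_div hab]
    have h5 : (1 : ℝ) ≤ ‖((p.1 * q.2 - p.2 * q.1 : ℤ) : ℂ)‖ := by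
      rw [Complex.norm_intCast, ← Int.cast_abs]
      exact_mod_cast Int.one_le_abs (hdist p hp q hq hne)
    have h4 : (α 0 - α 1) * ((p.1 * q.2 - p.2 * q.1 : ℤ) : L) =
        (p.1 - α 0 * p.2) * (q.1 - α 1 * q.2) - (q.1 - α 0 * q.2) * (p.1 - α 1 * p.2) := by
      push_cast
      ring
    calc ‖φ (α 0 - α 1)‖ ≤ ‖φ (α 0 - α 1)‖ * ‖((p.1 * q.2 - p.2 * q.1 : ℤ) : ℂ)‖ :=
          le_mul_of_one_le_right (norm_nonneg _) h5
      _ ≤ _ := by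
        rw [← map_intCast φ, ← norm_mul, ← map_mul, h4, map_sub]
        exact norm_sub_le _ _
  obtain ⟨s, hinj, hsS, hmono⟩ := exists_monotone_enum S J (n := 7) hcard
  have hstep : ∀ i j : Fin 7, i < j → 39 / 100 * J (s i) ^ 3 ≤ J (s j) :=
    fun i j hij => hgap _ (hsS i) _ (hsS j) (fun h => hij.ne (hinj h)) (hmono hij.le)
  have e1 : 4 * G ^ 1 ≤ J (s 0) := by simpa using hJ0 _ (hsS 0)
  have e2 := quartic_growth (C := 249 / 10) 1 hG (by norm_num) e1 (hstep 0 1 (by decide))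
    (by norm_num)
  have e3 := quartic_growth (C := 6000) (3 * 1) hG (by norm_num) e2 (hstep 1 2 (by decide))
    (by norm_num)
  have e4 := quartic_growth (C := 84000000000) _ hG (by norm_num) e3 (hstep 2 3 (by decide))
    (by norm_num)
  norm_num at e4
  have f5 := hstep 3 4 (by decide)
  have f6 := hstep 4 5 (by decide)
  have f7 := hstep 5 6 (by decide)
  obtain ⟨f, hf, hp⟩ := hS _ (hsS 3)
  have sm := (hrayp _ (hsS 3)).2.2
  have sm' := (hrayp _ (hsS 6)).2.2
  have hX4 := hJ0 _ (hsS 6)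
  change _ ≤ 11 / 5 * G ^ 2 / J _ at sm sm'
  set j := J (s 3) with hj
  set X := J (s 6) with hX
  have hG27 : 1 ≤ G ^ 27 := one_le_pow₀ hG
  have hj1 : 84000000000 ≤ j := by linarith
  have hj0 : 0 < j := by linarith
  have g7 : 4 / 1000000 * j ^ 27 ≤ X := by
    have g6 : 39 / 100 * (39 / 100 * j ^ 3) ^ 3 ≤ J (s 5) := le_trans (by gcongr) f6
    have g7 : 39 / 100 * (39 / 100 * (39 / 100 * j ^ 3) ^ 3) ^ 3 ≤ X := le_trans (by gcongr) f7
    have : 0 < j ^ 27 := by positivity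
    ring_nf at g7
    linarith
  have hX0 : 0 < X := by linarith
  have hG2 : G ^ 2 ≤ G ^ 27 := pow_le_pow_right₀ hG (by norm_num)
  have hpade := quaForm_pade φ hα iα hσ hf hp (x' := (s 6).1) (y' := (s 6).2)
    (E := G ^ 2) (one_le_pow₀ hG) hE hj.symm hX.symm sm sm'
    (by
      rw [div_le_iff₀ hj0]
      nlinarith)
    (by
      rw [div_lt_iff₀ hX0]
      nlinarith)
    (by nlinarith)
  have hmain : ∀ r : ℕ, 1 ≤ (960 * G ^ 6 * j) * (2600 * G ^ 12 / j ^ 4) ^ r * X +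
      (2112 * G ^ 8 * j) * (22 * G ^ 6 * j ^ 2) ^ r / X := by
    intro r
    refine (hpade r).trans (le_of_eq ?_)
    ring
  have hj27 : G ^ 27 ≤ j := by linarith
  have hQ2 : 2 ≤ 22 * G ^ 6 * j ^ 2 := by
    have h1 : 1 ≤ G ^ 6 := one_le_pow₀ hG
    have h2 : 1 ≤ j ^ 2 := one_le_pow₀ (by linarith)
    nlinarith [one_le_mul_of_one_le_of_one_le h1 h2]
  obtain ⟨r, hr, w1, w2⟩ := exists_window (R := 6) hmain hQ2 (by positivity)
    hX0 (by
      calc 2 * (2112 * G ^ 8 * j) * (22 * G ^ 6 * j ^ 2) ^ 6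
          = (2 * 2112 * 22 ^ 6) * (G ^ 44 * j ^ 13) := by ring
        _ ≤ (2 * 2112 * 22 ^ 6) * (j ^ 2 * j ^ 13) := by
            gcongr
            calc G ^ 44 ≤ G ^ 54 := pow_le_pow_right₀ hG (by norm_num)
              _ = (G ^ 27) ^ 2 := by ring
              _ ≤ j ^ 2 := by gcongr
        _ ≤ 4 / 1000000 * j ^ 27 := by
            have h12 : (84000000000 : ℝ) ^ 12 ≤ j ^ 12 := by gcongr
            have h15 : 0 < j ^ 15 := by positivity
            nlinarith
        _ ≤ X := g7)
  set P := 2600 * G ^ 12 / j ^ 4 with hP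
  set Q := 22 * G ^ 6 * j ^ 2 with hQ
  have hP0 : 0 < P := by positivity
  have hPQ : P * Q = 57200 * G ^ 18 / j ^ 2 := by
    rw [hP, hQ]
    field_simp
    norm_num
  have hPQ1 : P * Q ≤ 1 := by
    rw [hPQ, div_le_one (by positivity)]
    have h2 : (84000000000 * G ^ 27) ^ 2 ≤ j ^ 2 := by gcongr
    refine le_trans ?_ h2
    have : G ^ 18 ≤ G ^ 54 := pow_le_pow_right₀ hG (by norm_num)
    rw [mul_pow, ← pow_mul]
    exact mul_le_mul (by norm_num) this (by positivity) (by positivity)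
  have hcon : (1 : ℝ) < 1 := by
    calc (1 : ℝ) ≤ 2 * ((960 * G ^ 6 * j) * P ^ r * X) := w1
      _ = 2 * (960 * G ^ 6 * j) * P ^ r * X := by ring
      _ < 2 * (960 * G ^ 6 * j) * P ^ r * (2 * (2112 * G ^ 8 * j) * Q ^ (r + 1)) := by gcongr
      _ = 4 * (960 * G ^ 6 * j) * (2112 * G ^ 8 * j) * Q * (P * Q) ^ r := by
          rw [mul_pow P, pow_succ Q r]
          generalize Q = z, P = y
          ring
      _ ≤ 4 * (960 * G ^ 6 * j) * (2112 * G ^ 8 * j) * Q * (P * Q) ^ 6 :=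
          mul_le_mul_of_nonneg_left (pow_le_pow_of_le_one (by positivity) hPQ1 hr)
            (by positivity)
      _ = (4 * 960 * 2112 * 22 * 57200 ^ 6) * G ^ 128 / j ^ 8 := by
          rw [hPQ, hQ]
          field_simp
      _ ≤ 1 := by
          rw [div_le_one (by positivity)]
          have h8 : (84000000000 * G ^ 27) ^ 8 ≤ j ^ 8 := by gcongr
          refine le_trans ?_ h8
          have : G ^ 128 ≤ G ^ 216 := pow_le_pow_right₀ hG (by norm_num)
          rw [mul_pow 84000000000, ← pow_mul]
          refine mul_le_mul (by norm_num) this (by positivity) (by positivity)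
  exact lt_irrefl _ hcon

end QuarticRay

section QuarticMiddle

open Finset

variable {L : Type*} [Field L]

theorem quaE_mul_det_sq (α : Fin 4 → L) (x y x' y' : ℤ) (m : Fin 3) :
    quaE α m * (quaE α (m + 1) * quaE α (m + 2)) * ((x * y' - y * x' : ℤ) : L) ^ 2 =
      quaE α (m + 2) * (quaA α x y (m + 1) * quaB α x' y' (m + 1) +
        quaA α x' y' (m + 1) * quaB α x y (m + 1)) -
      quaE α (m + 1) * (quaA α x y (m + 2) * quaB α x' y' (m + 2) +
        quaA α x' y' (m + 2) * quaB α x y (m + 2)) := by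
  have d : ∀ i j, (α i - α j) * ((x * y' - y * x' : ℤ) : L) =
      (x - α i * y) * (x' - α j * y') - (x - α j * y) * (x' - α i * y') := fun i j => by
    push_cast
    ring
  have d01 := d 0 1
  have d23 := d 2 3
  have d02 := d 0 2
  have d31 := d 3 1
  have d03 := d 0 3
  have d12 := d 1 2
  fin_cases m <;> simp only [Fin.zero_eta, Fin.mk_one, Fin.reduceFinMk, Fin.reduceAdd, quaE, quaA,
    quaB, Matrix.cons_val] <;>
  generalize α 0 - α 1 = e01, α 2 - α 3 = e23, α 0 - α 2 = e02, α 3 - α 1 = e31,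
    α 0 - α 3 = e03, α 1 - α 2 = e12, ((x * y' - y * x' : ℤ) : L) = D,
    (x : L) - α 0 * y = l0, (x : L) - α 1 * y = l1, (x : L) - α 2 * y = l2,
    (x : L) - α 3 * y = l3, (x' : L) - α 0 * y' = l0', (x' : L) - α 1 * y' = l1',
    (x' : L) - α 2 * y' = l2', (x' : L) - α 3 * y' = l3' at *
  · linear_combination e02 * e31 * (e03 * e12) * (e23 * D * d01 + (l0 * l1' - l1 * l0') * d23)
  · linear_combination e01 * e23 * (e03 * e12) * (e31 * D * d02 + (l0 * l2' - l2 * l0') * d31)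
  · linear_combination e01 * e23 * (e02 * e31) * (e12 * D * d03 + (l0 * l3' - l3 * l0') * d12)

theorem norm_quaE_mul_det_sq_le (φ : L →+* ℂ) {α : Fin 4 → L} (hα : ∀ i, quaE α i ≠ 0)
    (x y x' y' : ℤ) (m : Fin 3) :
    ‖φ (quaE α m)‖ * ((x * y' - y * x' : ℤ) : ℝ) ^ 2 ≤
      (‖φ (quaA α x y (m + 1))‖ * ‖φ (quaB α x' y' (m + 1))‖ +
        ‖φ (quaA α x' y' (m + 1))‖ * ‖φ (quaB α x y (m + 1))‖) / ‖φ (quaE α (m + 1))‖ +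
      (‖φ (quaA α x y (m + 2))‖ * ‖φ (quaB α x' y' (m + 2))‖ +
        ‖φ (quaA α x' y' (m + 2))‖ * ‖φ (quaB α x y (m + 2))‖) / ‖φ (quaE α (m + 2))‖ := by
  have h1 : 0 < ‖φ (quaE α (m + 1))‖ := norm_pos_iff.2 ((map_ne_zero φ).2 (hα _))
  have h2 : 0 < ‖φ (quaE α (m + 2))‖ := norm_pos_iff.2 ((map_ne_zero φ).2 (hα _))
  have h := congrArg (fun z => ‖φ z‖) (quaE_mul_det_sq α x y x' y' m)
  simp only [map_sub, map_add, map_mul, map_pow, map_intCast, norm_mul, norm_pow,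
    Complex.norm_intCast, sq_abs] at h
  rw [div_add_div _ _ h1.ne' h2.ne', le_div_iff₀ (mul_pos h1 h2)]
  calc _ = ‖φ (quaE α m)‖ * (‖φ (quaE α (m + 1))‖ * ‖φ (quaE α (m + 2))‖) *
        ((x * y' - y * x' : ℤ) : ℝ) ^ 2 := by ring
    _ ≤ _ := by
      rw [h]
      refine (norm_sub_le _ _).trans ?_
      rw [norm_mul, norm_mul, mul_comm ‖φ (quaE α (m + 2))‖]
      gcongr <;> refine (norm_add_le _ _).trans ?_ <;> simp only [norm_mul, le_refl]

theorem quartic_middle_gap {D G E e₁ e₂ a₁ b₁ a₁' b₁' a₂ b₂ a₂' b₂' : ℝ} (hD : 121 ≤ D)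
    (hG : 0 ≤ G) (hGE : G ^ 2 = E) (hE : 1 ≤ E) (h₁ : E ≤ 2 * e₁) (h₂ : 0 < e₂)
    (h : E * D ≤ (a₁ * b₁' + a₁' * b₁) / e₁ + (a₂ * b₂' + a₂' * b₂) / e₂)
    (hb₁ : 0 ≤ b₁) (hb₁' : 0 ≤ b₁') (ha₁ : a₁ ≤ 9 / 2 * G) (ha₁' : a₁' ≤ 9 / 2 * G)
    (hb : b₁ ≤ 9 / 2 * G) (hb' : b₁' ≤ 9 / 2 * G)
    (ha₂ : 0 < a₂) (hab : a₂ * b₂ = e₂) (hab' : a₂' * b₂' = e₂) (hle : a₂ ≤ a₂') :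
    39 * E * a₂ ≤ a₂' := by
  have ha₂' : 0 < a₂' := ha₂.trans_le hle
  have hs : ∀ u v : ℝ, 0 ≤ v → u ≤ 9 / 2 * G → v ≤ 9 / 2 * G → u * v ≤ 81 / 4 * E :=
    fun u v hv h h' => by
      calc u * v ≤ (9 / 2 * G) * (9 / 2 * G) := by gcongr
        _ = 81 / 4 * E := by rw [← hGE]; ring
  have k₁ : (a₁ * b₁' + a₁' * b₁) / e₁ ≤ 81 := by
    rw [div_le_iff₀ (by linarith)]
    linarith [hs _ _ hb₁' ha₁ hb', hs _ _ hb₁ ha₁' hb]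
  have k₂ : (a₂ * b₂' + a₂' * b₂) / e₂ = a₂ / a₂' + a₂' / a₂ := by
    have e : b₂ = e₂ / a₂ := by field_simp; linarith
    have e' : b₂' = e₂ / a₂' := by field_simp; linarith
    rw [e, e']
    field_simp
  have k₃ : a₂ / a₂' ≤ 1 := (div_le_one ha₂').2 hle
  have k₄ : E * 121 ≤ E * D := by gcongr
  rw [← le_div_iff₀ ha₂]
  linarith

variable [CharZero L]

theorem card_quartic_middle_dvd_le (φ : L →+* ℂ) {α : Fin 4 → L}
    (hα : ∀ i, quaE α i ≠ 0) (hE : 1 ≤ ∏ i, ‖φ (quaE α i)‖) {m k l : Fin 3}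
    (hkl : (k = m + 1 ∧ l = m + 2) ∨ (k = m + 2 ∧ l = m + 1))
    (hmk : ‖φ (quaE α k)‖ ≤ ‖φ (quaE α m)‖) (hlk : ‖φ (quaE α l)‖ ≤ ‖φ (quaE α k)‖)
    {G : ℝ} (hG : 0 ≤ G) (hGE : G ^ 2 = ‖φ (quaE α m)‖) {T : Finset (ℤ × ℤ)}
    (hT : ∀ p ∈ T, ∃ f : ℤ, (f = 1 ∨ f = -1) ∧ ∏ j, ((p.1 : L) - α j * p.2) = f)
    (hdist : ∀ p ∈ T, ∀ q ∈ T, p ≠ q → p.1 * q.2 - p.2 * q.1 ≠ 0)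
    (hdvd : ∀ p ∈ T, ∀ q ∈ T, (11 : ℤ) ∣ p.1 * q.2 - p.2 * q.1)
    (hA : ∀ p ∈ T, ∀ i, ‖φ (quaA α p.1 p.2 i)‖ ≤ 9 / 2 * G)
    (hB : ∀ p ∈ T, ∀ i, ‖φ (quaB α p.1 p.2 i)‖ ≤ 9 / 2 * G) : T.card ≤ 3 := by
  have hpos : ∀ i, 0 < ‖φ (quaE α i)‖ := fun i => norm_pos_iff.2 ((map_ne_zero φ).2 (hα i))
  have hsum := congrArg φ (quaE_sum α)
  have hprod : 1 ≤ ‖φ (quaE α m)‖ * ‖φ (quaE α k)‖ * ‖φ (quaE α l)‖ := by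
    refine hE.trans_eq ?_
    rw [Fin.prod_univ_three]
    obtain ⟨rfl, rfl⟩ | ⟨rfl, rfl⟩ := hkl <;> fin_cases m <;>
      simp only [Fin.zero_eta, Fin.mk_one, Fin.reduceFinMk, Fin.reduceAdd, zero_add] <;> ring1
  have htri : ‖φ (quaE α m)‖ ≤ ‖φ (quaE α k)‖ + ‖φ (quaE α l)‖ := by
    have : φ (quaE α m) = -(φ (quaE α k) + φ (quaE α l)) := by
      simp only [map_add, map_zero] at hsum
      obtain ⟨rfl, rfl⟩ | ⟨rfl, rfl⟩ := hkl <;> fin_cases m <;> simp <;>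
        linear_combination hsum
    rw [this, norm_neg]
    exact norm_add_le _ _
  have hE1 : 1 ≤ ‖φ (quaE α m)‖ := by
    by_contra! h
    refine absurd hprod (not_le.2 ?_)
    calc _ ≤ ‖φ (quaE α m)‖ * 1 * 1 := by gcongr <;> linarith
      _ < 1 := by linarith
  have hdet : ∀ p q : ℤ × ℤ,
      ‖φ (quaE α m)‖ * ((p.1 * q.2 - p.2 * q.1 : ℤ) : ℝ) ^ 2 ≤
      (‖φ (quaA α p.1 p.2 k)‖ * ‖φ (quaB α q.1 q.2 k)‖ +
        ‖φ (quaA α q.1 q.2 k)‖ * ‖φ (quaB α p.1 p.2 k)‖) / ‖φ (quaE α k)‖ +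
      (‖φ (quaA α p.1 p.2 l)‖ * ‖φ (quaB α q.1 q.2 l)‖ +
        ‖φ (quaA α q.1 q.2 l)‖ * ‖φ (quaB α p.1 p.2 l)‖) / ‖φ (quaE α l)‖ := by
    intro p q
    have h := norm_quaE_mul_det_sq_le φ hα p.1 p.2 q.1 q.2 m
    obtain ⟨rfl, rfl⟩ | ⟨rfl, rfl⟩ := hkl
    · exact h
    · exact h.trans_eq (add_comm _ _)
  have hAB : ∀ p ∈ T, ∀ i, ‖φ (quaA α p.1 p.2 i)‖ * ‖φ (quaB α p.1 p.2 i)‖ =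
      ‖φ (quaE α i)‖ := by
    intro p hp i
    obtain ⟨f, hf, hfp⟩ := hT p hp
    rw [← norm_mul, ← map_mul, quaA_mul_quaB, hfp]
    rcases hf with rfl | rfl <;> simp
  have hApos : ∀ p ∈ T, ∀ i, 0 < ‖φ (quaA α p.1 p.2 i)‖ := fun p hp i =>
    (norm_nonneg _).lt_of_ne' fun h => (hpos i).ne' (by rw [← hAB p hp i, h, zero_mul])
  have hgap : ∀ p ∈ T, ∀ q ∈ T, p ≠ q → ‖φ (quaA α p.1 p.2 l)‖ ≤ ‖φ (quaA α q.1 q.2 l)‖ →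
      39 * ‖φ (quaE α m)‖ * ‖φ (quaA α p.1 p.2 l)‖ ≤ ‖φ (quaA α q.1 q.2 l)‖ := by
    intro p hp q hq hpq hle
    refine quartic_middle_gap ?_ hG hGE hE1 (by linarith) (hpos l) (hdet p q) (norm_nonneg _)
      (norm_nonneg _) (hA p hp k) (hA q hq k) (hB p hp k) (hB q hq k) (hApos p hp l)
      (hAB p hp l) (hAB q hq l) hle
    obtain ⟨c, hc⟩ := hdvd p hp q hq
    have hc0 : c ≠ 0 := by
      rintro rfl
      exact hdist p hp q hq hpq (by rw [hc, mul_zero])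
    have : 0 < c ^ 2 := by positivity
    have : (121 : ℤ) ≤ (p.1 * q.2 - p.2 * q.1) ^ 2 := by
      rw [hc]
      linarith [mul_pow 11 c 2]
    exact_mod_cast this
  by_contra! h
  obtain ⟨a, hinj, haT, hmono⟩ := exists_monotone_enum T
    (fun p : ℤ × ℤ => ‖φ (quaA α p.1 p.2 l)‖) (n := 4) h
  have step : ∀ i j, i < j → 39 * ‖φ (quaE α m)‖ * ‖φ (quaA α (a i).1 (a i).2 l)‖ ≤
      ‖φ (quaA α (a j).1 (a j).2 l)‖ := fun i j hij =>
    hgap _ (haT i) _ (haT j) (hinj.ne hij.ne) (hmono hij.le)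
  have s1 := step 0 1 (by decide)
  have s2 := step 1 2 (by decide)
  have s3 := step 2 3 (by decide)
  have hab := hAB _ (haT 0) l
  have hb0 := norm_nonneg (φ (quaB α (a 0).1 (a 0).2 l))
  have hfin : ‖φ (quaA α (a 3).1 (a 3).2 l)‖ * ‖φ (quaB α (a 0).1 (a 0).2 l)‖ ≤
      81 / 4 * ‖φ (quaE α m)‖ := by
    calc _ ≤ 9 / 2 * G * (9 / 2 * G) := by
          gcongr
          · exact hA _ (haT 3) l
          · exact hB _ (haT 0) l
      _ = _ := by rw [← hGE]; ring
  generalize ‖φ (quaA α (a 0).1 (a 0).2 l)‖ = a0, ‖φ (quaA α (a 1).1 (a 1).2 l)‖ = a1,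
    ‖φ (quaA α (a 2).1 (a 2).2 l)‖ = a2, ‖φ (quaA α (a 3).1 (a 3).2 l)‖ = a3,
    ‖φ (quaB α (a 0).1 (a 0).2 l)‖ = b0 at s1 s2 s3 hab hb0 hfin
  generalize ‖φ (quaE α m)‖ = E at *
  have hel := hpos l
  generalize ‖φ (quaE α l)‖ = e at *
  have h1 : 1 ≤ E ^ 2 * e := by
    refine hprod.trans ?_
    rw [sq]
    gcongr
  have h2 : (39 * E) ^ 3 * a0 ≤ a3 := by
    calc (39 * E) ^ 3 * a0 = 39 * E * (39 * E * (39 * E * a0)) := by ring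
      _ ≤ 39 * E * (39 * E * a1) := by gcongr
      _ ≤ 39 * E * a2 := by gcongr
      _ ≤ a3 := s3
  have h3 : 39 ^ 3 * (E ^ 2 * e) * E ≤ 81 / 4 * E := by
    calc _ = (39 * E) ^ 3 * a0 * b0 := by rw [← hab]; ring
      _ ≤ a3 * b0 := by gcongr
      _ ≤ _ := hfin
  have h4 := le_of_mul_le_mul_right h3 (by linarith)
  linarith

theorem card_quartic_middle_le (φ : L →+* ℂ) {α : Fin 4 → L}
    (hα : ∀ i, quaE α i ≠ 0) (hE : 1 ≤ ∏ i, ‖φ (quaE α i)‖) {m : Fin 3}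
    (hm : ∀ i, ‖φ (quaE α i)‖ ≤ ‖φ (quaE α m)‖)
    {G : ℝ} (hG : 0 ≤ G) (hGE : G ^ 2 = ‖φ (quaE α m)‖) {S : Finset (ℤ × ℤ)}
    (hprim : ∀ p ∈ S, IsCoprime p.1 p.2)
    (hS : ∀ p ∈ S, ∃ f : ℤ, (f = 1 ∨ f = -1) ∧ ∏ j, ((p.1 : L) - α j * p.2) = f)
    (hdist : ∀ p ∈ S, ∀ q ∈ S, p ≠ q → p.1 * q.2 - p.2 * q.1 ≠ 0)
    (hA : ∀ p ∈ S, ∀ i, ‖φ (quaA α p.1 p.2 i)‖ ≤ 9 / 2 * G)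
    (hB : ∀ p ∈ S, ∀ i, ‖φ (quaB α p.1 p.2 i)‖ ≤ 9 / 2 * G) : S.card ≤ 36 := by
  have : Fact (Nat.Prime 11) := ⟨by norm_num⟩
  refine card_le_of_dvd_det 11 3 hprim fun T hTS hT => ?_
  have main : ∀ k l : Fin 3, ((k = m + 1 ∧ l = m + 2) ∨ (k = m + 2 ∧ l = m + 1)) →
      ‖φ (quaE α l)‖ ≤ ‖φ (quaE α k)‖ → T.card ≤ 3 := fun k l hkl hlk =>
    card_quartic_middle_dvd_le φ hα hE hkl (hm k) hlk hG hGE (fun p hp => hS p (hTS hp))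
      (fun p hp q hq => hdist p (hTS hp) q (hTS hq)) hT (fun p hp => hA p (hTS hp))
      fun p hp => hB p (hTS hp)
  rcases le_total ‖φ (quaE α (m + 2))‖ ‖φ (quaE α (m + 1))‖ with h | h
  · exact main _ _ (Or.inl ⟨rfl, rfl⟩) h
  · exact main _ _ (Or.inr ⟨rfl, rfl⟩) h

end QuarticMiddle

section QuarticCount

variable {L : Type*} [Field L]

theorem quartic_ray_of_large {G u v t u' v' t' : ℝ} (hG : 0 < G) (hu : 9 / 2 * G < u)
    (huu : u * u' ≤ G ^ 2) (hvv : v * v' ≤ G ^ 2) (h1 : u ≤ v + t) (hvt : t ≤ v)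
    (h2 : u ≤ v' + t') (h3 : t' ≤ u' + v) : 4 * G ≤ u ∧ 4 * G ≤ v ∧ 4 * G ≤ t' := by
  have key : ∀ c x y : ℝ, 0 < c → c * G ≤ x → x * y ≤ G ^ 2 → y ≤ G / c := by
    intro c x y hc hx hxy
    rcases le_total y 0 with hy | hy
    · exact hy.trans (by positivity)
    · rw [le_div_iff₀ hc]
      have : c * G * y ≤ G ^ 2 := le_trans (by gcongr) hxy
      exact le_of_mul_le_mul_right (by linarith) hG
  have k1 := key (9 / 2) u u' (by norm_num) hu.le huu
  have k2 := key (9 / 4) v v' (by norm_num) (by linarith) hvv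
  have k3 := key (19 / 5) v v' (by norm_num) (by linarith) hvv
  exact ⟨by linarith, by linarith, by linarith⟩

theorem quartic_ray_or_middle {a b : Fin 3 → ℝ} {G : ℝ} (hG : 0 < G)
    (hab : ∀ i, a i * b i ≤ G ^ 2)
    (h1 : a 2 ≤ b 0 + b 1 ∧ b 0 ≤ a 2 + b 1 ∧ b 1 ≤ a 2 + b 0)
    (h2 : a 1 ≤ b 0 + b 2 ∧ b 0 ≤ a 1 + b 2 ∧ b 2 ≤ a 1 + b 0)
    (h3 : a 0 ≤ b 1 + b 2 ∧ b 1 ≤ a 0 + b 2 ∧ b 2 ≤ a 0 + b 1)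
    (h4 : a 0 ≤ a 1 + a 2 ∧ a 1 ≤ a 0 + a 2 ∧ a 2 ≤ a 0 + a 1) :
    (∀ i, a i ≤ 9 / 2 * G ∧ b i ≤ 9 / 2 * G) ∨
      (4 * G ≤ b 0 ∧ 4 * G ≤ b 1 ∧ 4 * G ≤ b 2) ∨ (4 * G ≤ b 0 ∧ 4 * G ≤ a 1 ∧ 4 * G ≤ a 2) ∨
      (4 * G ≤ a 0 ∧ 4 * G ≤ b 1 ∧ 4 * G ≤ a 2) ∨ (4 * G ≤ a 0 ∧ 4 * G ≤ a 1 ∧ 4 * G ≤ b 2) := by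
  have q0 := hab 0
  have q1 := hab 1
  have q2 := hab 2
  have p0 : b 0 * a 0 ≤ G ^ 2 := by linarith
  have p1 : b 1 * a 1 ≤ G ^ 2 := by linarith
  have p2 : b 2 * a 2 ≤ G ^ 2 := by linarith
  obtain ⟨h11, h12, h13⟩ := h1
  obtain ⟨h21, h22, h23⟩ := h2
  obtain ⟨h31, h32, h33⟩ := h3
  obtain ⟨h41, h42, h43⟩ := h4
  by_cases A0 : 9 / 2 * G < a 0
  · rcases le_total (a 2) (a 1) with h | h
    · have := quartic_ray_of_large hG A0 q0 q1 h41 h h31 (t' := b 2) (by linarith)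
      tauto
    · have := quartic_ray_of_large hG A0 q0 q2 (by linarith) h (t' := b 1) (by linarith)
        (by linarith)
      tauto
  by_cases A1 : 9 / 2 * G < a 1
  · rcases le_total (a 2) (a 0) with h | h
    · have := quartic_ray_of_large hG A1 q1 q0 (t' := b 2) (by linarith) h (by linarith)
        (by linarith)
      tauto
    · have := quartic_ray_of_large hG A1 q1 q2 (t' := b 0) (by linarith) h (by linarith)
        (by linarith)
      tauto
  by_cases A2 : 9 / 2 * G < a 2
  · rcases le_total (a 1) (a 0) with h | h
    · have := quartic_ray_of_large hG A2 q2 q0 (t' := b 1) (by linarith) h (by linarith)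
        (by linarith)
      tauto
    · have := quartic_ray_of_large hG A2 q2 q1 (t' := b 0) (by linarith) h (by linarith)
        (by linarith)
      tauto
  by_cases B0 : 9 / 2 * G < b 0
  · rcases le_total (a 2) (b 1) with h | h
    · have := quartic_ray_of_large hG B0 p0 p1 (t' := b 2) (by linarith) h (by linarith)
        (by linarith)
      tauto
    · have := quartic_ray_of_large hG B0 p0 q2 (t' := a 1) (by linarith) h (by linarith)
        (by linarith)
      tauto
  by_cases B1 : 9 / 2 * G < b 1
  · rcases le_total (a 2) (b 0) with h | h
    · have := quartic_ray_of_large hG B1 p1 p0 (t' := b 2) (by linarith) h (by linarith)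
        (by linarith)
      tauto
    · have := quartic_ray_of_large hG B1 p1 q2 (t' := a 0) (by linarith) h (by linarith)
        (by linarith)
      tauto
  by_cases B2 : 9 / 2 * G < b 2
  · rcases le_total (a 1) (b 0) with h | h
    · have := quartic_ray_of_large hG B2 p2 p0 (t' := b 1) (by linarith) h (by linarith)
        (by linarith)
      tauto
    · have := quartic_ray_of_large hG B2 p2 q1 (t' := a 0) (by linarith) h (by linarith)
        (by linarith)
      tauto
  refine Or.inl fun i => ?_
  fin_cases i
  · exact ⟨not_lt.1 A0, not_lt.1 B0⟩
  · exact ⟨not_lt.1 A1, not_lt.1 B1⟩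
  · exact ⟨not_lt.1 A2, not_lt.1 B2⟩

theorem quaE_comp_swap (α : Fin 4 → L) (j : Fin 4) (i : Fin 3) :
    ∃ k, quaE (α ∘ Equiv.swap 0 j) i = quaE α k ∨ quaE (α ∘ Equiv.swap 0 j) i = -quaE α k := by
  have s1 : ∀ i, Equiv.swap (0 : Fin 4) 1 i = ![1, 0, 2, 3] i := by decide
  have s2 : ∀ i, Equiv.swap (0 : Fin 4) 2 i = ![2, 1, 0, 3] i := by decide
  have s3 : ∀ i, Equiv.swap (0 : Fin 4) 3 i = ![3, 1, 2, 0] i := by decide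
  by_cases h : j = 0
  · exact ⟨i, Or.inl (by simp [h])⟩
  fin_cases j
  · exact absurd rfl h
  · refine ⟨![0, 2, 1] i, Or.inr ?_⟩
    fin_cases i <;> simp [quaE, s1] <;> ring1
  · refine ⟨![2, 1, 0] i, Or.inr ?_⟩
    fin_cases i <;> simp [quaE, s2] <;> ring1
  · refine ⟨![1, 0, 2] i, Or.inr ?_⟩
    fin_cases i <;> simp [quaE, s3] <;> ring1

/-- Up to sign, `quaB` for the roots permuted by a transposition `(0 j)`. -/
theorem norm_quaB_comp_swap (φ : L →+* ℂ) (α : Fin 4 → L) (x y : ℤ) :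
    (∀ i, ‖φ (quaB (α ∘ Equiv.swap 0 1) x y i)‖ =
      ![‖φ (quaB α x y 0)‖, ‖φ (quaA α x y 2)‖, ‖φ (quaA α x y 1)‖] i) ∧
    (∀ i, ‖φ (quaB (α ∘ Equiv.swap 0 2) x y i)‖ =
      ![‖φ (quaA α x y 2)‖, ‖φ (quaB α x y 1)‖, ‖φ (quaA α x y 0)‖] i) ∧
    (∀ i, ‖φ (quaB (α ∘ Equiv.swap 0 3) x y i)‖ =
      ![‖φ (quaA α x y 1)‖, ‖φ (quaA α x y 0)‖, ‖φ (quaB α x y 2)‖] i) := by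
  have s1 : ∀ i, Equiv.swap (0 : Fin 4) 1 i = ![1, 0, 2, 3] i := by decide
  have s2 : ∀ i, Equiv.swap (0 : Fin 4) 2 i = ![2, 1, 0, 3] i := by decide
  have s3 : ∀ i, Equiv.swap (0 : Fin 4) 3 i = ![3, 1, 2, 0] i := by decide
  have hn : ∀ u v : L, u = v ∨ u = -v → ‖φ u‖ = ‖φ v‖ := by
    rintro u v (rfl | rfl) <;> simp
  refine ⟨fun i => ?_, fun i => ?_, fun i => ?_⟩
  · fin_cases i <;> simp only [Fin.zero_eta, Fin.mk_one, Fin.reduceFinMk, Matrix.cons_val] <;>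
      refine hn _ _ ?_ <;>
      simp only [quaB, quaA, Function.comp_apply, s1, Matrix.cons_val] <;> first | (left; ring1) | (right; ring1)
  · fin_cases i <;> simp only [Fin.zero_eta, Fin.mk_one, Fin.reduceFinMk, Matrix.cons_val] <;>
      refine hn _ _ ?_ <;>
      simp only [quaB, quaA, Function.comp_apply, s2, Matrix.cons_val] <;> first | (left; ring1) | (right; ring1)
  · fin_cases i <;> simp only [Fin.zero_eta, Fin.mk_one, Fin.reduceFinMk, Matrix.cons_val] <;>
      refine hn _ _ ?_ <;>
      simp only [quaB, quaA, Function.comp_apply, s3, Matrix.cons_val] <;> first | (left; ring1) | (right; ring1)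

variable [CharZero L] [IsGalois ℚ L]

/-- A quartic Thue equation `F (x, y) = ±1` has at most `60` solutions up to sign. -/
theorem card_quartic_le (φ : L →+* ℂ) {α : Fin 4 → L} (hα : Function.Injective α)
    (iα : ∀ i, IsIntegral ℤ (α i))
    (hσ : ∀ σ : L ≃ₐ[ℚ] L, ∃ τ : Equiv.Perm (Fin 4), ∀ i, σ (α i) = α (τ i))
    {S : Finset (ℤ × ℤ)} (hprim : ∀ p ∈ S, IsCoprime p.1 p.2)
    (hS : ∀ p ∈ S, ∃ f : ℤ, (f = 1 ∨ f = -1) ∧ ∏ j, ((p.1 : L) - α j * p.2) = f)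
    (hdist : ∀ p ∈ S, ∀ q ∈ S, p ≠ q → p.1 * q.2 - p.2 * q.1 ≠ 0) : S.card ≤ 60 := by
  classical
  have hE0 := quaE_ne_zero hα
  have hprod : 1 ≤ ∏ i, ‖φ (quaE α i)‖ := by
    have := one_le_norm_of_galois φ (IsIntegral.prod _ fun i _ => isIntegral_quaE iα i)
      (Finset.prod_ne_zero_iff.2 fun i _ => hE0 i) fun σ => (quaSimilar_galois hσ σ).1
    rwa [map_prod, norm_prod] at this
  obtain ⟨m, hm⟩ := Finite.exists_max fun i => ‖φ (quaE α i)‖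
  have hE1 : 1 ≤ ‖φ (quaE α m)‖ := by
    by_contra! h
    refine absurd hprod (not_le.2 ?_)
    calc ∏ i, ‖φ (quaE α i)‖ ≤ ∏ _i : Fin 3, ‖φ (quaE α m)‖ :=
          Finset.prod_le_prod (fun _ _ => norm_nonneg _) fun i _ => hm i
      _ < 1 := by
        rw [Finset.prod_const]
        exact pow_lt_one₀ (norm_nonneg _) h (by simp)
  set G := √‖φ (quaE α m)‖ with hGdef
  have hGE : G ^ 2 = ‖φ (quaE α m)‖ := Real.sq_sqrt (norm_nonneg _)
  have hG : 1 ≤ G := Real.one_le_sqrt.2 hE1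
  let M : Finset (ℤ × ℤ) := S.filter fun p =>
    ∀ i, ‖φ (quaA α p.1 p.2 i)‖ ≤ 9 / 2 * G ∧ ‖φ (quaB α p.1 p.2 i)‖ ≤ 9 / 2 * G
  let R : Fin 4 → Finset (ℤ × ℤ) := fun j => S.filter fun p =>
    ∀ i, 4 * G ≤ ‖φ (quaB (α ∘ Equiv.swap 0 j) p.1 p.2 i)‖
  have hM : M.card ≤ 36 := by
    have hMS : ∀ p ∈ M, p ∈ S := fun p hp => (Finset.mem_filter.1 hp).1
    exact card_quartic_middle_le φ hE0 hprod hm (by linarith) hGE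
      (fun p hp => hprim p (hMS p hp)) (fun p hp => hS p (hMS p hp))
      (fun p hp q hq => hdist p (hMS p hp) q (hMS q hq))
      (fun p hp i => ((Finset.mem_filter.1 hp).2 i).1)
      (fun p hp i => ((Finset.mem_filter.1 hp).2 i).2)
  have hR : ∀ j ∈ Finset.univ, (R j).card ≤ 6 := by
    intro j _
    have hRS : ∀ p ∈ R j, p ∈ S := fun p hp => (Finset.mem_filter.1 hp).1
    refine card_quartic_ray_le φ (α := α ∘ Equiv.swap 0 j) (hα.comp (Equiv.injective _))
      (fun i => iα _) (fun σ => ?_) hG (fun i => ?_) (fun p hp => ?_)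
      (fun p hp q hq => hdist p (hRS p hp) q (hRS q hq))
      (fun p hp => (Finset.mem_filter.1 hp).2)
    · obtain ⟨τ, hτ⟩ := hσ σ
      exact ⟨Equiv.swap 0 j * τ * Equiv.swap 0 j, fun i => by simp [hτ]⟩
    · rw [hGE]
      obtain ⟨k, h | h⟩ := quaE_comp_swap α j i <;> rw [h]
      · exact hm k
      · rw [map_neg, norm_neg]
        exact hm k
    · obtain ⟨f, hf, h⟩ := hS p (hRS p hp)
      exact ⟨f, hf, by
        rw [← h]
        exact Equiv.prod_comp (Equiv.swap 0 j) fun i => (p.1 : L) - α i * p.2⟩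
  have hcover : S ⊆ M ∪ Finset.univ.biUnion R := by
    intro p hp
    have hab : ∀ i, ‖φ (quaA α p.1 p.2 i)‖ * ‖φ (quaB α p.1 p.2 i)‖ ≤ G ^ 2 := by
      intro i
      obtain ⟨f, hf, hfp⟩ := hS p hp
      rw [← norm_mul, ← map_mul, quaA_mul_quaB, hfp, hGE]
      refine le_trans (le_of_eq ?_) (hm i)
      rcases hf with rfl | rfl <;> simp
    have htri : ∀ u v w : L, u = v + w →
        ‖φ u‖ ≤ ‖φ v‖ + ‖φ w‖ ∧ ‖φ v‖ ≤ ‖φ u‖ + ‖φ w‖ ∧ ‖φ w‖ ≤ ‖φ u‖ + ‖φ v‖ := by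
      rintro u v w rfl
      have h1 := norm_add_le (φ v) (φ w)
      have h2 := norm_sub_le (φ v + φ w) (φ w)
      have h3 := norm_sub_le (φ v + φ w) (φ v)
      rw [add_sub_cancel_right] at h2
      rw [add_sub_cancel_left] at h3
      rw [map_add]
      exact ⟨h1, h2, h3⟩
    have e1 := quaB_one α p.1 p.2
    have e2 := quaB_two α p.1 p.2
    have e0 := quaA_sum α p.1 p.2
    have t1 := htri (quaB α p.1 p.2 1) (quaB α p.1 p.2 0) (quaA α p.1 p.2 2) e1
    have t2 := htri (quaB α p.1 p.2 0) (quaB α p.1 p.2 2) (quaA α p.1 p.2 1)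
      (by rw [e2]; ring)
    have t3 := htri (quaB α p.1 p.2 2) (quaB α p.1 p.2 1) (quaA α p.1 p.2 0)
      (by rw [e1, e2]; linear_combination -e0)
    have t4 := htri (-quaA α p.1 p.2 0) (quaA α p.1 p.2 1) (quaA α p.1 p.2 2)
      (by linear_combination -e0)
    rw [map_neg, norm_neg] at t4
    obtain ⟨n1, n2, n3⟩ := norm_quaB_comp_swap φ α p.1 p.2
    have := quartic_ray_or_middle (a := fun i => ‖φ (quaA α p.1 p.2 i)‖)
      (b := fun i => ‖φ (quaB α p.1 p.2 i)‖) (G := G) (by linarith) hab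
      ⟨by linarith, by linarith, by linarith⟩ ⟨by linarith, by linarith, by linarith⟩
      ⟨by linarith, by linarith, by linarith⟩ ⟨by linarith, by linarith, by linarith⟩
    rw [Finset.mem_union, Finset.mem_biUnion]
    rcases this with h | ⟨x0, x1, x2⟩ | ⟨x0, x1, x2⟩ | ⟨x0, x1, x2⟩ | ⟨x0, x1, x2⟩
    · exact Or.inl (Finset.mem_filter.2 ⟨hp, h⟩)
    · refine Or.inr ⟨0, Finset.mem_univ _, Finset.mem_filter.2 ⟨hp, fun i => ?_⟩⟩
      rw [Equiv.swap_self]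
      fin_cases i <;> assumption
    · refine Or.inr ⟨1, Finset.mem_univ _, Finset.mem_filter.2 ⟨hp, fun i => ?_⟩⟩
      rw [n1]
      fin_cases i <;> assumption
    · refine Or.inr ⟨2, Finset.mem_univ _, Finset.mem_filter.2 ⟨hp, fun i => ?_⟩⟩
      rw [n2]
      fin_cases i <;> assumption
    · refine Or.inr ⟨3, Finset.mem_univ _, Finset.mem_filter.2 ⟨hp, fun i => ?_⟩⟩
      rw [n3]
      fin_cases i <;> assumption
  calc S.card ≤ (M ∪ Finset.univ.biUnion R).card := Finset.card_le_card hcover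
    _ ≤ M.card + (Finset.univ.biUnion R).card := Finset.card_union_le _ _
    _ ≤ 36 + Finset.univ.card * 6 :=
      add_le_add hM (Finset.card_biUnion_le_card_mul _ _ _ hR)
    _ = 60 := by simp

end QuarticCount

section Resolvent

variable {L : Type*} [Field L]

theorem exists_int_of_galois [CharZero L] [IsGalois ℚ L] {x : L} (hx : IsIntegral ℤ x)
    (hσ : ∀ σ : L ≃ₐ[ℚ] L, σ x = x) : ∃ z : ℤ, x = z := by
  obtain ⟨q, rfl⟩ := (InfiniteGalois.mem_range_algebraMap_iff_fixed (k := ℚ) x).2 hσ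
  obtain ⟨z, rfl⟩ := IsIntegrallyClosed.isIntegral_iff.1
    ((isIntegral_algebraMap_iff (algebraMap ℚ L).injective).1 hx)
  exact ⟨z, by simp⟩

theorem exists_int_esymm [CharZero L] [IsGalois ℚ L] {a : Fin 4 → L}
    (ia : ∀ i, IsIntegral ℤ (a i))
    (hσ : ∀ σ : L ≃ₐ[ℚ] L, ∃ τ : Equiv.Perm (Fin 4), ∀ i, σ (a i) = a (τ i)) :
    ∃ s₁ s₂ s₃ s₄ : ℤ, a 0 + a 1 + a 2 + a 3 = s₁ ∧
      a 0 * a 1 + a 0 * a 2 + a 0 * a 3 + a 1 * a 2 + a 1 * a 3 + a 2 * a 3 = s₂ ∧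
      a 0 * a 1 * a 2 + a 0 * a 1 * a 3 + a 0 * a 2 * a 3 + a 1 * a 2 * a 3 = s₃ ∧
      a 0 * a 1 * a 2 * a 3 = s₄ := by
  have hsum : ∀ (σ : L ≃ₐ[ℚ] L) (k : ℕ), σ (∑ i, a i ^ k) = ∑ i, a i ^ k := fun σ k => by
    obtain ⟨τ, hτ⟩ := hσ σ
    simp only [map_sum, map_pow, hτ]
    exact Equiv.sum_comp τ fun i => a i ^ k
  have hprod : ∀ σ : L ≃ₐ[ℚ] L, σ (∏ i, a i) = ∏ i, a i := fun σ => by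
    obtain ⟨τ, hτ⟩ := hσ σ
    simp only [map_prod, hτ]
    exact Equiv.prod_comp τ fun i => a i
  have i0 := ia 0
  have i1 := ia 1
  have i2 := ia 2
  have i3 := ia 3
  obtain ⟨s₁, h₁⟩ := exists_int_of_galois (x := a 0 + a 1 + a 2 + a 3)
    (((i0.add i1).add i2).add i3) fun σ => by
      have := hsum σ 1
      simpa only [pow_one, Fin.sum_univ_four] using this
  obtain ⟨s₂, h₂⟩ := exists_int_of_galois
    (x := a 0 * a 1 + a 0 * a 2 + a 0 * a 3 + a 1 * a 2 + a 1 * a 3 + a 2 * a 3)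
    ((((((i0.mul i1).add (i0.mul i2)).add (i0.mul i3)).add (i1.mul i2)).add (i1.mul i3)).add
      (i2.mul i3)) fun σ => by
      have : a 0 * a 1 + a 0 * a 2 + a 0 * a 3 + a 1 * a 2 + a 1 * a 3 + a 2 * a 3 =
          ((∑ i, a i ^ 1) ^ 2 - ∑ i, a i ^ 2) / 2 := by
        simp only [Fin.sum_univ_four]
        ring
      rw [this, map_div₀, map_sub, map_pow, hsum, hsum, map_ofNat]
  obtain ⟨s₃, h₃⟩ := exists_int_of_galois
    (x := a 0 * a 1 * a 2 + a 0 * a 1 * a 3 + a 0 * a 2 * a 3 + a 1 * a 2 * a 3)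
    (((((i0.mul i1).mul i2).add ((i0.mul i1).mul i3)).add ((i0.mul i2).mul i3)).add
      ((i1.mul i2).mul i3)) fun σ => by
      have : a 0 * a 1 * a 2 + a 0 * a 1 * a 3 + a 0 * a 2 * a 3 + a 1 * a 2 * a 3 =
          ((∑ i, a i ^ 1) ^ 3 - 3 * (∑ i, a i ^ 1) * (∑ i, a i ^ 2) + 2 * ∑ i, a i ^ 3) / 6 := by
        simp only [Fin.sum_univ_four]
        ring
      simp only [this, map_div₀, map_add, map_sub, map_mul, map_pow σ (∑ i, a i ^ 1), hsum,
        map_ofNat]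
  obtain ⟨s₄, h₄⟩ := exists_int_of_galois (x := a 0 * a 1 * a 2 * a 3)
    (((i0.mul i1).mul i2).mul i3) fun σ => by
      have := hprod σ
      simpa only [Fin.prod_univ_four] using this
  exact ⟨s₁, s₂, s₃, s₄, h₁, h₂, h₃, h₄⟩

/-- The roots of the cubic resolvent of a quartic polynomial. -/
def quaTheta (a : Fin 4 → L) : Fin 3 → L :=
  ![a 0 * a 1 + a 2 * a 3, a 0 * a 2 + a 1 * a 3, a 0 * a 3 + a 1 * a 2]

theorem quaTheta_injective {a : Fin 4 → L} (ha : Function.Injective a) :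
    Function.Injective (quaTheta a) := by
  have h' : ∀ i j, i ≠ j → a i - a j ≠ 0 := fun i j hij => sub_ne_zero.2 (ha.ne hij)
  have h01 : quaTheta a 0 ≠ quaTheta a 1 := sub_ne_zero.1 <| by
    rw [show quaTheta a 0 - quaTheta a 1 = (a 0 - a 3) * (a 1 - a 2) by
      simp only [quaTheta, Matrix.cons_val]; ring]
    exact mul_ne_zero (h' _ _ (by decide)) (h' _ _ (by decide))
  have h02 : quaTheta a 0 ≠ quaTheta a 2 := sub_ne_zero.1 <| by
    rw [show quaTheta a 0 - quaTheta a 2 = (a 0 - a 2) * (a 1 - a 3) by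
      simp only [quaTheta, Matrix.cons_val]; ring]
    exact mul_ne_zero (h' _ _ (by decide)) (h' _ _ (by decide))
  have h12 : quaTheta a 1 ≠ quaTheta a 2 := sub_ne_zero.1 <| by
    rw [show quaTheta a 1 - quaTheta a 2 = (a 0 - a 1) * (a 2 - a 3) by
      simp only [quaTheta, Matrix.cons_val]; ring]
    exact mul_ne_zero (h' _ _ (by decide)) (h' _ _ (by decide))
  intro i j h
  fin_cases i <;> fin_cases j
  · rfl
  · exact absurd h h01
  · exact absurd h h02
  · exact absurd h h01.symm
  · rfl
  · exact absurd h h12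
  · exact absurd h h02.symm
  · exact absurd h h12.symm
  · rfl

theorem isIntegral_quaTheta {a : Fin 4 → L} (ia : ∀ i, IsIntegral ℤ (a i)) (i : Fin 3) :
    IsIntegral ℤ (quaTheta a i) := by
  fin_cases i
  · exact ((ia 0).mul (ia 1)).add ((ia 2).mul (ia 3))
  · exact ((ia 0).mul (ia 2)).add ((ia 1).mul (ia 3))
  · exact ((ia 0).mul (ia 3)).add ((ia 1).mul (ia 2))

theorem quaE_cubic {a b : Fin 4 → L} {w x y z s₁ s₂ s₃ s₄ : L}
    (h₁ : a 0 + a 1 + a 2 + a 3 = s₁)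
    (h₂ : a 0 * a 1 + a 0 * a 2 + a 0 * a 3 + a 1 * a 2 + a 1 * a 3 + a 2 * a 3 = s₂)
    (h₃ : a 0 * a 1 * a 2 + a 0 * a 1 * a 3 + a 0 * a 2 * a 3 + a 1 * a 2 * a 3 = s₃)
    (h₄ : a 0 * a 1 * a 2 * a 3 = s₄)
    (hb : ∀ i, b i = w + x * a i + y * a i ^ 2 + z * a i ^ 3) (i : Fin 3) :
    quaE b i = quaE a i * (x ^ 2 + s₁ * x * y + (s₁ ^ 2 - 2 * s₂) * x * z + s₂ * y ^ 2 +
      (s₁ * s₂ - s₃) * y * z + (s₂ ^ 2 - s₁ * s₃ + s₄) * z ^ 2 +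
      (x * z - y ^ 2 - s₁ * y * z - s₂ * z ^ 2) * quaTheta a i) := by
  subst h₁ h₂ h₃ h₄
  fin_cases i <;> simp only [Fin.zero_eta, Fin.mk_one, Fin.reduceFinMk, quaE, quaTheta, hb,
    Matrix.cons_val] <;> ring

theorem quaE_cubic_of_eq {a b : Fin 4 → L} {w x y z p q : L}
    (hx : x = p ^ 2 - (a 0 + a 1 + a 2 + a 3) * p * q +
      (a 0 * a 1 + a 0 * a 2 + a 0 * a 3 + a 1 * a 2 + a 1 * a 3 + a 2 * a 3) * q ^ 2)
    (hy : y = p * q - (a 0 + a 1 + a 2 + a 3) * q ^ 2) (hz : z = q ^ 2)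
    (hb : ∀ i, b i = w + x * a i + y * a i ^ 2 + z * a i ^ 3) :
    quaE b 0 = quaE a 0 * ∏ j, (p - a j * q) := by
  subst hx hy hz
  simp only [quaE, hb, Matrix.cons_val, Fin.prod_univ_four]
  ring

theorem quaTheta_esymm {a : Fin 4 → L} {s₁ s₂ s₃ s₄ : L}
    (h₁ : a 0 + a 1 + a 2 + a 3 = s₁)
    (h₂ : a 0 * a 1 + a 0 * a 2 + a 0 * a 3 + a 1 * a 2 + a 1 * a 3 + a 2 * a 3 = s₂)
    (h₃ : a 0 * a 1 * a 2 + a 0 * a 1 * a 3 + a 0 * a 2 * a 3 + a 1 * a 2 * a 3 = s₃)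
    (h₄ : a 0 * a 1 * a 2 * a 3 = s₄) :
    quaTheta a 0 + quaTheta a 1 + quaTheta a 2 = s₂ ∧
    quaTheta a 0 * quaTheta a 1 + quaTheta a 0 * quaTheta a 2 + quaTheta a 1 * quaTheta a 2 =
      s₁ * s₃ - 4 * s₄ ∧
    quaTheta a 0 * quaTheta a 1 * quaTheta a 2 = s₃ ^ 2 + s₁ ^ 2 * s₄ - 4 * s₂ * s₄ := by
  subst h₁ h₂ h₃ h₄
  refine ⟨?_, ?_, ?_⟩ <;> simp only [quaTheta, Matrix.cons_val] <;> ring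

end Resolvent

section Primitive

theorem eq_or_eq_neg_of_isCoprime {u v u' v' : ℤ} (h : IsCoprime u v) (h' : IsCoprime u' v')
    (hdet : u * v' - v * u' = 0) : (u' = u ∧ v' = v) ∨ (u' = -u ∧ v' = -v) := by
  obtain ⟨s, t, hst⟩ := h
  have hu : u' = u * (s * u' + t * v') := by linear_combination -u' * hst - t * hdet
  have hv : v' = v * (s * u' + t * v') := by linear_combination -v' * hst + s * hdet
  generalize s * u' + t * v' = k at hu hv
  rw [hu, hv] at h'
  have hk : IsUnit k := h'.isUnit_of_dvd' (dvd_mul_left _ _) (dvd_mul_left _ _)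
  rcases Int.isUnit_iff.1 hk with rfl | rfl
  · exact Or.inl ⟨by linarith, by linarith⟩
  · exact Or.inr ⟨by linarith, by linarith⟩

/-- One representative from each pair of opposite nonzero vectors. -/
def PosPair (p : ℤ × ℤ) : Prop := 0 < p.1 ∨ (p.1 = 0 ∧ 0 < p.2)

theorem posPair_or_neg {x y : ℤ} (h : IsCoprime x y) : PosPair (x, y) ∨ PosPair (-x, -y) := by
  rcases lt_trichotomy x 0 with hx | hx | hx
  · exact Or.inr (Or.inl (by simpa using hx))
  · rcases lt_trichotomy y 0 with hy | hy | hy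
    · exact Or.inr (Or.inr ⟨by simpa using hx, by simpa using hy⟩)
    · subst hx hy
      exact absurd h not_isCoprime_zero_zero
    · exact Or.inl (Or.inr ⟨hx, hy⟩)
  · exact Or.inl (Or.inl hx)

theorem PosPair.det_ne_zero {p q : ℤ × ℤ} (hp : PosPair p) (hq : PosPair q)
    (h : IsCoprime p.1 p.2) (h' : IsCoprime q.1 q.2) (hpq : p ≠ q) :
    p.1 * q.2 - p.2 * q.1 ≠ 0 := by
  intro hdet
  rcases eq_or_eq_neg_of_isCoprime h h' hdet with ⟨h1, h2⟩ | ⟨h1, h2⟩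
  · exact hpq (Prod.ext h1.symm h2.symm)
  · unfold PosPair at hp hq
    omega

/-- The integral points of the cone `x * z = y ^ 2`. -/
theorem exists_sq_of_mul_eq_sq {x y z : ℤ} (hxz : IsCoprime x z) (h : x * z = y ^ 2) :
    ∃ p q ε : ℤ, (ε = 1 ∨ ε = -1) ∧ x = ε * p ^ 2 ∧ y = ε * (p * q) ∧ z = ε * q ^ 2 := by
  obtain ⟨p, hp⟩ := Int.sq_of_isCoprime hxz h
  obtain ⟨q, hq⟩ := Int.sq_of_isCoprime hxz.symm (by rwa [mul_comm])
  have hy : y ^ 2 = (p * q) ^ 2 ∨ (y ^ 2 = -(p * q) ^ 2) := by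
    rw [← h]
    rcases hp with rfl | rfl <;> rcases hq with rfl | rfl
    · left; ring
    · right; ring
    · right; ring
    · left; ring
  have hy' : y ^ 2 = (p * q) ^ 2 := by
    rcases hy with hy | hy
    · exact hy
    · have h1 := sq_nonneg y
      have h2 := sq_nonneg (p * q)
      linarith
  obtain ⟨ε, hε, hx, hz⟩ : ∃ ε : ℤ, (ε = 1 ∨ ε = -1) ∧ x = ε * p ^ 2 ∧ z = ε * q ^ 2 := by
    rcases hp with hp | hp <;> rcases hq with hq | hq
    · exact ⟨1, Or.inl rfl, by linarith, by linarith⟩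
    · have : p ^ 2 * q ^ 2 = 0 := by
        have h1 := mul_nonneg (sq_nonneg p) (sq_nonneg q)
        have h2 := sq_nonneg y
        rw [← h, hp, hq] at h2
        linarith
      rcases mul_eq_zero.1 this with h0 | h0
      · exact ⟨-1, Or.inr rfl, by linarith, by linarith⟩
      · exact ⟨1, Or.inl rfl, by linarith, by linarith⟩
    · have : p ^ 2 * q ^ 2 = 0 := by
        have h1 := mul_nonneg (sq_nonneg p) (sq_nonneg q)
        have h2 := sq_nonneg y
        rw [← h, hp, hq] at h2
        linarith
      rcases mul_eq_zero.1 this with h0 | h0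
      · exact ⟨1, Or.inl rfl, by linarith, by linarith⟩
      · exact ⟨-1, Or.inr rfl, by linarith, by linarith⟩
    · exact ⟨-1, Or.inr rfl, by linarith, by linarith⟩
  rcases sq_eq_sq_iff_eq_or_eq_neg.1 hy' with hy | hy <;> rcases hε with rfl | rfl
  · exact ⟨p, q, 1, Or.inl rfl, hx, by linarith, hz⟩
  · exact ⟨p, -q, -1, Or.inr rfl, hx, by linarith, by linarith⟩
  · exact ⟨p, -q, 1, Or.inl rfl, hx, by linarith, by linarith⟩
  · exact ⟨p, q, -1, Or.inr rfl, hx, by linarith, hz⟩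

end Primitive

section Fiber

variable {L : Type*} [Field L] [CharZero L] [IsGalois ℚ L]

/-- An element of `ℤ[a]` with the same root differences products as `a` comes from a solution of
a quartic Thue equation. -/
theorem exists_quartic_point {a b : Fin 4 → L} (ha : Function.Injective a)
    {s₁ s₂ s₃ s₄ : ℤ} (h₁ : a 0 + a 1 + a 2 + a 3 = s₁)
    (h₂ : a 0 * a 1 + a 0 * a 2 + a 0 * a 3 + a 1 * a 2 + a 1 * a 3 + a 2 * a 3 = s₂)
    (h₃ : a 0 * a 1 * a 2 + a 0 * a 1 * a 3 + a 0 * a 2 * a 3 + a 1 * a 2 * a 3 = s₃)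
    (h₄ : a 0 * a 1 * a 2 * a 3 = s₄) {w x y z : ℤ}
    (hb : ∀ i, b i = w + x * a i + y * a i ^ 2 + z * a i ^ 3) {f : ℤ} (hf : f = 1 ∨ f = -1)
    (hE : ∀ i, quaE b i = f * quaE a i) :
    ∃ p : ℤ × ℤ, PosPair p ∧ IsCoprime p.1 p.2 ∧ ∏ j, ((p.1 : L) - a j * p.2) = f ∧
      ∃ w ε : ℤ, (ε = 1 ∨ ε = -1) ∧ ∀ i, b i = w + ε * (((p.1 ^ 2 - s₁ * p.1 * p.2 +
        s₂ * p.2 ^ 2 : ℤ) : L) * a i + ((p.1 * p.2 - s₁ * p.2 ^ 2 : ℤ) : L) * a i ^ 2 +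
        ((p.2 ^ 2 : ℤ) : L) * a i ^ 3) := by
  have hE0 := quaE_ne_zero ha
  obtain ⟨u, hu⟩ : ∃ u : ℤ, u = x ^ 2 + s₁ * x * y + (s₁ ^ 2 - 2 * s₂) * x * z + s₂ * y ^ 2 +
      (s₁ * s₂ - s₃) * y * z + (s₂ ^ 2 - s₁ * s₃ + s₄) * z ^ 2 := ⟨_, rfl⟩
  obtain ⟨v, hv⟩ : ∃ v : ℤ, v = x * z - y ^ 2 - s₁ * y * z - s₂ * z ^ 2 := ⟨_, rfl⟩
  have huv : ∀ i, (u : L) + v * quaTheta a i = f := fun i => by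
    refine mul_left_cancel₀ (hE0 i) ?_
    rw [mul_comm _ (f : L), ← hE i, quaE_cubic h₁ h₂ h₃ h₄ hb i, hu, hv]
    push_cast
    ring
  have hv0 : v = 0 := by
    have h : (v : L) * (quaTheta a 0 - quaTheta a 1) = 0 := by
      linear_combination huv 0 - huv 1
    rcases mul_eq_zero.1 h with h | h
    · exact_mod_cast h
    · exact absurd (quaTheta_injective ha (sub_eq_zero.1 h)) (by decide)
  have hu0 : u = f := by
    have h := huv 0
    rw [hv0, Int.cast_zero, zero_mul, add_zero] at h
    exact_mod_cast h
  have hff : f * f = 1 := by rcases hf with rfl | rfl <;> rfl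
  have hcop : IsCoprime (x - s₁ * y - s₂ * z) z :=
    ⟨f * (x + 2 * s₁ * y + s₂ * z + (2 * s₁ ^ 2 + s₂) * z),
      f * ((s₁ ^ 2 - 2 * s₂) * x + (4 * s₁ * s₂ - s₃) * y + (2 * s₂ ^ 2 - s₁ * s₃ + s₄) * z), by
      rw [hu] at hu0
      rw [hv] at hv0
      linear_combination hff + f * hu0 + f * (2 * s₁ ^ 2 + s₂) * hv0⟩
  obtain ⟨p, q, ε, hε, hx, hy, hz⟩ := exists_sq_of_mul_eq_sq hcop (y := y) (by
    rw [hv] at hv0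
    linear_combination hv0)
  have hεε : (ε : L) * ε = 1 := by rcases hε with rfl | rfl <;> simp
  obtain ⟨r, hr⟩ : ∃ r : ℤ, r = p + s₁ * q := ⟨_, rfl⟩
  have hx' : x = ε * (r ^ 2 - s₁ * r * q + s₂ * q ^ 2) := by
    rw [hr]
    linear_combination hx + s₁ * hy + s₂ * hz
  have hy' : y = ε * (r * q - s₁ * q ^ 2) := by
    rw [hr]
    linear_combination hy
  have hb' : ∀ i, b i = w + ε * (((r ^ 2 - s₁ * r * q + s₂ * q ^ 2 : ℤ) : L) * a i +
      ((r * q - s₁ * q ^ 2 : ℤ) : L) * a i ^ 2 + ((q ^ 2 : ℤ) : L) * a i ^ 3) := fun i => by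
    rw [hb, hx', hy', hz]
    push_cast
    ring
  have hprod : ∏ j, ((r : L) - a j * q) = f := by
    have h := quaE_cubic_of_eq (a := a) (b := fun i => ε * b i) (w := ε * w) (p := r) (q := q)
      rfl rfl rfl (fun i => by
        rw [hb' i, h₁, h₂]
        push_cast
        linear_combination ((r ^ 2 - s₁ * r * q + s₂ * q ^ 2) * a i +
          (r * q - s₁ * q ^ 2) * a i ^ 2 + q ^ 2 * a i ^ 3) * hεε)
    have h' : quaE (fun i => ε * b i) 0 = quaE b 0 := by
      simp only [quaE, Matrix.cons_val]
      linear_combination (b 0 - b 1) * (b 2 - b 3) * hεε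
    rw [h', hE 0, mul_comm] at h
    exact (mul_left_cancel₀ (hE0 0) h).symm
  have hform : r ^ 4 - s₁ * r ^ 3 * q + s₂ * r ^ 2 * q ^ 2 - s₃ * r * q ^ 3 + s₄ * q ^ 4 = f := by
    have : ((r ^ 4 - s₁ * r ^ 3 * q + s₂ * r ^ 2 * q ^ 2 - s₃ * r * q ^ 3 + s₄ * q ^ 4 : ℤ) : L) =
        f := by
      rw [← hprod, Fin.prod_univ_four]
      push_cast
      rw [← h₁, ← h₂, ← h₃, ← h₄]
      ring
    exact_mod_cast this
  have hrq : IsCoprime r q := ⟨f * r ^ 3,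
    f * (-s₁ * r ^ 3 + s₂ * r ^ 2 * q - s₃ * r * q ^ 2 + s₄ * q ^ 3), by
      linear_combination hff + f * hform⟩
  rcases posPair_or_neg hrq with h | h
  · exact ⟨(r, q), h, hrq, hprod, w, ε, hε, hb'⟩
  · refine ⟨(-r, -q), h, hrq.neg_neg, ?_, w, ε, hε, fun i => ?_⟩
    · rw [← hprod]
      simp only [Fin.prod_univ_four]
      push_cast
      ring
    · rw [hb' i]
      push_cast
      ring

theorem card_quartic_fiber_le (φ : L →+* ℂ) {a : Fin 4 → L} (ha : Function.Injective a)
    (ia : ∀ i, IsIntegral ℤ (a i))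
    (hσ : ∀ σ : L ≃ₐ[ℚ] L, ∃ τ : Equiv.Perm (Fin 4), ∀ i, σ (a i) = a (τ i))
    {ι : Type*} {T : Finset ι} {b : ι → Fin 4 → L}
    (hb : ∀ t ∈ T, ∃ w x y z : ℤ, ∀ i, b t i = w + x * a i + y * a i ^ 2 + z * a i ^ 3)
    (hE : ∀ t ∈ T, ∃ f : ℤ, (f = 1 ∨ f = -1) ∧ ∀ i, quaE (b t) i = f * quaE a i)
    (hT : ∀ t ∈ T, ∀ t' ∈ T, (∃ c : ℤ, (∀ i, b t' i = b t i + c) ∨ ∀ i, b t' i = -b t i + c) →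
      t = t') : T.card ≤ 60 := by
  classical
  obtain ⟨s₁, s₂, s₃, s₄, h₁, h₂, h₃, h₄⟩ := exists_int_esymm ia hσ
  have key : ∀ t ∈ T, ∃ (p : ℤ × ℤ) (f : ℤ), (f = 1 ∨ f = -1) ∧ PosPair p ∧
      IsCoprime p.1 p.2 ∧ ∏ j, ((p.1 : L) - a j * p.2) = f ∧
      ∃ w ε : ℤ, (ε = 1 ∨ ε = -1) ∧ ∀ i, b t i = w + ε * (((p.1 ^ 2 - s₁ * p.1 * p.2 +
        s₂ * p.2 ^ 2 : ℤ) : L) * a i + ((p.1 * p.2 - s₁ * p.2 ^ 2 : ℤ) : L) * a i ^ 2 +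
        ((p.2 ^ 2 : ℤ) : L) * a i ^ 3) := by
    intro t ht
    obtain ⟨w, x, y, z, hw⟩ := hb t ht
    obtain ⟨f, hf, hfE⟩ := hE t ht
    obtain ⟨p, h⟩ := exists_quartic_point ha h₁ h₂ h₃ h₄ hw hf hfE
    exact ⟨p, f, hf, h⟩
  choose! g f hf hpos hcop hprod w ε hε hg using key
  have hinj : Set.InjOn g T := by
    intro t ht t' ht' hgt
    refine hT t ht t' ht' ?_
    have e := hg t ht
    have e' := hg t' ht'
    rw [← hgt] at e'
    rcases hε t ht with h | h <;> rcases hε t' ht' with h' | h' <;> rw [h] at e <;>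
      rw [h'] at e'
    · exact ⟨w t' - w t, Or.inl fun i => by rw [e, e']; push_cast; ring⟩
    · exact ⟨w t' + w t, Or.inr fun i => by rw [e, e']; push_cast; ring⟩
    · exact ⟨w t' + w t, Or.inr fun i => by rw [e, e']; push_cast; ring⟩
    · exact ⟨w t' - w t, Or.inl fun i => by rw [e, e']; push_cast; ring⟩
  rw [← Finset.card_image_of_injOn hinj]
  refine card_quartic_le φ ha ia hσ ?_ ?_ ?_
  · simp only [Finset.forall_mem_image]
    exact hcop
  · simp only [Finset.forall_mem_image]
    exact fun t ht => ⟨f t, hf t ht, hprod t ht⟩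
  · simp only [Finset.forall_mem_image]
    exact fun t ht t' ht' hne =>
      (hpos t ht).det_ne_zero (hpos t' ht') (hcop t ht) (hcop t' ht') hne

end Fiber

section Monogenic

variable {L : Type*} [Field L] [CharZero L] [IsGalois ℚ L]

theorem exists_cubic_point {a b : Fin 4 → L}
    {s₁ s₂ s₃ s₄ : ℤ} (h₁ : a 0 + a 1 + a 2 + a 3 = s₁)
    (h₂ : a 0 * a 1 + a 0 * a 2 + a 0 * a 3 + a 1 * a 2 + a 1 * a 3 + a 2 * a 3 = s₂)
    (h₃ : a 0 * a 1 * a 2 + a 0 * a 1 * a 3 + a 0 * a 2 * a 3 + a 1 * a 2 * a 3 = s₃)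
    (h₄ : a 0 * a 1 * a 2 * a 3 = s₄) {w x y z : ℤ}
    (hb : ∀ i, b i = w + x * a i + y * a i ^ 2 + z * a i ^ 3) :
    ∃ u v N : ℤ, (∀ i, quaE b i = quaE a i * (u + v * quaTheta a i)) ∧
      ∏ i, (u + v * quaTheta a i) = N ∧ ∏ i, quaE b i = (∏ i, quaE a i) * N ∧
      (N = 1 ∨ N = -1 → IsCoprime u v) := by
  obtain ⟨t₁, t₂, t₃⟩ := quaTheta_esymm h₁ h₂ h₃ h₄
  obtain ⟨u, hu⟩ : ∃ u : ℤ, u = x ^ 2 + s₁ * x * y + (s₁ ^ 2 - 2 * s₂) * x * z + s₂ * y ^ 2 +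
      (s₁ * s₂ - s₃) * y * z + (s₂ ^ 2 - s₁ * s₃ + s₄) * z ^ 2 := ⟨_, rfl⟩
  obtain ⟨v, hv⟩ : ∃ v : ℤ, v = x * z - y ^ 2 - s₁ * y * z - s₂ * z ^ 2 := ⟨_, rfl⟩
  have hE : ∀ i, quaE b i = quaE a i * (u + v * quaTheta a i) := fun i => by
    rw [quaE_cubic h₁ h₂ h₃ h₄ hb i, hu, hv]
    push_cast
    rfl
  have hN : ∏ i, (u + v * quaTheta a i) = ((u * (u ^ 2 + s₂ * u * v + (s₁ * s₃ - 4 * s₄) * v ^ 2) +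
      v * ((s₃ ^ 2 + s₁ ^ 2 * s₄ - 4 * s₂ * s₄) * v ^ 2) : ℤ) : L) := by
    rw [Fin.prod_univ_three]
    push_cast
    linear_combination (u : L) ^ 2 * v * t₁ + (u : L) * v ^ 2 * t₂ + (v : L) ^ 3 * t₃
  refine ⟨u, v, _, hE, hN, ?_, ?_⟩
  · rw [← hN, ← Finset.prod_mul_distrib]
    exact Finset.prod_congr rfl fun i _ => hE i
  · generalize u ^ 2 + s₂ * u * v + (s₁ * s₃ - 4 * s₄) * v ^ 2 = c,
      (s₃ ^ 2 + s₁ ^ 2 * s₄ - 4 * s₂ * s₄) * v ^ 2 = d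
    rintro (h | h)
    · exact ⟨c, d, by linarith⟩
    · exact ⟨-c, -d, by linarith⟩

/-- Algebraic integers of degree four generating the same ring, up to translation and sign. -/
theorem card_monogenic_le (φ : L →+* ℂ) {ω : L} (hω : ω ^ 2 + ω + 1 = 0) {ι : Type*}
    {T : Finset ι} {b : ι → Fin 4 → L} (hinj : ∀ t ∈ T, Function.Injective (b t))
    (hbint : ∀ t ∈ T, ∀ i, IsIntegral ℤ (b t i))
    (hσ : ∀ t ∈ T, ∀ σ : L ≃ₐ[ℚ] L, ∃ τ : Equiv.Perm (Fin 4), ∀ i, σ (b t i) = b t (τ i))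
    (hb : ∀ s ∈ T, ∀ t ∈ T, ∃ w x y z : ℤ,
      ∀ i, b t i = w + x * b s i + y * b s i ^ 2 + z * b s i ^ 3)
    (hT : ∀ t ∈ T, ∀ t' ∈ T, (∃ c : ℤ, (∀ i, b t' i = b t i + c) ∨ ∀ i, b t' i = -b t i + c) →
      t = t') : T.card ≤ 2640 := by
  classical
  rcases T.eq_empty_or_nonempty with rfl | ⟨s, hs⟩
  · simp
  have hE0 := fun t ht => quaE_ne_zero (hinj t ht)
  obtain ⟨s₁, s₂, s₃, s₄, h₁, h₂, h₃, h₄⟩ := exists_int_esymm (hbint s hs) (hσ s hs)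
  have key : ∀ t ∈ T, ∃ (p : ℤ × ℤ) (N f : ℤ), (N = 1 ∨ N = -1) ∧ (f = 1 ∨ f = -1) ∧
      PosPair p ∧ IsCoprime p.1 p.2 ∧ ∏ i, (p.1 + p.2 * quaTheta (b s) i) = N ∧
      ∀ i, quaE (b t) i = f * (quaE (b s) i * (p.1 + p.2 * quaTheta (b s) i)) := by
    intro t ht
    obtain ⟨w, x, y, z, hw⟩ := hb s hs t ht
    obtain ⟨u, v, N, hE, hN, hEN, hcop⟩ := exists_cubic_point h₁ h₂ h₃ h₄ hw
    obtain ⟨s₁', s₂', s₃', s₄', h₁', h₂', h₃', h₄'⟩ := exists_int_esymm (hbint t ht) (hσ t ht)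
    obtain ⟨w', x', y', z', hw'⟩ := hb t ht s hs
    obtain ⟨u', v', N', -, -, hEN', -⟩ := exists_cubic_point h₁' h₂' h₃' h₄' hw'
    have hNN : N * N' = 1 := by
      have : ((N * N' : ℤ) : L) = 1 := by
        refine mul_left_cancel₀ (Finset.prod_ne_zero_iff.2 fun i _ => hE0 s hs i :
          ∏ i, quaE (b s) i ≠ 0) ?_
        rw [mul_one]
        nth_rewrite 2 [hEN']
        rw [hEN]
        push_cast
        ring
      exact_mod_cast this
    have hN1 : N = 1 ∨ N = -1 := Int.isUnit_iff.1 (.of_mul_eq_one _ hNN)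
    rcases posPair_or_neg (hcop hN1) with h | h
    · exact ⟨(u, v), N, 1, hN1, Or.inl rfl, h, hcop hN1, hN, fun i => by simp [hE i]⟩
    · refine ⟨(-u, -v), -N, -1, by omega, Or.inr rfl, h, (hcop hN1).neg_neg, ?_, fun i => ?_⟩
      · push_cast
        rw [← hN, Fin.prod_univ_three, Fin.prod_univ_three]
        ring
      · rw [hE i]
        push_cast
        ring
  choose! g N f hN hf hpos hcop hprod hE using key
  have hθ := quaTheta_injective (hinj s hs)
  have iθ := isIntegral_quaTheta (hbint s hs)
  obtain ⟨t₁, t₂, t₃⟩ := quaTheta_esymm h₁ h₂ h₃ h₄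
  have hcubic : (T.image g).card ≤ 44 := by
    refine card_cubic_le φ (a := -quaTheta (b s) 0) (b := -quaTheta (b s) 1)
      (c := -quaTheta (b s) 2) (s₁ := -s₂) (s₂ := s₁ * s₃ - 4 * s₄)
      (s₃ := -(s₃ ^ 2 + s₁ ^ 2 * s₄ - 4 * s₂ * s₄)) hω
      (fun h => absurd (hθ (neg_injective h)) (by decide))
      (fun h => absurd (hθ (neg_injective h)) (by decide))
      (fun h => absurd (hθ (neg_injective h)) (by decide)) ?_ ?_ ?_
      (iθ 0).neg (iθ 1).neg (iθ 2).neg ?_ ?_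
    · push_cast
      linear_combination -t₁
    · push_cast
      linear_combination t₂
    · push_cast
      linear_combination -t₃
    · simp only [Finset.forall_mem_image]
      refine fun t ht => ⟨N t, hN t ht, ?_⟩
      rw [← hprod t ht, Fin.prod_univ_three]
      ring
    · simp only [Finset.forall_mem_image]
      exact fun t ht t' ht' hne =>
        (hpos t ht).det_ne_zero (hpos t' ht') (hcop t ht) (hcop t' ht') hne
  have hfiber : ∀ p ∈ T.image g, (T.filter fun t => g t = p).card ≤ 60 := by
    intro p hp
    obtain ⟨t₀, ht₀, rfl⟩ := Finset.mem_image.1 hp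
    have hmem : ∀ t ∈ T.filter (fun t => g t = g t₀), t ∈ T := fun t ht =>
      (Finset.mem_filter.1 ht).1
    refine card_quartic_fiber_le φ (hinj t₀ ht₀) (hbint t₀ ht₀) (hσ t₀ ht₀) (b := b)
      (fun t ht => hb t₀ ht₀ t (hmem t ht)) (fun t ht => ⟨f t * f t₀, ?_, fun i => ?_⟩)
      fun t ht t' ht' => hT t (hmem t ht) t' (hmem t' ht')
    · rcases hf t (hmem t ht) with h | h <;> rcases hf t₀ ht₀ with h' | h' <;> rw [h, h'] <;>
        decide
    · have hff : (f t₀ : L) * f t₀ = 1 := by rcases hf t₀ ht₀ with h | h <;> simp [h]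
      rw [hE t (hmem t ht), hE t₀ ht₀, (Finset.mem_filter.1 ht).2]
      push_cast
      linear_combination -((f t : L) * (quaE (b s) i *
        ((g t₀).1 + (g t₀).2 * quaTheta (b s) i))) * hff
  calc T.card ≤ 60 * (T.image g).card := Finset.card_le_mul_card_image _ _ hfiber
    _ ≤ 60 * 44 := by gcongr
    _ = 2640 := by norm_num

end Monogenic

section Order

open Polynomial

theorem finite_and_card_le_of_finset_card_le {X : Type*} {n : ℕ}
    (h : ∀ s : Finset X, s.card ≤ n) : Finite X ∧ Nat.card X ≤ n := by
  have hf : Finite X := by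
    by_contra hinf
    rw [not_finite_iff_infinite] at hinf
    obtain ⟨s, hs⟩ := Infinite.exists_subset_card_eq X (n + 1)
    have := h s
    omega
  refine ⟨hf, ?_⟩
  have := Fintype.ofFinite X
  rw [Nat.card_eq_fintype_card]
  exact h Finset.univ

variable {K : Type*} [Field K] [NumberField K] {O : Subalgebra ℤ K}

theorem IsMonogenizer.exists_coeff (hK : Module.finrank ℚ K = 4) {α β : K}
    (hα : IsMonogenizer O α) (hbint : IsIntegral ℤ α) (hβ : β ∈ O) :
    ∃ w x y z : ℤ, β = w + x * α + y * α ^ 2 + z * α ^ 3 := by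
  rw [← hα.2, Algebra.adjoin_singleton_eq_range_aeval] at hβ
  obtain ⟨p, rfl⟩ := hβ
  have hmonic := minpoly.monic hbint
  have hdeg : (p %ₘ minpoly ℤ α).natDegree < 4 := by
    refine (natDegree_modByMonic_lt p hmonic (minpoly.ne_one ℤ α)).trans_le ?_
    rw [← hK, ← natDegree_map_eq_of_injective (algebraMap ℤ ℚ).injective_int,
      ← minpoly.isIntegrallyClosed_eq_field_fractions' ℚ hbint]
    exact minpoly.natDegree_le α
  refine ⟨(p %ₘ minpoly ℤ α).coeff 0, (p %ₘ minpoly ℤ α).coeff 1, (p %ₘ minpoly ℤ α).coeff 2,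
    (p %ₘ minpoly ℤ α).coeff 3, ?_⟩
  have h := aeval_modByMonic_eq_self_of_root (p := p) (minpoly.aeval ℤ α)
  change aeval α p = _
  rw [← h, aeval_eq_sum_range' hdeg]
  simp [Finset.sum_range_succ]

theorem IsMonogenizer.injective_embedding {L ι : Type*} [Field L] [CharZero L] {α : K}
    (hα : IsMonogenizer O α) (hOspan : Submodule.span ℚ (O : Set K) = ⊤) {τ : ι → K →ₐ[ℚ] L}
    (hτ : Function.Injective τ) : Function.Injective fun i => τ i α := by
  intro i j hij
  apply hτ
  have hO : ∀ x ∈ O, τ i x = τ j x := by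
    intro x hx
    rw [← hα.2] at hx
    induction hx using Algebra.adjoin_induction with
    | mem x hx =>
      rw [Set.mem_singleton_iff.1 hx]
      exact hij
    | algebraMap r => simp
    | add x y _ _ hx hy => rw [map_add, map_add, hx, hy]
    | mul x y _ _ hx hy => rw [map_mul, map_mul, hx, hy]
  have h := LinearMap.ext_on hOspan (f := (τ i).toLinearMap) (g := (τ j).toLinearMap)
    fun x hx => hO x hx
  exact AlgHom.ext fun x => LinearMap.congr_fun h x

theorem isGalois_algebraicClosure_rat : IsGalois ℚ (AlgebraicClosure ℚ) := by
  have h := @IsAlgClosure.isGalois ℚ (AlgebraicClosure ℚ) _ _ (AlgebraicClosure.instAlgebra ℚ)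
    (@IsAlgClosure.mk _ _ _ _ (AlgebraicClosure.instAlgebra ℚ) _ inferInstance
      (AlgebraicClosure.isAlgebraic ℚ)) _
  convert h
  exact Subsingleton.elim _ _

theorem card_monogenizer_le (hK : Module.finrank ℚ K = 4) (hOint : ∀ x ∈ O, IsIntegral ℤ x)
    (hOspan : Submodule.span ℚ (O : Set K) = ⊤) {T : Finset {x : K // IsMonogenizer O x}}
    (hT : ∀ t ∈ T, ∀ t' ∈ T, MonogenizerRel O t t' → t = t') : T.card ≤ 2640 := by
  let L := AlgebraicClosure ℚ
  have : IsGalois ℚ L := isGalois_algebraicClosure_rat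
  let φ : L →ₐ[ℚ] ℂ := IsAlgClosed.lift
  obtain ⟨ω, hω⟩ : ∃ ω : L, ω ^ 2 + ω + 1 = 0 := by
    obtain ⟨ω, hω⟩ := IsAlgClosed.exists_root (X ^ 2 + X + 1 : L[X]) (by
      rw [show (X ^ 2 + X + 1 : L[X]) = C 1 * X ^ 2 + C 1 * X + C 1 by simp,
        degree_quadratic one_ne_zero]
      decide)
    exact ⟨ω, by simpa using hω⟩
  have hcard : Fintype.card (Fin 4) = Fintype.card (K →ₐ[ℚ] L) := by
    rw [AlgHom.card, hK, Fintype.card_fin]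
  let τ : Fin 4 ≃ (K →ₐ[ℚ] L) := Fintype.equivOfCardEq hcard
  have hbint : ∀ t : {x : K // IsMonogenizer O x}, IsIntegral ℤ (t : K) := fun t =>
    hOint _ t.2.1
  refine card_monogenic_le (φ : L →+* ℂ) hω (b := fun t i => τ i t)
    (fun t _ => t.2.injective_embedding hOspan τ.injective)
    (fun t _ i => (hbint t).map ((τ i : K →+* L).toIntAlgHom)) (fun t _ σ => ?_)
    (fun s _ t _ => ?_) fun t ht t' ht' h => hT t ht t' ht' ?_
  · refine ⟨(τ.trans (AlgEquiv.arrowCongr AlgEquiv.refl σ)).trans τ.symm, fun i => ?_⟩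
    simp [AlgEquiv.arrowCongr]
  · obtain ⟨w, x, y, z, h⟩ := s.2.exists_coeff hK (hbint s) t.2.1
    refine ⟨w, x, y, z, fun i => ?_⟩
    rw [h]
    simp
  · obtain ⟨c, h⟩ := h
    refine ⟨c, h.imp (fun h => ?_) fun h => ?_⟩
    · exact (τ 0).injective (by simpa using h 0)
    · exact (τ 0).injective (by simpa using h 0)

end Order

/-- An order in a quartic number field has at most `2760` monogenizations. -/
theorem monogenizations_of_quartic_order_le_2760
    (K : Type*) [Field K] [NumberField K]
    (hK : Module.finrank ℚ K = 4)
    (O : Subalgebra ℤ K)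
    (hOint : ∀ x ∈ O, IsIntegral ℤ x)
    (hOspan : Submodule.span ℚ (O : Set K) = ⊤) :
    Finite (Monogenizations O) ∧ Nat.card (Monogenizations O) ≤ 2760 := by
  refine finite_and_card_le_of_finset_card_le fun s => ?_
  let out : Monogenizations O → {x : K // IsMonogenizer O x} := Quot.out
  have hout : ∀ q, Quot.mk (MonogenizerRel O) (out q) = q := Quot.out_eq
  have hinj : Function.Injective out := Function.LeftInverse.injective hout
  rw [← Finset.card_map ⟨out, hinj⟩]
  refine (card_monogenizer_le hK hOint hOspan ?_).trans (by norm_num)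
  simp only [Finset.mem_map, Function.Embedding.coeFn_mk]
  rintro _ ⟨q, -, rfl⟩ _ ⟨q', -, rfl⟩ h
  rw [← hout q, ← hout q', Quot.sound h]
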